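/- arXiv:2404.05867 — 6 statements merged into one kernel-verified Lean document; each statement's English description precedes it below -/
import Mathlib

section
/- Let ρ_AB be a density matrix on H_A ⊗ H_B, let ρ_B denote its partial trace over A, let P_AB be the orthogonal projection onto the support of ρ_AB, and let P_B be the orthogonal projection onto the support of ρ_B. Then P_AB commutes with 1_A ⊗ P_B, i.e. [1_A ⊗ P_B, P_AB] = 0. -/
open Matrix Kronecker BigOperators
open scoped ComplexOrder

/-- A density matrix: a positive semidefinite matrix of trace one. -/
def IsDensityMatrix {n : Type*} [Fintype n] (ρ : Matrix n n ℂ) : Prop :=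
  ρ.PosSemidef ∧ ρ.trace = 1

/-- `P` is the orthogonal projection onto the support of `ρ`, i.e. `P` is a Hermitian
idempotent whose kernel is exactly the kernel of `ρ` (so its range is the orthogonal
complement of `ker ρ`). -/
def IsSupportProj {n : Type*} [Fintype n] (ρ P : Matrix n n ℂ) : Prop :=
  P.IsHermitian ∧ P * P = P ∧ ∀ v : n → ℂ, ρ.mulVec v = 0 ↔ P.mulVec v = 0

/-- A vector in the kernel of the partial trace of a positive semidefinite matrix gives, tensored
with any basis vector, a vector in the kernel of the matrix. -/
theorem Matrix.PosSemidef.mulVec_single_tensor_eq_zero {A B : Type*} [Fintype A] [DecidableEq A]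
    [Fintype B] {ρ : Matrix (A × B) (A × B) ℂ} (hρ : ρ.PosSemidef) {v : B → ℂ}
    (hv : (Matrix.of fun b b' => ∑ a : A, ρ (a, b) (a, b')) *ᵥ v = 0) (a : A) :
    ρ *ᵥ (fun p => if p.1 = a then v p.2 else 0) = 0 := by
  set w : A → A × B → ℂ := fun a p => if p.1 = a then v p.2 else 0
  have expand (a : A) : star (w a) ⬝ᵥ (ρ *ᵥ w a) =
      ∑ b, ∑ b', star (v b) * (ρ (a, b) (a, b') * v b') := by
    simp [w, dotProduct, mulVec, Fintype.sum_prod_type_right, Finset.mul_sum, apply_ite]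
  have hsum : ∑ a, star (w a) ⬝ᵥ (ρ *ᵥ w a) = 0 := by
    calc ∑ a, star (w a) ⬝ᵥ (ρ *ᵥ w a)
        = star v ⬝ᵥ ((Matrix.of fun b b' => ∑ a : A, ρ (a, b) (a, b')) *ᵥ v) := by
          simp_rw [expand]
          simp only [dotProduct, mulVec, Matrix.of_apply, Finset.sum_mul, Finset.mul_sum,
            Pi.star_apply]
          rw [Finset.sum_comm]
          exact Finset.sum_congr rfl fun _ _ => Finset.sum_comm
      _ = 0 := by rw [hv, dotProduct_zero]
  rw [Finset.sum_eq_zero_iff_of_nonneg fun a _ => hρ.dotProduct_mulVec_nonneg (w a)] at hsum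
  exact (hρ.dotProduct_mulVec_zero_iff (w a)).1 (hsum a (Finset.mem_univ a))

/-- For a density matrix `ρ` on `H_A ⊗ H_B` with reduced state `ρ_B`,
the projection onto the support of `ρ` commutes with `1_A ⊗ P_B`, where `P_B` projects
onto the support of `ρ_B`. -/
theorem support_proj_commutes_with_ampliated_marginal_proj
    {A B : Type*} [Fintype A] [DecidableEq A] [Fintype B] [DecidableEq B]
    (ρ : Matrix (A × B) (A × B) ℂ) (hρ : IsDensityMatrix ρ)
    (ρB : Matrix B B ℂ)
    (hρB : ρB = Matrix.of fun b b' => ∑ a : A, ρ (a, b) (a, b'))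
    (PAB : Matrix (A × B) (A × B) ℂ) (hPAB : IsSupportProj ρ PAB)
    (PB : Matrix B B ℂ) (hPB : IsSupportProj ρB PB) :
    ((1 : Matrix A A ℂ) ⊗ₖ PB) * PAB - PAB * ((1 : Matrix A A ℂ) ⊗ₖ PB) = 0 := by
  subst hρB
  obtain ⟨hAB, -, hABker⟩ := hPAB
  obtain ⟨hB, hBB, hBker⟩ := hPB
  have hcol (b : B) : PB *ᵥ (fun b' => (1 - PB) b' b) = 0 := by
    have h : PB * (1 - PB) = 0 := by rw [mul_sub, mul_one, hBB, sub_self]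
    ext b''
    exact congrFun (congrFun h b'') b
  have hzero : PAB * ((1 : Matrix A A ℂ) ⊗ₖ (1 - PB)) = 0 := by
    ext p ⟨a, b⟩
    have h := congrFun ((hABker _).1
      (hρ.1.mulVec_single_tensor_eq_zero ((hBker _).2 (hcol b)) a)) p
    simpa [Matrix.mul_apply, mulVec, dotProduct, Matrix.one_apply] using h
  have hright : PAB * ((1 : Matrix A A ℂ) ⊗ₖ PB) = PAB := by
    have hsplit : (1 : Matrix A A ℂ) ⊗ₖ (1 - PB) + (1 : Matrix A A ℂ) ⊗ₖ PB = 1 := by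
      rw [← kronecker_add, sub_add_cancel, one_kronecker_one]
    rw [← eq_sub_iff_add_eq] at hsplit
    rw [hsplit, mul_sub, mul_one, sub_eq_zero] at hzero
    exact hzero.symm
  have hleft : ((1 : Matrix A A ℂ) ⊗ₖ PB) * PAB = PAB := by
    simpa [conjTranspose_mul, conjTranspose_kronecker, hAB.eq, hB.eq] using
      congrArg conjTranspose hright
  rw [hleft, hright, sub_self]
end

section
/- Let ρ_ABC be a density matrix on H_A ⊗ H_B ⊗ H_C satisfying I(A:C|B)_ρ = 0. Let P_AB and P_BC be the orthogonal projections onto the supports of the reduced density matrices ρ_AB and ρ_BC. Then P_AB ⊗ 1_C commutes with 1_A ⊗ P_BC: [P_AB ⊗ 1_C, 1_A ⊗ P_BC] = 0. -/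
open Matrix Kronecker BigOperators
open scoped ComplexOrder

/-- The von Neumann entropy `S(ρ) = -Tr(ρ log ρ)`, computed via the eigenvalues of a
Hermitian matrix (with the convention `0 log 0 = 0`). -/
noncomputable def vNEntropy {n : Type*} [Fintype n] [DecidableEq n]
    (ρ : Matrix n n ℂ) : ℝ :=
  if h : ρ.IsHermitian then -∑ i, h.eigenvalues i * Real.log (h.eigenvalues i) else 0

/-- Reduced density matrix on `A × B` (partial trace over `C`). -/
noncomputable def margAB {A B C : Type*} [Fintype C]
    (ρ : Matrix (A × B × C) (A × B × C) ℂ) : Matrix (A × B) (A × B) ℂ :=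
  Matrix.of fun p q => ∑ c : C, ρ (p.1, p.2, c) (q.1, q.2, c)

/-- Reduced density matrix on `B × C` (partial trace over `A`). -/
noncomputable def margBC {A B C : Type*} [Fintype A]
    (ρ : Matrix (A × B × C) (A × B × C) ℂ) : Matrix (B × C) (B × C) ℂ :=
  Matrix.of fun p q => ∑ a : A, ρ (a, p) (a, q)

/-- Reduced density matrix on `B` (partial trace over `A` and `C`). -/
noncomputable def margB {A B C : Type*} [Fintype A] [Fintype C]
    (ρ : Matrix (A × B × C) (A × B × C) ℂ) : Matrix B B ℂ :=
  Matrix.of fun b b' => ∑ a : A, ∑ c : C, ρ (a, b, c) (a, b', c)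

/-- Conditional mutual information `I(A:C|B) = S(AB) + S(BC) - S(B) - S(ABC)`. -/
noncomputable def CMI {A B C : Type*} [Fintype A] [DecidableEq A]
    [Fintype B] [DecidableEq B] [Fintype C] [DecidableEq C]
    (ρ : Matrix (A × B × C) (A × B × C) ℂ) : ℝ :=
  vNEntropy (margAB ρ) + vNEntropy (margBC ρ) - vNEntropy (margB ρ) - vNEntropy ρ

/-- Convex interpolation turns the logarithm into an antiderivative of the resolvent. -/
lemma hasDerivAt_mul_log_interp {w r s u : ℝ} (hr : 0 ≤ r) (hs : 0 ≤ s)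
    (h : w ≠ 0 → r ≠ 0 → s ≠ 0) (hu : 0 < u) (hu1 : u < 1) :
    HasDerivAt (fun u => w * r * Real.log ((1 - u) * s + u * r))
      ((1 - u)⁻¹ * (w * r ^ 2 / ((1 - u) * s + u * r) - w * r)) u := by
  by_cases hw : w = 0
  · simpa [hw] using hasDerivAt_const u (0 : ℝ)
  by_cases hr0 : r = 0
  · simpa [hr0] using hasDerivAt_const u (0 : ℝ)
  have hs' : 0 < s := lt_of_le_of_ne hs (Ne.symm (h hw hr0))
  have hr' : 0 < r := lt_of_le_of_ne hr (Ne.symm hr0)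
  have hu2 : 0 < 1 - u := by linarith
  have hm : 0 < (1 - u) * s + u * r := by positivity
  have h1 : HasDerivAt (fun u : ℝ => (1 - u) * s + u * r) (-1 * s + 1 * r) u :=
    (((hasDerivAt_id u).const_sub 1).mul_const s).add ((hasDerivAt_id u).mul_const r)
  refine ((h1.log hm.ne').const_mul (w * r)).congr_deriv ?_
  field_simp
  ring

lemma continuousOn_mul_log_interp {w r s : ℝ} (hr : 0 ≤ r) (hs : 0 ≤ s)
    (h : w ≠ 0 → r ≠ 0 → s ≠ 0) :
    ContinuousOn (fun u => w * r * Real.log ((1 - u) * s + u * r)) (Set.Icc 0 1) := by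
  by_cases hw : w = 0
  · simpa [hw] using continuousOn_const
  by_cases hr0 : r = 0
  · simpa [hr0] using continuousOn_const
  have hs' : 0 < s := lt_of_le_of_ne hs (Ne.symm (h hw hr0))
  have hr' : 0 < r := lt_of_le_of_ne hr (Ne.symm hr0)
  refine continuousOn_const.mul (ContinuousOn.log (by fun_prop) fun u hu => ?_)
  rcases eq_or_lt_of_le hu.1 with rfl | hu0
  · simpa using hs'.ne'
  · have : 0 ≤ (1 - u) * s := mul_nonneg (by linarith [hu.2]) hs
    have : 0 < u * r := mul_pos hu0 hr'
    positivity

lemma sum_resolvent_rescale {K : Type*} [Fintype K] (w r s : K → ℝ) {u : ℝ} (hu1 : u < 1) :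
    ∑ i, w i * r i ^ 2 / ((1 - u) * s i + u * r i)
      = (1 - u)⁻¹ * ∑ i, w i * r i ^ 2 / (s i + (u / (1 - u)) * r i) := by
  have : (1 - u) ≠ 0 := by linarith
  rw [Finset.mul_sum]
  refine Finset.sum_congr rfl fun i _ => ?_
  have e : (1 - u) * s i + u * r i = (1 - u) * (s i + (u / (1 - u)) * r i) := by
    field_simp
  rw [e, mul_comm (1 - u), ← div_div]
  ring

/-- If two weighted logarithmic sums agree while the associated resolvent sums are ordered,
then the resolvent sums agree. -/
lemma sum_resolvent_eq_of_sum_log_eq {I J : Type*} [Fintype I] [Fintype J]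
    {w r s : I → ℝ} {w' r' s' : J → ℝ}
    (hr : ∀ i, 0 ≤ r i) (hs : ∀ i, 0 ≤ s i) (h : ∀ i, w i ≠ 0 → r i ≠ 0 → s i ≠ 0)
    (hr' : ∀ i, 0 ≤ r' i) (hs' : ∀ i, 0 ≤ s' i) (h' : ∀ i, w' i ≠ 0 → r' i ≠ 0 → s' i ≠ 0)
    (hsum : ∑ i, w i * r i = ∑ i, w' i * r' i)
    (hlog : ∑ i, w i * r i * (Real.log (r i) - Real.log (s i))
      = ∑ i, w' i * r' i * (Real.log (r' i) - Real.log (s' i)))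
    (hle : ∀ t > 0, ∑ i, w' i * r' i ^ 2 / (s' i + t * r' i)
      ≤ ∑ i, w i * r i ^ 2 / (s i + t * r i)) (t : ℝ) (ht : 0 < t) :
    ∑ i, w i * r i ^ 2 / (s i + t * r i) = ∑ i, w' i * r' i ^ 2 / (s' i + t * r' i) := by
  set g : ℝ → ℝ := fun u => (∑ i, w i * r i * Real.log ((1 - u) * s i + u * r i))
    - ∑ i, w' i * r' i * Real.log ((1 - u) * s' i + u * r' i) with hg
  have hd : ∀ u, 0 < u → u < 1 → HasDerivAt g ((1 - u)⁻¹ * ((1 - u)⁻¹ *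
      ((∑ i, w i * r i ^ 2 / (s i + (u / (1 - u)) * r i))
        - ∑ i, w' i * r' i ^ 2 / (s' i + (u / (1 - u)) * r' i)))) u := by
    intro u hu hu1
    have h1 := HasDerivAt.fun_sum (u := Finset.univ) fun i _ =>
      hasDerivAt_mul_log_interp (w := w i) (hr i) (hs i) (h i) hu hu1
    have h2 := HasDerivAt.fun_sum (u := Finset.univ) fun i _ =>
      hasDerivAt_mul_log_interp (w := w' i) (hr' i) (hs' i) (h' i) hu hu1
    refine (h1.sub h2).congr_deriv ?_
    rw [← Finset.mul_sum, ← Finset.mul_sum, ← mul_sub, Finset.sum_sub_distrib,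
      Finset.sum_sub_distrib, sum_resolvent_rescale _ _ _ hu1, sum_resolvent_rescale _ _ _ hu1, hsum]
    ring
  have hc : ContinuousOn g (Set.Icc 0 1) :=
    (continuousOn_finsetSum _ fun i _ => continuousOn_mul_log_interp (hr i) (hs i) (h i)).sub
      (continuousOn_finsetSum _ fun i _ => continuousOn_mul_log_interp (hr' i) (hs' i) (h' i))
  have hmono : MonotoneOn g (Set.Icc 0 1) := by
    refine monotoneOn_of_deriv_nonneg (convex_Icc 0 1) hc ?_ ?_
    · intro u hu
      rw [interior_Icc] at hu
      exact (hd u hu.1 hu.2).differentiableAt.differentiableWithinAt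
    · intro u hu
      rw [interior_Icc] at hu
      rw [(hd u hu.1 hu.2).deriv]
      have h1 : 0 < 1 - u := by linarith [hu.2]
      have := hle (u / (1 - u)) (div_pos hu.1 h1)
      exact mul_nonneg (by positivity) (mul_nonneg (by positivity) (by linarith))
  have h01 : g 0 = g 1 := by
    simp only [mul_sub, Finset.sum_sub_distrib] at hlog
    simp only [hg, sub_zero, one_mul, zero_mul, add_zero, sub_self, zero_add]
    linarith
  have hu0 : 0 < t / (1 + t) := by positivity
  have hu1 : t / (1 + t) < 1 := by rw [div_lt_one (by positivity)]; linarith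
  have key := hd _ hu0 hu1
  have hconst : g =ᶠ[nhds (t / (1 + t))] fun _ => g 0 := by
    filter_upwards [Ioo_mem_nhds hu0 hu1] with u hu
    refine le_antisymm ?_ ?_
    · rw [h01]; exact hmono ⟨hu.1.le, hu.2.le⟩ (by simp) hu.2.le
    · exact hmono (by simp) ⟨hu.1.le, hu.2.le⟩ hu.1.le
  have key' := key.unique ((hasDerivAt_const _ (g 0)).congr_of_eventuallyEq hconst)
  have hne : (1 - t / (1 + t))⁻¹ ≠ 0 := inv_ne_zero (by linarith)
  have e : t / (1 + t) / (1 - t / (1 + t)) = t := by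
    have : 1 + t ≠ 0 := by positivity
    have h2 : 1 - t / (1 + t) = 1 / (1 + t) := by field_simp; ring
    rw [h2]; field_simp
  rw [e] at key'
  simpa [hne, sub_eq_zero] using key'

/-- A linear relation satisfied by a linearly independent family of functions at finitely many
points is satisfied by every function. -/
lemma sum_mul_eq_zero_of_linearIndependent {S T I : Type*} [Fintype I] {φ : S → T → ℂ}
    (hφ : LinearIndependent ℂ φ) {c : I → ℂ} {x : I → S}
    (h : ∀ t, ∑ i, c i * φ (x i) t = 0) (f : S → ℂ) : ∑ i, c i * f (x i) = 0 := by
  have h1 : Finsupp.linearCombination ℂ φ (∑ i, Finsupp.single (x i) (c i)) = 0 := by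
    funext t
    simpa [map_sum, Finsupp.linearCombination_single, Finset.sum_apply] using h t
  have h2 := (linearIndependent_iff.mp hφ) _ h1
  simpa [map_sum, Finsupp.linearCombination_single] using
    congrArg (Finsupp.linearCombination ℂ f) h2

lemma linearIndependent_resolvent :
    LinearIndependent ℂ
      (fun (x : {x : ℝ // 0 ≤ x}) (t : {t : ℝ // 0 < t}) => (((x : ℝ) + t : ℝ) : ℂ)⁻¹) := by
  classical
  rw [linearIndependent_iff']
  intro S c h k hk
  let p : Polynomial ℂ := ∑ i ∈ S, Polynomial.C (c i) *
    ∏ j ∈ S.erase i, (Polynomial.X + Polynomial.C ((j : ℝ) : ℂ))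
  have hp : p = 0 := by
    refine Polynomial.eq_zero_of_infinite_isRoot _ (Set.Infinite.mono (s :=
      (fun t : ℝ => (t : ℂ)) '' Set.Ioi 0) ?_ ((Set.Ioi_infinite 0).image
        Complex.ofReal_injective.injOn))
    rintro _ ⟨t, ht, rfl⟩
    have ht' : 0 < t := ht
    have hne : ∀ j ∈ S, ((t : ℂ) + ((j : ℝ) : ℂ)) ≠ 0 := by
      intro j _
      have := j.2
      have h1 : t + (j : ℝ) ≠ 0 := by positivity
      exact_mod_cast h1
    have ht2 := congrFun h ⟨t, ht⟩
    simp only [Finset.sum_apply, Pi.smul_apply, smul_eq_mul, Pi.zero_apply] at ht2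
    simp only [Set.mem_ofPred_eq, Polynomial.IsRoot, p, Polynomial.eval_finsetSum,
      Polynomial.eval_mul, Polynomial.eval_prod, Polynomial.eval_add, Polynomial.eval_X,
      Polynomial.eval_C]
    calc _ = ∑ i ∈ S, (∏ j ∈ S, ((t : ℂ) + ((j : ℝ) : ℂ)))
          * (c i * (((i : ℝ) + t : ℝ) : ℂ)⁻¹) := by
            refine Finset.sum_congr rfl fun i hi => ?_
            rw [← Finset.mul_prod_erase S _ hi]
            have := hne i hi
            push_cast
            rw [add_comm ((i : ℝ) : ℂ)]
            field_simp
      _ = 0 := by rw [← Finset.mul_sum, ht2, mul_zero]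
  have he := congrArg (Polynomial.eval (-((k : ℝ) : ℂ))) hp
  simp only [p, Polynomial.eval_finsetSum,
      Polynomial.eval_mul, Polynomial.eval_prod, Polynomial.eval_add, Polynomial.eval_X,
      Polynomial.eval_C, Polynomial.eval_zero] at he
  rw [Finset.sum_eq_single k] at he
  · rcases mul_eq_zero.mp he with h0 | h0
    · exact h0
    · obtain ⟨j, hj, hj0⟩ := Finset.prod_eq_zero_iff.mp h0
      exfalso
      refine (Finset.mem_erase.mp hj).1 (Subtype.ext ?_)
      have : ((j : ℝ) : ℂ) = ((k : ℝ) : ℂ) := by linear_combination hj0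
      exact_mod_cast this
  · intro j _ hjk
    rw [Finset.prod_eq_zero (Finset.mem_erase.mpr ⟨Ne.symm hjk, hk⟩) (by simp), mul_zero]
  · exact fun hk' => absurd hk hk'

lemma linearIndependent_imaginary_power :
    LinearIndependent ℂ
      (fun (x : {x : ℝ // 0 < x}) (θ : ℝ) => Complex.exp (θ * Real.log x * Complex.I)) := by
  let χ : {x : ℝ // 0 < x} → (Multiplicative ℝ →* ℂ) := fun x =>
    { toFun := fun θ => Complex.exp ((Multiplicative.toAdd θ : ℝ) * Real.log x * Complex.I)
      map_one' := by simp
      map_mul' := fun a b => by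
        rw [← Complex.exp_add, toAdd_mul]
        push_cast
        ring_nf }
  have hχ : Function.Injective χ := by
    intro x y hxy
    by_contra hne
    have hl : Real.log x - Real.log y ≠ 0 := by
      intro h0
      exact hne (Subtype.ext (Real.log_injOn_pos x.2 y.2 (sub_eq_zero.mp h0)))
    have h1 := DFunLike.congr_fun hxy
      (Multiplicative.ofAdd (Real.pi / (Real.log x - Real.log y)))
    have h2 : Complex.exp ((Real.pi / (Real.log x - Real.log y) : ℝ) * Real.log x * Complex.I)
      = Complex.exp ((Real.pi / (Real.log x - Real.log y) : ℝ) * Real.log y * Complex.I) := h1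
    have h3 : (((Real.pi / (Real.log x - Real.log y) : ℝ) * Real.log x * Complex.I : ℂ))
        = (Real.pi / (Real.log x - Real.log y) : ℝ) * Real.log y * Complex.I
          + Real.pi * Complex.I := by
      have : ((Real.pi : ℝ) : ℂ) = (((Real.pi / (Real.log x - Real.log y))
          * (Real.log x - Real.log y) : ℝ) : ℂ) := by
        rw [div_mul_cancel₀ _ hl]
      rw [this]
      push_cast
      ring
    rw [h3, Complex.exp_add, Complex.exp_pi_mul_I] at h2
    have h4 := Complex.exp_ne_zero
      ((Real.pi / (Real.log x - Real.log y) : ℝ) * Real.log y * Complex.I)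
    apply h4
    linear_combination (-1 / 2 : ℂ) * h2
  exact (linearIndependent_monoidHom (Multiplicative ℝ) ℂ).comp χ hχ

/-- A decomposition of a positive semidefinite matrix as a combination of mutually orthogonal
projections summing to one, with nonnegative coefficients. -/
structure SpectralResolution {n : Type*} [Fintype n] [DecidableEq n] (I : Type*) [Fintype I]
    [DecidableEq I] (M : Matrix n n ℂ) where
  val : I → ℝ
  proj : I → Matrix n n ℂ
  val_nonneg : ∀ i, 0 ≤ val i
  proj_conjTranspose : ∀ i, (proj i)ᴴ = proj i
  proj_mul : ∀ i j, proj i * proj j = if i = j then proj i else 0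
  sum_proj : ∑ i, proj i = 1
  sum_smul : ∑ i, (val i : ℂ) • proj i = M

/-- The indicator function of the nonzero reals. -/
noncomputable def suppInd (x : ℝ) : ℂ := if x = 0 then 0 else 1

namespace SpectralResolution

variable {n m I J : Type*} [Fintype n] [DecidableEq n] [Fintype m] [DecidableEq m]
  [Fintype I] [DecidableEq I] [Fintype J] [DecidableEq J]
  {M N : Matrix n n ℂ}

/-- Functional calculus along a spectral resolution. -/
noncomputable def fc (R : SpectralResolution I M) (f : ℝ → ℂ) : Matrix n n ℂ :=
  ∑ i, f (R.val i) • R.proj i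

/-- The image of a spectral resolution under a `⋆`-homomorphism. -/
noncomputable def map (R : SpectralResolution I M) (ι : Matrix n n ℂ →⋆ₐ[ℂ] Matrix m m ℂ) :
    SpectralResolution I (ι M) where
  val := R.val
  proj i := ι (R.proj i)
  val_nonneg := R.val_nonneg
  proj_conjTranspose i := by
    rw [← star_eq_conjTranspose, ← map_star, star_eq_conjTranspose, R.proj_conjTranspose]
  proj_mul i j := by
    rw [← map_mul, R.proj_mul]
    split_ifs <;> simp
  sum_proj := by rw [← map_sum, R.sum_proj, map_one]
  sum_smul := by
    conv_rhs => rw [← R.sum_smul]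
    rw [map_sum]
    exact Finset.sum_congr rfl fun i _ => (map_smul ι (R.val i : ℂ) (R.proj i)).symm

lemma map_fc (R : SpectralResolution I M) (ι : Matrix n n ℂ →⋆ₐ[ℂ] Matrix m m ℂ) (f : ℝ → ℂ) :
    (R.map ι).fc f = ι (R.fc f) := by
  simp [fc, map, map_sum]

lemma fc_congr (R : SpectralResolution I M) {f g : ℝ → ℂ} (h : ∀ x, 0 ≤ x → f x = g x) :
    R.fc f = R.fc g :=
  Finset.sum_congr rfl fun i _ => by rw [h _ (R.val_nonneg i)]

lemma fc_ofReal (R : SpectralResolution I M) : R.fc (fun x => x) = M := R.sum_smul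

lemma fc_one (R : SpectralResolution I M) : R.fc (fun _ => 1) = 1 := by
  simp [fc, R.sum_proj]

lemma proj_mul_fc (R : SpectralResolution I M) (i : I) (f : ℝ → ℂ) :
    R.proj i * R.fc f = f (R.val i) • R.proj i := by
  simp [fc, Finset.mul_sum, R.proj_mul]

lemma fc_mul_proj (R : SpectralResolution I M) (i : I) (f : ℝ → ℂ) :
    R.fc f * R.proj i = f (R.val i) • R.proj i := by
  simp [fc, Finset.sum_mul, R.proj_mul]

lemma fc_mul_fc (R : SpectralResolution I M) (f g : ℝ → ℂ) :
    R.fc f * R.fc g = R.fc fun x => f x * g x := by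
  conv_lhs => rw [fc, Finset.sum_mul]
  simp only [smul_mul_assoc, proj_mul_fc, smul_smul]
  rfl

lemma conjTranspose_fc (R : SpectralResolution I M) (f : ℝ → ℂ) :
    (R.fc f)ᴴ = R.fc fun x => star (f x) := by
  simp [fc, conjTranspose_sum, conjTranspose_smul, R.proj_conjTranspose]

lemma conjTranspose_fc_suppInd (R : SpectralResolution I M) :
    (R.fc suppInd)ᴴ = R.fc suppInd := by
  rw [conjTranspose_fc]
  congr 1
  funext x
  simp only [suppInd]
  split_ifs <;> simp

lemma fc_suppInd_mul (R : SpectralResolution I M) : R.fc suppInd * M = M := by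
  conv_lhs => enter [2]; rw [← R.fc_ofReal]
  rw [fc_mul_fc]
  conv_rhs => rw [← R.fc_ofReal]
  congr 1
  funext x
  by_cases hx : x = 0 <;> simp [suppInd, hx]

lemma mul_fc_inv (R : SpectralResolution I M) :
    M * R.fc (fun x => (x : ℂ)⁻¹) = R.fc suppInd := by
  conv_lhs => enter [1]; rw [← R.fc_ofReal]
  rw [fc_mul_fc]
  congr 1
  funext x
  by_cases hx : x = 0 <;> simp [suppInd, hx]

lemma fc_inv_mul (R : SpectralResolution I M) :
    R.fc (fun x => (x : ℂ)⁻¹) * M = R.fc suppInd := by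
  conv_lhs => enter [2]; rw [← R.fc_ofReal]
  rw [fc_mul_fc]
  congr 1
  funext x
  by_cases hx : x = 0 <;> simp [suppInd, hx]

lemma isHermitian (R : SpectralResolution I M) : Mᴴ = M := by
  conv_lhs => rw [← R.fc_ofReal, conjTranspose_fc]
  conv_rhs => rw [← R.fc_ofReal]
  simp

lemma exists_factor (R : SpectralResolution I M) : ∃ B : Matrix n n ℂ, Bᴴ = B ∧ M = B * B := by
  refine ⟨R.fc fun x => (Real.sqrt x : ℂ), by simp [conjTranspose_fc], ?_⟩
  rw [fc_mul_fc]
  conv_lhs => rw [← R.fc_ofReal]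
  refine R.fc_congr fun x hx => ?_
  rw [← Complex.ofReal_mul, Real.mul_self_sqrt hx]

lemma posSemidef (R : SpectralResolution I M) : M.PosSemidef := by
  obtain ⟨B, hB, rfl⟩ := R.exists_factor
  conv => enter [1, 1]; rw [← hB]
  exact posSemidef_conjTranspose_mul_self B

/-- A matrix annihilating `M` in the trace sense annihilates `M`. -/
lemma mul_eq_zero_of_trace (R : SpectralResolution I M) {E : Matrix n n ℂ}
    (h : (E * M * Eᴴ).trace = 0) : E * M = 0 := by
  obtain ⟨B, hB, rfl⟩ := R.exists_factor
  have : ((E * B) * (E * B)ᴴ).trace = 0 := by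
    rw [conjTranspose_mul, hB, ← h]
    simp only [Matrix.mul_assoc]
  rw [trace_mul_conjTranspose_self_eq_zero_iff] at this
  rw [← Matrix.mul_assoc, this, Matrix.zero_mul]

/-- Double functional calculus along two spectral resolutions (left and right). -/
noncomputable def schur (S : SpectralResolution J N) (R : SpectralResolution I M)
    (φ : ℝ → ℝ → ℂ) : Matrix n n ℂ :=
  ∑ p : J × I, φ (S.val p.1) (R.val p.2) • (S.proj p.1 * R.proj p.2)

lemma schur_congr (S : SpectralResolution J N) (R : SpectralResolution I M)
    {φ ψ : ℝ → ℝ → ℂ} (h : ∀ x y, 0 ≤ x → 0 ≤ y → φ x y = ψ x y) :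
    S.schur R φ = S.schur R ψ :=
  Finset.sum_congr rfl fun p _ => by rw [h _ _ (S.val_nonneg _) (R.val_nonneg _)]

lemma fc_mul_fc_eq_schur (S : SpectralResolution J N) (R : SpectralResolution I M)
    (f g : ℝ → ℂ) : S.fc f * R.fc g = S.schur R fun x y => f x * g y := by
  simp only [fc, schur, Finset.sum_mul_sum, Fintype.sum_prod_type, smul_mul_smul_comm]

lemma mul_schur (S : SpectralResolution J N) (R : SpectralResolution I M) (φ : ℝ → ℝ → ℂ) :
    N * S.schur R φ = S.schur R fun x y => x * φ x y := by
  conv_lhs => enter [1]; rw [← S.fc_ofReal]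
  simp only [schur, Finset.mul_sum, mul_smul_comm, ← Matrix.mul_assoc, fc_mul_proj,
    smul_mul_assoc, smul_smul, mul_comm]

lemma schur_mul (S : SpectralResolution J N) (R : SpectralResolution I M) (φ : ℝ → ℝ → ℂ) :
    S.schur R φ * M = S.schur R fun x y => φ x y * y := by
  conv_lhs => enter [2]; rw [← R.fc_ofReal]
  simp only [schur, Finset.sum_mul, mul_smul_comm, Matrix.mul_assoc, proj_mul_fc,
    smul_mul_assoc, smul_smul]

lemma schur_one (S : SpectralResolution J N) (R : SpectralResolution I M) :
    S.schur R (fun _ _ => 1) = 1 := by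
  have := fc_mul_fc_eq_schur S R (fun _ => 1) (fun _ => 1)
  rw [fc_one, fc_one, mul_one] at this
  simpa using this.symm

/-- The resolvent of the pair of left and right multiplications, applied to `M`. -/
noncomputable def resolvent (S : SpectralResolution J N) (R : SpectralResolution I M) (t : ℝ) :
    Matrix n n ℂ :=
  S.schur R fun x y => ((y / (x + t * y) : ℝ) : ℂ)

lemma resolvent_spec (S : SpectralResolution J N) (R : SpectralResolution I M) {t : ℝ}
    (ht : 0 < t) : N * S.resolvent R t + (t : ℂ) • (S.resolvent R t * M) = M := by
  have h1 : M = S.schur R fun _ y => y := by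
    have := fc_mul_fc_eq_schur S R (fun _ => 1) (fun y => y)
    rw [fc_one, fc_ofReal, one_mul] at this
    simpa using this
  conv_rhs => rw [h1]
  rw [resolvent, mul_schur, schur_mul, schur, schur, schur, Finset.smul_sum,
    ← Finset.sum_add_distrib]
  refine Finset.sum_congr rfl fun p _ => ?_
  rw [smul_smul, ← add_smul]
  congr 1
  have hx := S.val_nonneg p.1
  have hy := R.val_nonneg p.2
  generalize S.val p.1 = x at *
  generalize R.val p.2 = y at *
  rcases eq_or_lt_of_le hy with rfl | hy
  · simp
  · have : x + t * y ≠ 0 := by positivity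
    norm_cast
    field_simp

/-- The overlaps of two families of projections. -/
noncomputable def overlap (S : SpectralResolution J N) (R : SpectralResolution I M)
    (p : J × I) : ℝ := (S.proj p.1 * R.proj p.2).trace.re

lemma re_trace_mul_schur (S : SpectralResolution J N) (R : SpectralResolution I M)
    (φ : ℝ → ℝ → ℝ) : (M * S.schur R fun x y => φ x y).trace.re
      = ∑ p, S.overlap R p * R.val p.2 * φ (S.val p.1) (R.val p.2) := by
  rw [trace_mul_comm, schur_mul, schur, trace_sum, Complex.re_sum]
  refine Finset.sum_congr rfl fun p _ => ?_
  rw [trace_smul, ← Complex.ofReal_mul, smul_eq_mul, Complex.re_ofReal_mul, overlap]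
  ring

lemma val_ne_zero_of_overlap_ne_zero (S : SpectralResolution J N) (R : SpectralResolution I M)
    (hsupp : S.fc suppInd * M = M) (p : J × I) (hp : S.overlap R p ≠ 0)
    (hr : R.val p.2 ≠ 0) : S.val p.1 ≠ 0 := by
  intro hs
  have h1 : S.proj p.1 * M = 0 := by
    rw [← hsupp, ← Matrix.mul_assoc, proj_mul_fc]
    simp [suppInd, hs]
  have h2 : M * R.proj p.2 = (R.val p.2 : ℂ) • R.proj p.2 := by
    conv_lhs => enter [1]; rw [← R.fc_ofReal]
    rw [fc_mul_proj]
  have h3 : (R.val p.2 : ℂ) • (S.proj p.1 * R.proj p.2) = 0 := by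
    rw [← mul_smul_comm, ← h2, ← Matrix.mul_assoc, h1, Matrix.zero_mul]
  have h4 : S.proj p.1 * R.proj p.2 = 0 :=
    (smul_eq_zero.mp h3).resolve_left (by exact_mod_cast hr)
  exact hp (by simp [overlap, h4])

/-- The support of the image of a marginal dominates. -/
lemma map_fc_suppInd_mul {M' : Matrix m m ℂ} (S : SpectralResolution J M')
    (R : SpectralResolution I M) (ι : Matrix m m ℂ →⋆ₐ[ℂ] Matrix n n ℂ)
    (htr : ∀ X, (M * ι X).trace = (M' * X).trace) :
    (S.map ι).fc suppInd * M = M := by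
  have hP : (1 - S.fc suppInd) * (1 - S.fc suppInd) = 1 - S.fc suppInd := by
    have : S.fc suppInd * S.fc suppInd = S.fc suppInd := by
      rw [fc_mul_fc]
      congr 1
      funext x
      by_cases hx : x = 0 <;> simp [suppInd, hx]
    rw [sub_mul, mul_sub, mul_sub, this]
    simp
  have hPh : (1 - S.fc suppInd)ᴴ = 1 - S.fc suppInd := by
    rw [conjTranspose_sub, conjTranspose_fc_suppInd, conjTranspose_one]
  have h := R.mul_eq_zero_of_trace (E := ι (1 - S.fc suppInd)) (by
    rw [← star_eq_conjTranspose, ← map_star, star_eq_conjTranspose, hPh, trace_mul_comm,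
      ← Matrix.mul_assoc, ← map_mul, hP, trace_mul_comm, htr, trace_mul_comm, sub_mul,
      fc_suppInd_mul]
    simp)
  rw [map_sub, map_one, sub_mul, one_mul, sub_eq_zero] at h
  rw [map_fc]
  exact h.symm

end SpectralResolution

/-- The variational gap in the monotonicity of the resolvent form under a `⋆`-homomorphism. -/
lemma trace_resolvent_gap {n m : Type*} [Fintype n] [DecidableEq n] [Fintype m] [DecidableEq m]
    {ρ σ Z : Matrix n n ℂ} {ρ₀ σ₀ Z₀ : Matrix m m ℂ} (ι : Matrix m m ℂ →⋆ₐ[ℂ] Matrix n n ℂ)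
    {t : ℝ} (hρ : ρᴴ = ρ) (hσ : σᴴ = σ)
    (hρι : ∀ X, (ρ * ι X).trace = (ρ₀ * X).trace) (hσι : ∀ X, (σ * ι X).trace = (σ₀ * X).trace)
    (hZ : σ * Z + (t : ℂ) • (Z * ρ) = ρ) (hZ₀ : σ₀ * Z₀ + (t : ℂ) • (Z₀ * ρ₀) = ρ₀) :
    ((Z - ι Z₀)ᴴ * σ * (Z - ι Z₀)).trace + t * ((Z - ι Z₀) * ρ * (Z - ι Z₀)ᴴ).trace
      = (Zᴴ * ρ).trace - (ρ₀ * Z₀).trace := by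
  have hι : (ι Z₀)ᴴ = ι Z₀ᴴ := (map_star ι Z₀).symm
  have e1 : (ρ * ι Z₀ᴴ).trace = (ρ₀ * Z₀ᴴ).trace := hρι _
  have e2 : (Zᴴ * (σ * ι Z₀ + (t : ℂ) • (ι Z₀ * ρ))).trace = (ρ₀ * Z₀).trace := by
    have hZ' : Zᴴ * σ + (t : ℂ) • (ρ * Zᴴ) = ρ := by
      have := congrArg conjTranspose hZ
      simpa [conjTranspose_add, conjTranspose_smul, conjTranspose_mul, hρ, hσ] using this
    rw [← hρι]
    conv_rhs => rw [← hZ']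
    rw [mul_add, add_mul, trace_add, trace_add, mul_smul_comm, smul_mul_assoc, trace_smul,
      trace_smul, ← Matrix.mul_assoc, ← Matrix.mul_assoc, trace_mul_comm (Zᴴ * ι Z₀) ρ,
      Matrix.mul_assoc ρ]
  have e3 : (ι Z₀ᴴ * (σ * ι Z₀ + (t : ℂ) • (ι Z₀ * ρ))).trace = (ρ₀ * Z₀ᴴ).trace := by
    rw [mul_add, trace_add, mul_smul_comm, trace_smul, ← Matrix.mul_assoc, ← Matrix.mul_assoc,
      trace_mul_comm _ ρ, trace_mul_comm _ (ι Z₀), ← Matrix.mul_assoc, ← map_mul, ← map_mul,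
      trace_mul_comm _ σ, hρι, hσι]
    conv_rhs => rw [← hZ₀]
    rw [add_mul, trace_add, smul_mul_assoc, trace_smul, Matrix.mul_assoc, Matrix.mul_assoc Z₀,
      trace_mul_comm Z₀, Matrix.mul_assoc]
  have e4 : ((Z - ι Z₀)ᴴ * σ * (Z - ι Z₀)).trace + t * ((Z - ι Z₀) * ρ * (Z - ι Z₀)ᴴ).trace
      = ((Zᴴ - ι Z₀ᴴ) * (ρ - (σ * ι Z₀ + (t : ℂ) • (ι Z₀ * ρ)))).trace := by
    rw [conjTranspose_sub, hι, trace_mul_comm _ (Zᴴ - ι Z₀ᴴ), Matrix.mul_assoc,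
      ← smul_eq_mul (t : ℂ), ← trace_smul, ← trace_add, ← mul_smul_comm, ← mul_add]
    congr 2
    conv_rhs => enter [1]; rw [← hZ]
    rw [mul_sub, sub_mul, smul_sub]
    abel
  rw [e4, sub_mul, mul_sub, mul_sub, trace_sub, trace_sub, trace_sub, e2, e3,
    trace_mul_comm _ ρ, trace_mul_comm _ ρ, e1]
  rw [trace_mul_comm ρ]
  ring

/-- A multiplicative family of square roots of the nonnegative reals. -/
noncomputable def phasedSqrt (θ x : ℝ) : ℂ :=
  Real.sqrt x * Complex.exp (θ * Real.log x * Complex.I)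

lemma phasedSqrt_zero (θ : ℝ) : phasedSqrt θ 0 = 0 := by simp [phasedSqrt]

lemma phasedSqrt_div (θ : ℝ) {x y : ℝ} (hx : 0 ≤ x) :
    phasedSqrt θ (x / y) = phasedSqrt θ x / phasedSqrt θ y := by
  by_cases hx0 : x = 0
  · simp [hx0, phasedSqrt]
  by_cases hy0 : y = 0
  · simp [hy0, phasedSqrt]
  simp only [phasedSqrt]
  rw [Real.sqrt_div hx, Real.log_div hx0 hy0, mul_div_mul_comm, ← Complex.exp_sub]
  push_cast
  ring_nf

lemma phasedSqrt_mul (θ : ℝ) {x y : ℝ} (hx : 0 ≤ x) :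
    phasedSqrt θ (x * y) = phasedSqrt θ x * phasedSqrt θ y := by
  by_cases hx0 : x = 0
  · simp [hx0, phasedSqrt]
  by_cases hy0 : y = 0
  · simp [hy0, phasedSqrt]
  simp only [phasedSqrt]
  rw [Real.sqrt_mul hx, Real.log_mul hx0 hy0, mul_mul_mul_comm, ← Complex.exp_add]
  push_cast
  ring_nf

lemma phasedSqrt_ne_zero (θ : ℝ) {x : ℝ} (hx : 0 < x) : phasedSqrt θ x ≠ 0 :=
  mul_ne_zero (by exact_mod_cast (Real.sqrt_pos.mpr hx).ne') (Complex.exp_ne_zero _)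

lemma phasedSqrt_mul_inv (θ : ℝ) {x : ℝ} (hx : 0 ≤ x) :
    phasedSqrt θ x * (phasedSqrt θ x)⁻¹ = suppInd x := by
  rcases eq_or_lt_of_le hx with rfl | hx
  · simp [phasedSqrt_zero, suppInd]
  · rw [mul_inv_cancel₀ (phasedSqrt_ne_zero θ hx), suppInd, if_neg hx.ne']

lemma phasedSqrt_mul_star (θ : ℝ) {x : ℝ} (hx : 0 ≤ x) :
    phasedSqrt θ x * star (phasedSqrt θ x) = x := by
  simp only [phasedSqrt, ← starRingEnd_apply, ← Complex.exp_conj, map_mul,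
    Complex.conj_ofReal, Complex.conj_I]
  rw [mul_mul_mul_comm, ← Complex.exp_add, ← Complex.ofReal_mul, Real.mul_self_sqrt hx]
  simp

/-- A relation between all phased square roots forces the relation between supports. -/
lemma sum_mul_suppInd_eq_zero {K : Type*} [Fintype K] {c : K → ℂ} {x : K → ℝ}
    (hx : ∀ i, 0 ≤ x i) (h : ∀ θ, ∑ i, c i * phasedSqrt θ (x i) = 0) :
    ∑ i, c i * suppInd (x i) = 0 := by
  have key := sum_mul_eq_zero_of_linearIndependent linearIndependent_imaginary_power
    (c := fun i => c i * (Real.sqrt (x i) : ℂ))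
    (x := fun i => if h0 : 0 < x i then ⟨x i, h0⟩ else ⟨1, one_pos⟩) (fun θ => by
      rw [← h θ]
      refine Finset.sum_congr rfl fun i _ => ?_
      by_cases h0 : 0 < x i
      · simp [h0, phasedSqrt, mul_assoc]
      · have : x i = 0 := le_antisymm (not_lt.mp h0) (hx i)
        simp [this, phasedSqrt])
    (fun y => (Real.sqrt y : ℂ)⁻¹)
  rw [← key]
  refine Finset.sum_congr rfl fun i _ => ?_
  by_cases h0 : 0 < x i
  · have : (Real.sqrt (x i) : ℂ) ≠ 0 := by exact_mod_cast (Real.sqrt_pos.mpr h0).ne'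
    simp [h0, suppInd, h0.ne', this]
  · have : x i = 0 := le_antisymm (not_lt.mp h0) (hx i)
    simp [this, suppInd]

lemma suppInd_mul (x y : ℝ) : suppInd (x * y) = suppInd x * suppInd y := by
  by_cases hx : x = 0 <;> by_cases hy : y = 0 <;> simp [suppInd, hx, hy]

lemma suppInd_div (x y : ℝ) : suppInd (x / y) = suppInd x * suppInd y := by
  by_cases hx : x = 0 <;> by_cases hy : y = 0 <;> simp [suppInd, hx, hy]

namespace SpectralResolution

variable {n m I J I₀ J₀ : Type*} [Fintype n] [DecidableEq n] [Fintype m] [DecidableEq m]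
  [Fintype I] [DecidableEq I] [Fintype J] [DecidableEq J]
  [Fintype I₀] [DecidableEq I₀] [Fintype J₀] [DecidableEq J₀]
  {ρ σ : Matrix n n ℂ} {ρ₀ σ₀ : Matrix m m ℂ}

/-- The relative entropy of `ρ` with respect to `σ`, in terms of spectral resolutions. -/
noncomputable def relEnt (S : SpectralResolution J σ) (R : SpectralResolution I ρ) : ℝ :=
  ∑ p, S.overlap R p * R.val p.2 * (Real.log (R.val p.2) - Real.log (S.val p.1))

/-- Equality in the monotonicity of relative entropy forces the resolvents to match. -/
theorem resolvent_mul_eq (R : SpectralResolution I ρ) (S : SpectralResolution J σ)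
    (R₀ : SpectralResolution I₀ ρ₀) (S₀ : SpectralResolution J₀ σ₀)
    (ι : Matrix m m ℂ →⋆ₐ[ℂ] Matrix n n ℂ)
    (hρι : ∀ X, (ρ * ι X).trace = (ρ₀ * X).trace) (hσι : ∀ X, (σ * ι X).trace = (σ₀ * X).trace)
    (hsupp : S.fc suppInd * ρ = ρ) (hsupp₀ : S₀.fc suppInd * ρ₀ = ρ₀)
    (hent : S.relEnt R = S₀.relEnt R₀) {t : ℝ} (ht : 0 < t) :
    S.resolvent R t * ρ = ι (S₀.resolvent R₀ t) * ρ := by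
  have hF : ∀ t, (ρ * S.resolvent R t).trace.re
      = ∑ p, S.overlap R p * R.val p.2 ^ 2 / (S.val p.1 + t * R.val p.2) := by
    intro t
    rw [resolvent, re_trace_mul_schur S R fun x y => y / (x + t * y)]
    exact Finset.sum_congr rfl fun p _ => by ring
  have hF₀ : ∀ t, (ρ₀ * S₀.resolvent R₀ t).trace.re
      = ∑ p, S₀.overlap R₀ p * R₀.val p.2 ^ 2 / (S₀.val p.1 + t * R₀.val p.2) := by
    intro t
    rw [resolvent, re_trace_mul_schur S₀ R₀ fun x y => y / (x + t * y)]
    exact Finset.sum_congr rfl fun p _ => by ring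
  have hgap : ∀ t > 0, ∃ a b : ℝ, 0 ≤ a ∧ 0 ≤ b ∧
      ((S.resolvent R t - ι (S₀.resolvent R₀ t)) * ρ *
        (S.resolvent R t - ι (S₀.resolvent R₀ t))ᴴ).trace = b ∧
      a + t * b = (ρ * S.resolvent R t).trace.re - (ρ₀ * S₀.resolvent R₀ t).trace.re := by
    intro t ht
    have gap := trace_resolvent_gap ι R.isHermitian S.isHermitian hρι hσι
      (S.resolvent_spec R ht) (S₀.resolvent_spec R₀ ht)
    have ha := (S.posSemidef.conjTranspose_mul_mul_same
      (S.resolvent R t - ι (S₀.resolvent R₀ t))).trace_nonneg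
    have hb := (R.posSemidef.mul_mul_conjTranspose_same
      (S.resolvent R t - ι (S₀.resolvent R₀ t))).trace_nonneg
    have hZ : ((S.resolvent R t)ᴴ * ρ).trace.re = (ρ * S.resolvent R t).trace.re := by
      have : (S.resolvent R t)ᴴ * ρ = (ρ * S.resolvent R t)ᴴ := by
        rw [conjTranspose_mul, R.isHermitian]
      rw [this, trace_conjTranspose]
      simp
    rw [Complex.nonneg_iff] at ha hb
    refine ⟨_, _, ha.1, hb.1, Complex.ext rfl (by simpa using hb.2.symm), ?_⟩
    have := congrArg Complex.re gap
    rwa [Complex.add_re, Complex.re_ofReal_mul, Complex.sub_re, hZ] at this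
  have heq := sum_resolvent_eq_of_sum_log_eq
    (w := S.overlap R) (r := fun p => R.val p.2) (s := fun p => S.val p.1)
    (w' := S₀.overlap R₀) (r' := fun p => R₀.val p.2) (s' := fun p => S₀.val p.1)
    (fun p => R.val_nonneg _) (fun p => S.val_nonneg _)
    (S.val_ne_zero_of_overlap_ne_zero R hsupp)
    (fun p => R₀.val_nonneg _) (fun p => S₀.val_nonneg _)
    (S₀.val_ne_zero_of_overlap_ne_zero R₀ hsupp₀)
    (by
      have h1 := re_trace_mul_schur S R fun _ _ => 1
      have h2 := re_trace_mul_schur S₀ R₀ fun _ _ => 1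
      have h3 := hρι 1
      simp only [Complex.ofReal_one, schur_one, mul_one, map_one] at h1 h2 h3
      rw [← h1, ← h2, h3])
    hent
    (by
      intro t ht
      obtain ⟨a, b, ha, hb, -, h⟩ := hgap t ht
      rw [← hF, ← hF₀]
      nlinarith [mul_nonneg ht.le hb])
    t ht
  obtain ⟨a, b, ha, hb, hE, h⟩ := hgap t ht
  rw [hF, hF₀, heq, sub_self] at h
  have hb0 : b = 0 := by
    have := mul_nonneg ht.le hb
    exact (mul_eq_zero.mp (by linarith : t * b = 0)).resolve_left ht.ne'
  have := R.mul_eq_zero_of_trace (by rw [hE, hb0, Complex.ofReal_zero])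
  rwa [sub_mul, sub_eq_zero] at this

/-- Matching resolvents imply matching functional calculi. -/
lemma schur_mul_eq_of_resolvent (R : SpectralResolution I ρ) (S : SpectralResolution J σ)
    (R₀ : SpectralResolution I₀ ρ₀) (S₀ : SpectralResolution J₀ σ₀)
    (ι : Matrix m m ℂ →⋆ₐ[ℂ] Matrix n n ℂ)
    (h : ∀ t > 0, S.resolvent R t * ρ = ι (S₀.resolvent R₀ t) * ρ) (f : ℝ → ℂ) :
    S.schur R (fun x y => suppInd y * f (x / y)) * ρ
      = ι (S₀.schur R₀ fun x y => suppInd y * f (x / y)) * ρ := by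
  have expand : ∀ φ : ℝ → ℝ → ℂ, ∀ a b,
      (S.schur R φ * ρ - ι (S₀.schur R₀ φ) * ρ) a b
        = ∑ k : (J × I) ⊕ (J₀ × I₀), Sum.elim
            (fun p => (S.proj p.1 * R.proj p.2 * ρ) a b * φ (S.val p.1) (R.val p.2))
            (fun p => -(ι (S₀.proj p.1 * R₀.proj p.2) * ρ) a b
              * φ (S₀.val p.1) (R₀.val p.2)) k := by
    intro φ a b
    rw [Fintype.sum_sum_type]
    simp only [schur, map_sum, map_smul, Finset.sum_mul, smul_mul_assoc, Matrix.sub_apply,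
      Matrix.sum_apply, Matrix.smul_apply, smul_eq_mul, Sum.elim_inl, Sum.elim_inr, neg_mul,
      Finset.sum_neg_distrib, sub_eq_add_neg]
    simp only [mul_comm]
  rw [← sub_eq_zero]
  ext a b
  rw [expand, Matrix.zero_apply]
  have key := sum_mul_eq_zero_of_linearIndependent linearIndependent_resolvent
    (c := Sum.elim
      (fun p : J × I => (S.proj p.1 * R.proj p.2 * ρ) a b * suppInd (R.val p.2))
      (fun p : J₀ × I₀ => -(ι (S₀.proj p.1 * R₀.proj p.2) * ρ) a b * suppInd (R₀.val p.2)))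
    (x := Sum.elim
      (fun p => ⟨S.val p.1 / R.val p.2, div_nonneg (S.val_nonneg _) (R.val_nonneg _)⟩)
      (fun p => ⟨S₀.val p.1 / R₀.val p.2, div_nonneg (S₀.val_nonneg _) (R₀.val_nonneg _)⟩))
    (fun t => by
      have h1 := expand (fun x y => ((y / (x + t * y) : ℝ) : ℂ)) a b
      have h2 : S.schur R (fun x y => ((y / (x + t * y) : ℝ) : ℂ)) * ρ
          - ι (S₀.schur R₀ fun x y => ((y / (x + t * y) : ℝ) : ℂ)) * ρ = 0 :=
        sub_eq_zero.mpr (h t t.2)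
      have e : ∀ x y : ℝ, suppInd y * ((x / y + t : ℝ) : ℂ)⁻¹ = ((y / (x + t * y) : ℝ) : ℂ) := by
        intro x y
        by_cases hy : y = 0
        · simp [hy, suppInd]
        · have : x / y + t = (x + t * y) / y := by field_simp
          rw [this, suppInd, if_neg hy, one_mul, ← Complex.ofReal_inv, inv_div]
      rw [h2, Matrix.zero_apply] at h1
      rw [h1]
      refine Finset.sum_congr rfl fun k _ => ?_
      rcases k with p | p
      · simp only [Sum.elim_inl, mul_assoc, e]
      · simp only [Sum.elim_inr, mul_assoc, e])
    (fun y => f y)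
  rw [← key]
  refine Finset.sum_congr rfl fun k _ => ?_
  rcases k with p | p
  · simp only [Sum.elim_inl, mul_assoc]
  · simp only [Sum.elim_inr, mul_assoc]

lemma fc_phasedSqrt_mul_star (R : SpectralResolution I ρ) (θ : ℝ) :
    R.fc (phasedSqrt θ) * (R.fc (phasedSqrt θ))ᴴ = ρ := by
  rw [conjTranspose_fc, fc_mul_fc]
  conv_rhs => rw [← R.fc_ofReal]
  exact R.fc_congr fun x hx => phasedSqrt_mul_star θ hx

/-- The rotated Petz recovery formula, up to a right factor `ρ`. -/
lemma fc_phasedSqrt_mul (R : SpectralResolution I ρ) (S : SpectralResolution J σ)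
    (R₀ : SpectralResolution I₀ ρ₀) (S₀ : SpectralResolution J₀ σ₀)
    (ι : Matrix m m ℂ →⋆ₐ[ℂ] Matrix n n ℂ)
    (hsupp : S.fc suppInd * ρ = ρ)
    (h : ∀ t > 0, S.resolvent R t * ρ = ι (S₀.resolvent R₀ t) * ρ) (θ : ℝ) :
    S.fc (phasedSqrt θ) * ι (S₀.fc (fun x => (phasedSqrt θ x)⁻¹) * R₀.fc (phasedSqrt θ)) * ρ
      = R.fc (phasedSqrt θ) * ρ := by
  have h1 := schur_mul_eq_of_resolvent R S R₀ S₀ ι h fun x => (phasedSqrt θ x)⁻¹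
  have e : ∀ x y : ℝ, 0 ≤ x → 0 ≤ y →
      suppInd y * (phasedSqrt θ (x / y))⁻¹ = (phasedSqrt θ x)⁻¹ * phasedSqrt θ y := by
    intro x y hx _
    rw [phasedSqrt_div θ hx]
    by_cases hy0 : y = 0
    · simp [hy0, suppInd, phasedSqrt_zero]
    · rw [suppInd, if_neg hy0, inv_div, one_mul, div_eq_mul_inv, mul_comm]
  rw [schur_congr S R e, schur_congr S₀ R₀ e,
    ← fc_mul_fc_eq_schur S R (fun x => (phasedSqrt θ x)⁻¹),
    ← fc_mul_fc_eq_schur S₀ R₀ (fun x => (phasedSqrt θ x)⁻¹)] at h1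
  have comm : R.fc (phasedSqrt θ) * ρ = ρ * R.fc (phasedSqrt θ) := by
    conv_lhs => enter [2]; rw [← R.fc_ofReal]
    conv_rhs => enter [1]; rw [← R.fc_ofReal]
    rw [fc_mul_fc, fc_mul_fc]
    simp only [mul_comm]
  rw [Matrix.mul_assoc, ← h1, Matrix.mul_assoc, ← Matrix.mul_assoc (S.fc _), fc_mul_fc,
    S.fc_congr (fun x hx => phasedSqrt_mul_inv θ hx), comm, ← Matrix.mul_assoc, hsupp]

/-- The rotated Petz recovery formula. -/
lemma fc_phasedSqrt_eq (R : SpectralResolution I ρ) (S : SpectralResolution J σ)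
    (R₀ : SpectralResolution I₀ ρ₀) (S₀ : SpectralResolution J₀ σ₀)
    (ι : Matrix m m ℂ →⋆ₐ[ℂ] Matrix n n ℂ)
    (hρι : ∀ X, (ρ * ι X).trace = (ρ₀ * X).trace) (hσι : ∀ X, (σ * ι X).trace = (σ₀ * X).trace)
    (hsupp : S.fc suppInd * ρ = ρ) (hsupp₀ : S₀.fc suppInd * ρ₀ = ρ₀)
    (h : ∀ t > 0, S.resolvent R t * ρ = ι (S₀.resolvent R₀ t) * ρ) (θ : ℝ) :
    S.fc (phasedSqrt θ) * ι (S₀.fc (fun x => (phasedSqrt θ x)⁻¹) * R₀.fc (phasedSqrt θ))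
      = R.fc (phasedSqrt θ) := by
  have hX := fc_phasedSqrt_mul R S R₀ S₀ ι hsupp h θ
  set Y := S₀.fc (fun x => (phasedSqrt θ x)⁻¹) with hY
  set X := S.fc (phasedSqrt θ) * ι (Y * R₀.fc (phasedSqrt θ)) with hXdef
  set G := R.fc (phasedSqrt θ) with hG
  have hGsupp : G * R.fc suppInd = G := by
    rw [hG, fc_mul_fc]
    refine R.fc_congr fun x _ => ?_
    by_cases hx : x = 0 <;> simp [hx, suppInd, phasedSqrt_zero]
  have hXP : X * R.fc suppInd = G := by
    rw [← R.mul_fc_inv, ← Matrix.mul_assoc, hX, Matrix.mul_assoc, R.mul_fc_inv, hGsupp]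
  have hXX : (X * Xᴴ).trace = ρ.trace := by
    have h1 : Xᴴ = ι (Y * R₀.fc (phasedSqrt θ))ᴴ * (S.fc (phasedSqrt θ))ᴴ := by
      rw [hXdef, conjTranspose_mul]
      congr 1
      exact (map_star ι _).symm
    have h2 : S.fc (phasedSqrt θ) * (S.fc (phasedSqrt θ))ᴴ = σ := S.fc_phasedSqrt_mul_star θ
    have h3 : (S.fc (phasedSqrt θ))ᴴ * S.fc (phasedSqrt θ) = σ := by
      refine Eq.trans ?_ h2
      rw [conjTranspose_fc, fc_mul_fc, fc_mul_fc]
      simp only [mul_comm]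
    have h4 : Y * R₀.fc (phasedSqrt θ) * (Y * R₀.fc (phasedSqrt θ))ᴴ = Y * ρ₀ * Yᴴ := by
      rw [conjTranspose_mul, Matrix.mul_assoc, ← Matrix.mul_assoc (R₀.fc _),
        R₀.fc_phasedSqrt_mul_star, Matrix.mul_assoc]
    have h5 : Yᴴ * σ₀ * Y = S₀.fc suppInd := by
      conv_lhs => enter [1, 2]; rw [← S₀.fc_ofReal]
      rw [hY, conjTranspose_fc, fc_mul_fc, fc_mul_fc]
      refine S₀.fc_congr fun x hx => ?_
      conv_lhs => enter [1, 2]; rw [← phasedSqrt_mul_star θ hx]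
      rcases eq_or_lt_of_le hx with rfl | hx
      · simp [phasedSqrt_zero, suppInd]
      · have := phasedSqrt_ne_zero θ hx
        have h6 : star (phasedSqrt θ x) ≠ 0 := star_ne_zero.mpr this
        rw [star_inv₀, suppInd, if_neg hx.ne']
        field_simp
    have h7 : (σ₀ * (Y * ρ₀ * Yᴴ)).trace = (Yᴴ * σ₀ * Y * ρ₀).trace := by
      simp only [← Matrix.mul_assoc]
      rw [trace_mul_comm]
      simp only [← Matrix.mul_assoc]
    have h8 := hρι 1
    rw [map_one, mul_one, mul_one] at h8
    rw [h1, hXdef, ← Matrix.mul_assoc, Matrix.mul_assoc (S.fc _), ← map_mul, h4,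
      trace_mul_comm, ← Matrix.mul_assoc, h3, hσι, h7, h5, hsupp₀, h8]
  have hGG : G * Gᴴ = ρ := R.fc_phasedSqrt_mul_star θ
  have hXG : X * Gᴴ = ρ := by
    have : Gᴴ = R.fc suppInd * Gᴴ := by
      conv_lhs => rw [← hGsupp, conjTranspose_mul, conjTranspose_fc_suppInd]
    rw [this, ← Matrix.mul_assoc, hXP, hGG]
  have hGX : G * Xᴴ = ρ := by
    have := congrArg conjTranspose hXG
    rwa [conjTranspose_mul, conjTranspose_conjTranspose, R.isHermitian] at this
  have hD : ((X - G) * (X - G)ᴴ).trace = 0 := by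
    rw [conjTranspose_sub, mul_sub, sub_mul, sub_mul, hXG, hGX, hGG, trace_sub, trace_sub,
      trace_sub, hXX]
    ring
  exact sub_eq_zero.mp (trace_mul_conjTranspose_self_eq_zero_iff.mp hD)

/-- Equality in the monotonicity of relative entropy forces the supports to commute. -/
theorem fc_suppInd_commute (R : SpectralResolution I ρ) (S : SpectralResolution J σ)
    (R₀ : SpectralResolution I₀ ρ₀) (S₀ : SpectralResolution J₀ σ₀)
    (ι : Matrix m m ℂ →⋆ₐ[ℂ] Matrix n n ℂ)
    (hρι : ∀ X, (ρ * ι X).trace = (ρ₀ * X).trace) (hσι : ∀ X, (σ * ι X).trace = (σ₀ * X).trace)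
    (hsupp : S.fc suppInd * ρ = ρ) (hsupp₀ : S₀.fc suppInd * ρ₀ = ρ₀)
    (hent : S.relEnt R = S₀.relEnt R₀) :
    ι (R₀.fc suppInd) * S.fc suppInd = S.fc suppInd * ι (R₀.fc suppInd) := by
  have hpow := fc_phasedSqrt_eq R S R₀ S₀ ι hρι hσι hsupp hsupp₀ fun t ht =>
    resolvent_mul_eq R S R₀ S₀ ι hρι hσι hsupp hsupp₀ hent ht
  have expand : ∀ f g h k : ℝ → ℂ, ∀ a b,
      (S.fc f * ι (S₀.fc g * R₀.fc h) - R.fc k) a b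
        = ∑ p : (J × J₀ × I₀) ⊕ I, Sum.elim
          (fun p => (S.proj p.1 * ι (S₀.proj p.2.1 * R₀.proj p.2.2)) a b
            * (f (S.val p.1) * (g (S₀.val p.2.1) * h (R₀.val p.2.2))))
          (fun i => -(R.proj i a b) * k (R.val i)) p := by
    intro f g h k a b
    rw [fc_mul_fc_eq_schur, Fintype.sum_sum_type, Fintype.sum_prod_type]
    simp only [fc, schur, map_sum, map_smul, Finset.sum_mul_sum, smul_mul_smul_comm,
      Matrix.sub_apply, Matrix.sum_apply, Matrix.smul_apply, smul_eq_mul, Sum.elim_inl,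
      Sum.elim_inr, neg_mul, Finset.sum_neg_distrib, sub_eq_add_neg]
    simp only [mul_comm]
  have hprod : S.fc suppInd * ι (S₀.fc suppInd * R₀.fc suppInd) = R.fc suppInd := by
    rw [← sub_eq_zero]
    ext a b
    rw [expand, Matrix.zero_apply]
    have key := sum_mul_suppInd_eq_zero
      (c := Sum.elim
        (fun p : J × J₀ × I₀ => (S.proj p.1 * ι (S₀.proj p.2.1 * R₀.proj p.2.2)) a b)
        (fun i : I => -(R.proj i a b)))
      (x := Sum.elim
        (fun p => S.val p.1 * (R₀.val p.2.2 / S₀.val p.2.1)) R.val)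
      (by
        rintro (p | i)
        · exact mul_nonneg (S.val_nonneg _) (div_nonneg (R₀.val_nonneg _) (S₀.val_nonneg _))
        · exact R.val_nonneg i)
      (fun θ => by
        have h1 := expand (phasedSqrt θ) (fun x => (phasedSqrt θ x)⁻¹) (phasedSqrt θ)
          (phasedSqrt θ) a b
        rw [hpow θ, sub_self, Matrix.zero_apply] at h1
        rw [h1]
        refine Finset.sum_congr rfl fun p _ => ?_
        rcases p with p | i
        · simp only [Sum.elim_inl]
          rw [phasedSqrt_mul θ (S.val_nonneg _), phasedSqrt_div θ (R₀.val_nonneg _),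
            div_eq_inv_mul]
        · rfl)
    rw [← key]
    refine Finset.sum_congr rfl fun p _ => ?_
    rcases p with p | i
    · simp only [Sum.elim_inl]
      rw [suppInd_mul, suppInd_div, mul_comm (suppInd (R₀.val _))]
    · rfl
  have habs : S₀.fc suppInd * R₀.fc suppInd = R₀.fc suppInd := by
    rw [← R₀.mul_fc_inv, ← Matrix.mul_assoc, hsupp₀]
  rw [habs] at hprod
  have hadj := congrArg conjTranspose hprod
  have hι : (ι (R₀.fc suppInd))ᴴ = ι (R₀.fc suppInd) := by
    rw [← star_eq_conjTranspose, ← map_star, star_eq_conjTranspose, conjTranspose_fc_suppInd]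
  rw [conjTranspose_mul, hι, conjTranspose_fc_suppInd, conjTranspose_fc_suppInd] at hadj
  rw [hprod, hadj]

lemma trace_mul_proj (R : SpectralResolution I ρ) {i : I} (hi : (R.proj i).trace = 1) :
    (ρ * R.proj i).trace = R.val i := by
  conv_lhs => enter [1, 1]; rw [← R.fc_ofReal]
  rw [fc_mul_proj, trace_smul, hi, smul_eq_mul, mul_one]

/-- The relative entropy when the left projections are tested against `ρ`. -/
lemma relEnt_eq (S : SpectralResolution J σ) (R : SpectralResolution I ρ)
    (hR : ∀ i, (R.proj i).trace = 1) (hS : ∀ j, (ρ * S.proj j).trace = S.val j) :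
    S.relEnt R = ∑ i, R.val i * Real.log (R.val i) - ∑ j, S.val j * Real.log (S.val j) := by
  have h1 : ∀ i, ∑ j, S.overlap R (j, i) = 1 := by
    intro i
    simp only [overlap]
    rw [← Complex.re_sum, ← trace_sum, ← Finset.sum_mul, S.sum_proj, one_mul, hR, Complex.one_re]
  have h2 : ∀ j, ∑ i, S.overlap R (j, i) * R.val i = S.val j := by
    intro j
    rw [← Complex.ofReal_re (S.val j), ← hS j, trace_mul_comm]
    conv_rhs => enter [1, 1, 2]; rw [← R.sum_smul]
    rw [Finset.mul_sum, trace_sum, Complex.re_sum]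
    refine Finset.sum_congr rfl fun i _ => ?_
    rw [mul_smul_comm, trace_smul, smul_eq_mul, Complex.re_ofReal_mul, overlap, mul_comm]
  simp only [relEnt, mul_sub, Finset.sum_sub_distrib]
  congr 1
  · rw [Fintype.sum_prod_type_right]
    refine Finset.sum_congr rfl fun i _ => ?_
    simp only [mul_assoc]
    rw [← Finset.sum_mul, h1, one_mul]
  · rw [Fintype.sum_prod_type]
    refine Finset.sum_congr rfl fun j _ => ?_
    dsimp only
    rw [← Finset.sum_mul, h2]

lemma relEnt_map_eq (S : SpectralResolution J₀ σ₀) (R : SpectralResolution I ρ)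
    (ι : Matrix m m ℂ →⋆ₐ[ℂ] Matrix n n ℂ) (hι : ∀ X, (ρ * ι X).trace = (σ₀ * X).trace)
    (hR : ∀ i, (R.proj i).trace = 1) (hS : ∀ j, (S.proj j).trace = 1) :
    (S.map ι).relEnt R
      = ∑ i, R.val i * Real.log (R.val i) - ∑ j, S.val j * Real.log (S.val j) :=
  relEnt_eq (S.map ι) R hR fun j => (hι _).trans (S.trace_mul_proj (hS j))

lemma eq_fc_suppInd (R : SpectralResolution I ρ) {P : Matrix n n ℂ} (hP : IsSupportProj ρ P) :
    P = R.fc suppInd := by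
  obtain ⟨hPh, hPP, hker⟩ := hP
  have hcol : ∀ X : Matrix n n ℂ, ρ * X = 0 ↔ P * X = 0 := by
    have hz : ∀ N X : Matrix n n ℂ, N * X = 0 ↔ ∀ j, N *ᵥ X.col j = 0 := by
      intro N X
      constructor
      · intro h j
        funext i
        exact congrFun (congrFun h i) j
      · intro h
        ext i j
        exact congrFun (h j) i
    intro X
    rw [hz, hz]
    exact forall_congr' fun j => hker _
  have hρQ : ρ * R.fc suppInd = ρ := by
    have := congrArg conjTranspose R.fc_suppInd_mul
    rwa [conjTranspose_mul, conjTranspose_fc_suppInd, R.isHermitian] at this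
  have h1 : P * (1 - R.fc suppInd) = 0 := by
    rw [← hcol, mul_sub, hρQ, mul_one, sub_self]
  have h2 : R.fc suppInd * (1 - P) = 0 := by
    have : ρ * (1 - P) = 0 := by rw [hcol, mul_sub, hPP, mul_one, sub_self]
    rw [← R.fc_inv_mul, Matrix.mul_assoc, this, Matrix.mul_zero]
  rw [mul_sub, mul_one, sub_eq_zero] at h1 h2
  have h3 := congrArg conjTranspose h2
  rw [conjTranspose_mul, conjTranspose_fc_suppInd, hPh.eq] at h3
  rw [h1, ← h3]

end SpectralResolution

/-- A positive semidefinite matrix has a spectral resolution into rank-one projections, whose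
coefficients compute the von Neumann entropy. -/
lemma Matrix.PosSemidef.exists_spectralResolution {n : Type*} [Fintype n] [DecidableEq n]
    {M : Matrix n n ℂ} (hM : M.PosSemidef) :
    ∃ R : SpectralResolution n M, (∀ i, (R.proj i).trace = 1) ∧
      vNEntropy M = -∑ i, R.val i * Real.log (R.val i) := by
  have hH := hM.isHermitian
  set U : Matrix n n ℂ := hH.eigenvectorUnitary.1 with hU
  have hUU : Uᴴ * U = 1 := by
    simpa [star_eq_conjTranspose] using Unitary.coe_star_mul_self hH.eigenvectorUnitary
  have hUU' : U * Uᴴ = 1 := mul_eq_one_comm.mp hUU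
  refine ⟨⟨hH.eigenvalues, fun i => U * single i i 1 * Uᴴ, hM.eigenvalues_nonneg, ?_, ?_, ?_, ?_⟩,
    ?_, ?_⟩
  · intro i
    simp [conjTranspose_mul, Matrix.mul_assoc]
  · intro i j
    have : U * single i i (1 : ℂ) * Uᴴ * (U * single j j 1 * Uᴴ)
        = U * (single i i 1 * single j j 1) * Uᴴ := by
      simp only [Matrix.mul_assoc]
      rw [← Matrix.mul_assoc Uᴴ U, hUU, Matrix.one_mul]
    rw [this]
    split_ifs with h
    · subst h
      simp
    · rw [single_mul_single_of_ne _ _ _ _ h, Matrix.mul_zero, Matrix.zero_mul]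
  · rw [← Finset.sum_mul, ← Finset.mul_sum]
    have : ∑ i : n, single i i (1 : ℂ) = 1 := by
      rw [← diagonal_one, ← sum_single_eq_diagonal]
    rw [this, Matrix.mul_one, hUU']
  · conv_rhs => rw [hH.spectral_theorem, Unitary.conjStarAlgAut_apply]
    rw [← sum_single_eq_diagonal, Finset.mul_sum, Finset.sum_mul]
    refine Finset.sum_congr rfl fun i _ => ?_
    rw [← smul_mul_assoc, ← mul_smul_comm, smul_single]
    simp [hU, star_eq_conjTranspose]
  · intro i
    rw [trace_mul_comm, ← Matrix.mul_assoc, hUU, Matrix.one_mul, trace_single_eq_same]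
  · rw [vNEntropy, dif_pos hH]

section Marginals

variable {A B C : Type*} [Fintype A] [DecidableEq A] [Fintype B] [DecidableEq B]
  [Fintype C] [DecidableEq C]

/-- The embedding `X ↦ 1 ⊗ X`. -/
noncomputable def rightEmbedding (A B : Type*) [Fintype A] [DecidableEq A] [Fintype B]
    [DecidableEq B] : Matrix B B ℂ →⋆ₐ[ℂ] Matrix (A × B) (A × B) ℂ where
  toFun X := (1 : Matrix A A ℂ) ⊗ₖ X
  map_one' := one_kronecker_one
  map_mul' X Y := by rw [← mul_kronecker_mul, one_mul]
  map_zero' := kronecker_zero _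
  map_add' X Y := kronecker_add _ _ _
  commutes' c := by
    simp [Algebra.algebraMap_eq_smul_one, kronecker_smul]
  map_star' X := by
    simp [star_eq_conjTranspose, conjTranspose_kronecker]

/-- The embedding `X ↦ X ⊗ 1` followed by reassociation. -/
noncomputable def leftEmbedding (A B C : Type*) [Fintype A] [DecidableEq A] [Fintype B]
    [DecidableEq B] [Fintype C] [DecidableEq C] :
    Matrix (A × B) (A × B) ℂ →⋆ₐ[ℂ] Matrix (A × B × C) (A × B × C) ℂ where
  toFun X := reindex (Equiv.prodAssoc A B C) (Equiv.prodAssoc A B C)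
    (X ⊗ₖ (1 : Matrix C C ℂ))
  map_one' := by simp
  map_mul' X Y := by
    simp only [reindex_apply]
    rw [submatrix_mul_equiv, ← mul_kronecker_mul, one_mul]
  map_zero' := by simp
  map_add' X Y := by
    simp only [add_kronecker]
    rfl
  commutes' c := by
    simp only [Algebra.algebraMap_eq_smul_one, smul_kronecker, one_kronecker_one]
    change c • reindex (Equiv.prodAssoc A B C) (Equiv.prodAssoc A B C) 1 = _
    rw [reindex_apply, submatrix_one_equiv]
  map_star' X := by
    simp [star_eq_conjTranspose, conjTranspose_kronecker]

lemma rightEmbedding_apply (X : Matrix B B ℂ) (p q : A × B) :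
    rightEmbedding A B X p q = if p.1 = q.1 then X p.2 q.2 else 0 := by
  change ((1 : Matrix A A ℂ) ⊗ₖ X) p q = _
  simp [kroneckerMap_apply, Matrix.one_apply]

lemma leftEmbedding_apply (X : Matrix (A × B) (A × B) ℂ) (p q : A × B × C) :
    leftEmbedding A B C X p q
      = if p.2.2 = q.2.2 then X (p.1, p.2.1) (q.1, q.2.1) else 0 := by
  change (reindex (Equiv.prodAssoc A B C) (Equiv.prodAssoc A B C)
    (X ⊗ₖ (1 : Matrix C C ℂ))) p q = _
  simp [kroneckerMap_apply, Matrix.one_apply]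

lemma trace_mul_rightEmbedding (M : Matrix (A × B) (A × B) ℂ) (X : Matrix B B ℂ) :
    (M * rightEmbedding A B X).trace
      = ((of fun b b' => ∑ a, M (a, b) (a, b') : Matrix B B ℂ) * X).trace := by
  simp only [trace, diag_apply, mul_apply, rightEmbedding_apply, Fintype.sum_prod_type,
    of_apply, Finset.sum_mul, mul_ite, mul_zero]
  rw [Finset.sum_comm]
  refine Finset.sum_congr rfl fun b _ => ?_
  conv_rhs => rw [Finset.sum_comm]
  refine Finset.sum_congr rfl fun a _ => ?_
  rw [Finset.sum_comm]
  simp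

lemma trace_mul_leftEmbedding (M : Matrix (A × B × C) (A × B × C) ℂ)
    (X : Matrix (A × B) (A × B) ℂ) :
    (M * leftEmbedding A B C X).trace = (margAB M * X).trace := by
  simp only [trace, diag_apply, mul_apply, leftEmbedding_apply, Fintype.sum_prod_type,
    margAB, of_apply, Finset.sum_mul, mul_ite, mul_zero, Finset.sum_ite_eq', Finset.mem_univ,
    if_true]
  refine Finset.sum_congr rfl fun a _ => Finset.sum_congr rfl fun b _ => ?_
  rw [Finset.sum_comm]
  refine Finset.sum_congr rfl fun a' _ => ?_
  rw [Finset.sum_comm]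

lemma margAB_rightEmbedding_margBC (ρ : Matrix (A × B × C) (A × B × C) ℂ) :
    margAB (rightEmbedding A (B × C) (margBC ρ)) = rightEmbedding A B (margB ρ) := by
  ext p q
  simp only [margAB, of_apply, rightEmbedding_apply, margBC, margB]
  split_ifs
  · exact Finset.sum_comm
  · simp

end Marginals

lemma Matrix.PosSemidef.margAB {A B C : Type*} [Fintype C] {ρ : Matrix (A × B × C) (A × B × C) ℂ}
    (hρ : ρ.PosSemidef) :
    (margAB ρ).PosSemidef := by
  have : _root_.margAB ρ = ∑ c : C, ρ.submatrix (fun p : A × B => (p.1, p.2, c))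
      (fun p : A × B => (p.1, p.2, c)) := by
    ext p q
    simp [_root_.margAB, Matrix.sum_apply]
  rw [this]
  exact posSemidef_sum _ fun c _ => hρ.submatrix _

lemma Matrix.PosSemidef.margBC {A B C : Type*} [Fintype A] {ρ : Matrix (A × B × C) (A × B × C) ℂ}
    (hρ : ρ.PosSemidef) :
    (margBC ρ).PosSemidef := by
  have : _root_.margBC ρ = ∑ a : A, ρ.submatrix (fun p : B × C => (a, p))
      (fun p : B × C => (a, p)) := by
    ext p q
    simp [_root_.margBC, Matrix.sum_apply]
  rw [this]
  exact posSemidef_sum _ fun c _ => hρ.submatrix _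

lemma Matrix.PosSemidef.margB {A B C : Type*} [Fintype A] [Fintype C]
    {ρ : Matrix (A × B × C) (A × B × C) ℂ}
    (hρ : ρ.PosSemidef) :
    (margB ρ).PosSemidef := by
  have : _root_.margB ρ = ∑ a : A, ∑ c : C, ρ.submatrix (fun b : B => (a, b, c))
      (fun b : B => (a, b, c)) := by
    ext p q
    simp [_root_.margB, Matrix.sum_apply]
  rw [this]
  exact posSemidef_sum _ fun a _ => posSemidef_sum _ fun c _ => hρ.submatrix _

theorem markov_support_projections_commute
    {A B C : Type*} [Fintype A] [DecidableEq A] [Fintype B] [DecidableEq B]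
    [Fintype C] [DecidableEq C]
    (ρ : Matrix (A × B × C) (A × B × C) ℂ) (hρ : IsDensityMatrix ρ)
    (hMarkov : CMI ρ = 0)
    (PAB : Matrix (A × B) (A × B) ℂ) (hPAB : IsSupportProj (margAB ρ) PAB)
    (PBC : Matrix (B × C) (B × C) ℂ) (hPBC : IsSupportProj (margBC ρ) PBC) :
    (Matrix.reindex (Equiv.prodAssoc A B C) (Equiv.prodAssoc A B C)
        (PAB ⊗ₖ (1 : Matrix C C ℂ))) * ((1 : Matrix A A ℂ) ⊗ₖ PBC)
      = ((1 : Matrix A A ℂ) ⊗ₖ PBC) *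
        (Matrix.reindex (Equiv.prodAssoc A B C) (Equiv.prodAssoc A B C)
          (PAB ⊗ₖ (1 : Matrix C C ℂ))) := by
  have hpos := hρ.1
  obtain ⟨R, hR, hRS⟩ := hpos.exists_spectralResolution
  obtain ⟨RAB, hRAB, hRABS⟩ := hpos.margAB.exists_spectralResolution
  obtain ⟨RBC, hRBC, hRBCS⟩ := hpos.margBC.exists_spectralResolution
  obtain ⟨RB, hRB, hRBS⟩ := hpos.margB.exists_spectralResolution
  have trBC : ∀ X, (ρ * rightEmbedding A (B × C) X).trace = (margBC ρ * X).trace :=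
    trace_mul_rightEmbedding ρ
  have trB : ∀ X, (margAB ρ * rightEmbedding A B X).trace = (margB ρ * X).trace :=
    trace_mul_rightEmbedding (margAB ρ)
  have hent : (RBC.map (rightEmbedding A (B × C))).relEnt R
      = (RB.map (rightEmbedding A B)).relEnt RAB := by
    rw [SpectralResolution.relEnt_map_eq RBC R _ trBC hR hRBC,
      SpectralResolution.relEnt_map_eq RB RAB _ trB hRAB hRB]
    rw [CMI, hRS, hRABS, hRBCS, hRBS] at hMarkov
    linarith
  have key := SpectralResolution.fc_suppInd_commute R (RBC.map (rightEmbedding A (B × C))) RAB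
    (RB.map (rightEmbedding A B)) (leftEmbedding A B C) (trace_mul_leftEmbedding ρ)
    (fun X => by rw [trace_mul_leftEmbedding, margAB_rightEmbedding_margBC])
    (RBC.map_fc_suppInd_mul R _ trBC) (RB.map_fc_suppInd_mul RAB _ trB) hent
  rw [SpectralResolution.map_fc, ← RAB.eq_fc_suppInd hPAB, ← RBC.eq_fc_suppInd hPBC] at key
  exact key
end

section
/- Suppose H_B carries an orthogonal direct sum decomposition H_B = ⊕_{j∈J} H_{b_j^L} ⊗ H_{b_j^R}, and let ρ_ABC = ⊕_j q_j ρ_{A b_j^L} ⊗ ρ_{b_j^R C} be the block-diagonal density matrix on H_A ⊗ H_B ⊗ H_C determined by density matrices ρ_{A b_j^L} on H_A ⊗ H_{b_j^L}, ρ_{b_j^R C} on H_{b_j^R} ⊗ H_C, and a probability distribution (q_j). Let P_AB and P_BC be the orthogonal projections onto the supports of the reduced density matrices ρ_AB and ρ_BC. Then P_AB ⊗ 1_C commutes with 1_A ⊗ P_BC. -/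
open Matrix Kronecker BigOperators
open scoped ComplexOrder

/-- Reassociation of indices `Σ j, (A × bLⱼ) × (bRⱼ × C) ≃ A × (Σ j, bLⱼ × bRⱼ) × C`. -/
def assocEquiv (A C : Type*) {J : Type*} (bL bR : J → Type*) :
    (Σ j, (A × bL j) × (bR j × C)) ≃ A × (Σ j, bL j × bR j) × C where
  toFun x := (x.2.1.1, ⟨x.1, (x.2.1.2, x.2.2.1)⟩, x.2.2.2)
  invFun y := ⟨y.2.1.1, ((y.1, y.2.1.2.1), (y.2.1.2.2, y.2.2))⟩
  left_inv x := rfl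
  right_inv y := rfl

/-- The block-diagonal density matrix `⊕ⱼ qⱼ · ρ_{A bLⱼ} ⊗ ρ_{bRⱼ C}` on
`H_A ⊗ (⊕ⱼ H_{bLⱼ} ⊗ H_{bRⱼ}) ⊗ H_C`. -/
noncomputable def blockState {A C : Type*} {J : Type*} [DecidableEq J]
    (bL bR : J → Type*)
    (q : J → ℝ)
    (ρL : ∀ j, Matrix (A × bL j) (A × bL j) ℂ)
    (ρR : ∀ j, Matrix (bR j × C) (bR j × C) ℂ) :
    Matrix (A × (Σ j, bL j × bR j) × C) (A × (Σ j, bL j × bR j) × C) ℂ :=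
  Matrix.reindex (assocEquiv A C bL bR) (assocEquiv A C bL bR)
    (Matrix.blockDiagonal' fun j => (q j : ℂ) • (ρL j ⊗ₖ ρR j))

/-- Partial trace over the second tensor factor. -/
def traceRight {m n : Type*} [Fintype n] (X : Matrix (m × n) (m × n) ℂ) : Matrix m m ℂ :=
  Matrix.of fun i k => ∑ x, X (i, x) (k, x)

/-- Partial trace over the first tensor factor. -/
def traceLeft {m n : Type*} [Fintype m] (X : Matrix (m × n) (m × n) ℂ) : Matrix n n ℂ :=
  Matrix.of fun i k => ∑ x, X (x, i) (x, k)

/-- An algebraic form of being the support projection of `M`. -/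
structure IsAlgSupportProj {n : Type*} [Fintype n] (M P : Matrix n n ℂ) : Prop where
  isHermitian : P.IsHermitian
  mul_self : P * P = P
  mul_proj : M * P = M
  exists_mul : ∃ X, X * M = P

theorem conj_isometry_mul {m n : Type*} [Fintype m] [Fintype n] [DecidableEq m]
    {V : Matrix n m ℂ} (hV : Vᴴ * V = 1) (X Y : Matrix m m ℂ) :
    V * X * Vᴴ * (V * Y * Vᴴ) = V * (X * Y) * Vᴴ := by
  calc _ = V * X * (Vᴴ * V) * Y * Vᴴ := by simp only [Matrix.mul_assoc]
    _ = _ := by rw [hV, Matrix.mul_one, Matrix.mul_assoc V]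

theorem conj_isometry_commute {m n : Type*} [Fintype m] [Fintype n] [DecidableEq m]
    {V : Matrix n m ℂ} (hV : Vᴴ * V = 1) {X Y : Matrix m m ℂ} (h : Commute X Y) :
    Commute (V * X * Vᴴ) (V * Y * Vᴴ) := by
  rw [Commute, SemiconjBy, conj_isometry_mul hV, conj_isometry_mul hV, h.eq]

namespace IsAlgSupportProj

variable {m n : Type*} [Fintype m] [Fintype n]

theorem isSupportProj {M P : Matrix n n ℂ} (h : IsAlgSupportProj M P) : IsSupportProj M P := by
  refine ⟨h.isHermitian, h.mul_self, fun v => ⟨fun hv => ?_, fun hv => ?_⟩⟩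
  · obtain ⟨X, hX⟩ := h.exists_mul
    rw [← hX, ← Matrix.mulVec_mulVec, hv, Matrix.mulVec_zero]
  · rw [← h.mul_proj, ← Matrix.mulVec_mulVec, hv, Matrix.mulVec_zero]

theorem kronecker {M P : Matrix m m ℂ} {N Q : Matrix n n ℂ} (h : IsAlgSupportProj M P)
    (k : IsAlgSupportProj N Q) : IsAlgSupportProj (M ⊗ₖ N) (P ⊗ₖ Q) where
  isHermitian := by
    rw [Matrix.IsHermitian, Matrix.conjTranspose_kronecker, h.isHermitian.eq, k.isHermitian.eq]
  mul_self := by rw [← Matrix.mul_kronecker_mul, h.mul_self, k.mul_self]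
  mul_proj := by rw [← Matrix.mul_kronecker_mul, h.mul_proj, k.mul_proj]
  exists_mul := by
    obtain ⟨X, hX⟩ := h.exists_mul
    obtain ⟨Y, hY⟩ := k.exists_mul
    exact ⟨X ⊗ₖ Y, by rw [← Matrix.mul_kronecker_mul, hX, hY]⟩

theorem smul {M P : Matrix n n ℂ} (h : IsAlgSupportProj M P) (q : ℂ) :
    IsAlgSupportProj (q • M) ((if q = 0 then (0 : ℂ) else 1) • P) := by
  by_cases hq : q = 0
  · subst hq
    exact ⟨by simp, by simp, by simp, 0, by simp⟩
  · obtain ⟨X, hX⟩ := h.exists_mul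
    refine ⟨by simpa [hq] using h.isHermitian, by simp [hq, h.mul_self],
      by simp [hq, h.mul_proj], q⁻¹ • X, by simp [hq, hX]⟩

theorem blockDiagonal' {J : Type*} [Fintype J] [DecidableEq J] {k : J → Type*}
    [∀ j, Fintype (k j)] {M P : ∀ j, Matrix (k j) (k j) ℂ}
    (h : ∀ j, IsAlgSupportProj (M j) (P j)) :
    IsAlgSupportProj (Matrix.blockDiagonal' M) (Matrix.blockDiagonal' P) where
  isHermitian := by
    rw [Matrix.IsHermitian, Matrix.blockDiagonal'_conjTranspose]
    congr 1
    exact funext fun j => (h j).isHermitian.eq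
  mul_self := by
    rw [← Matrix.blockDiagonal'_mul]
    congr 1
    exact funext fun j => (h j).mul_self
  mul_proj := by
    rw [← Matrix.blockDiagonal'_mul]
    congr 1
    exact funext fun j => (h j).mul_proj
  exists_mul := by
    choose X hX using fun j => (h j).exists_mul
    refine ⟨Matrix.blockDiagonal' X, ?_⟩
    rw [← Matrix.blockDiagonal'_mul]
    congr 1
    exact funext hX

theorem reindex {M P : Matrix m m ℂ} (h : IsAlgSupportProj M P) (e : m ≃ n) :
    IsAlgSupportProj (Matrix.reindex e e M) (Matrix.reindex e e P) where
  isHermitian := h.isHermitian.submatrix _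
  mul_self := by simp [Matrix.submatrix_mul_equiv, h.mul_self]
  mul_proj := by simp [Matrix.submatrix_mul_equiv, h.mul_proj]
  exists_mul := by
    obtain ⟨X, hX⟩ := h.exists_mul
    exact ⟨Matrix.reindex e e X, by simp [Matrix.submatrix_mul_equiv, hX]⟩

theorem conj_isometry [DecidableEq m] {M P : Matrix m m ℂ} (h : IsAlgSupportProj M P)
    {V : Matrix n m ℂ} (hV : Vᴴ * V = 1) : IsAlgSupportProj (V * M * Vᴴ) (V * P * Vᴴ) := by
  obtain ⟨X, hX⟩ := h.exists_mul
  exact ⟨Matrix.isHermitian_mul_mul_conjTranspose _ h.isHermitian,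
    by rw [conj_isometry_mul hV, h.mul_self],
    by rw [conj_isometry_mul hV, h.mul_proj], V * X * Vᴴ, by rw [conj_isometry_mul hV, hX]⟩

end IsAlgSupportProj

theorem Matrix.IsHermitian.exists_isAlgSupportProj {n : Type*} [Fintype n] [DecidableEq n]
    {M : Matrix n n ℂ} (hM : M.IsHermitian) : ∃ P, IsAlgSupportProj M P := by
  have hD : IsAlgSupportProj (diagonal (RCLike.ofReal ∘ hM.eigenvalues : n → ℂ))
      (diagonal fun i => if hM.eigenvalues i = 0 then 0 else 1) := by
    refine ⟨?_, ?_, ?_, diagonal fun i => ((hM.eigenvalues i : ℂ))⁻¹, ?_⟩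
    · rw [Matrix.IsHermitian, diagonal_conjTranspose]
      congr 1
      ext i
      simp only [Pi.star_apply]
      split_ifs <;> simp
    all_goals
      rw [diagonal_mul_diagonal]
      congr 1
      ext i
      by_cases h : hM.eigenvalues i = 0 <;> simp [h]
  have hspec := hM.spectral_theorem
  rw [Unitary.conjStarAlgAut_apply] at hspec
  rw [hspec]
  exact ⟨_, hD.conj_isometry (V := (hM.eigenvectorUnitary : Matrix n n ℂ))
    (Unitary.coe_star_mul_self hM.eigenvectorUnitary)⟩

theorem IsSupportProj.mul_eq_left {n : Type*} [Fintype n] [DecidableEq n]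
    {M P Q : Matrix n n ℂ} (hP : IsSupportProj M P) (hQ : IsSupportProj M Q) : P * Q = P := by
  have h : P * (1 - Q) = 0 := by
    refine Matrix.ext_of_mulVec_single fun i => ?_
    rw [Matrix.zero_mulVec, ← Matrix.mulVec_mulVec, ← hP.2.2, hQ.2.2, Matrix.mulVec_mulVec,
      Matrix.mul_sub, hQ.2.1, Matrix.mul_one, sub_self, Matrix.zero_mulVec]
  rw [Matrix.mul_sub, Matrix.mul_one, sub_eq_zero] at h
  exact h.symm

theorem IsSupportProj.unique {n : Type*} [Fintype n] [DecidableEq n]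
    {M P Q : Matrix n n ℂ} (hP : IsSupportProj M P) (hQ : IsSupportProj M Q) : P = Q := by
  rw [← hP.mul_eq_left hQ, ← hP.1.eq, ← hQ.1.eq, ← Matrix.conjTranspose_mul,
    hQ.mul_eq_left hP]

theorem Matrix.IsHermitian.traceRight {m n : Type*} [Fintype n] {X : Matrix (m × n) (m × n) ℂ}
    (h : X.IsHermitian) : (traceRight X).IsHermitian := by
  ext i k
  simp only [Matrix.conjTranspose_apply, _root_.traceRight, Matrix.of_apply, star_sum]
  exact Finset.sum_congr rfl fun x _ => h.apply _ _

theorem Matrix.IsHermitian.traceLeft {m n : Type*} [Fintype m] {X : Matrix (m × n) (m × n) ℂ}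
    (h : X.IsHermitian) : (traceLeft X).IsHermitian := by
  ext i k
  simp only [Matrix.conjTranspose_apply, _root_.traceLeft, Matrix.of_apply, star_sum]
  exact Finset.sum_congr rfl fun x _ => h.apply _ _

open scoped MatrixOrder Matrix.Norms.L2Operator in
theorem Matrix.PosSemidef.mul_eq_zero_of_trace_eq_zero {n : Type*} [Fintype n] [DecidableEq n]
    {M Q : Matrix n n ℂ} (hM : M.PosSemidef) (h : (Qᴴ * M * Q).trace = 0) : M * Q = 0 := by
  have h0 := (hM.conjTranspose_mul_mul_same Q).trace_eq_zero_iff.1 h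
  obtain ⟨S, rfl⟩ := CStarAlgebra.nonneg_iff_eq_star_mul_self.mp hM.nonneg
  have h1 : (S * Q)ᴴ * (S * Q) = 0 := by
    rw [← h0, Matrix.conjTranspose_mul, Matrix.star_eq_conjTranspose]
    simp only [Matrix.mul_assoc]
  rw [Matrix.star_eq_conjTranspose, Matrix.mul_assoc,
    Matrix.conjTranspose_mul_self_eq_zero.1 h1, Matrix.mul_zero]

theorem trace_mul_one_kronecker {m n : Type*} [Fintype m] [Fintype n] [DecidableEq m]
    (X : Matrix (m × n) (m × n) ℂ) (Q : Matrix n n ℂ) :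
    (X * ((1 : Matrix m m ℂ) ⊗ₖ Q)).trace = (traceLeft X * Q).trace := by
  simp only [Matrix.trace, Matrix.diag_apply, Matrix.mul_apply, Fintype.sum_prod_type_right,
    Matrix.kroneckerMap_apply, Matrix.one_apply, traceLeft, Matrix.of_apply, Finset.sum_mul,
    ite_mul, one_mul, zero_mul, mul_ite, mul_zero, Finset.sum_ite_eq', Finset.mem_univ, if_true]
  exact Finset.sum_congr rfl fun i _ => Finset.sum_comm

theorem trace_mul_kronecker_one {m n : Type*} [Fintype m] [Fintype n] [DecidableEq n]
    (X : Matrix (m × n) (m × n) ℂ) (Q : Matrix m m ℂ) :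
    (X * (Q ⊗ₖ (1 : Matrix n n ℂ))).trace = (traceRight X * Q).trace := by
  simp only [Matrix.trace, Matrix.diag_apply, Matrix.mul_apply, Fintype.sum_prod_type,
    Matrix.kroneckerMap_apply, Matrix.one_apply, traceRight, Matrix.of_apply, Finset.sum_mul,
    mul_one, mul_ite, mul_zero, Finset.sum_ite_eq', Finset.mem_univ, if_true]
  exact Finset.sum_congr rfl fun i _ => Finset.sum_comm

theorem IsAlgSupportProj.commute_of_trace_mul_eq {n : Type*} [Fintype n] [DecidableEq n]
    {M P R : Matrix n n ℂ} (hM : M.PosSemidef) (h : IsAlgSupportProj M P)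
    (hR : R.IsHermitian) (hRR : R * R = R) (ht : (M * R).trace = M.trace) : Commute P R := by
  have h1 : M * (1 - R) = 0 := by
    refine hM.mul_eq_zero_of_trace_eq_zero ?_
    rw [Matrix.mul_assoc, Matrix.trace_mul_comm, Matrix.mul_assoc,
      (Matrix.isHermitian_one.sub hR).eq, sub_mul, one_mul, mul_sub R, mul_one, hRR,
      sub_self, sub_zero, mul_sub, mul_one, Matrix.trace_sub, ht, sub_self]
  obtain ⟨X, hX⟩ := h.exists_mul
  have h2 : P * R = P := by
    have : P * (1 - R) = 0 := by rw [← hX, Matrix.mul_assoc, h1, Matrix.mul_zero]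
    rw [mul_sub, mul_one, sub_eq_zero] at this
    exact this.symm
  have h3 := congrArg Matrix.conjTranspose h2
  rw [Matrix.conjTranspose_mul, hR.eq, h.isHermitian.eq] at h3
  exact h2.trans h3.symm

theorem IsAlgSupportProj.commute_one_kronecker {m n : Type*} [Fintype m] [Fintype n]
    [DecidableEq m] [DecidableEq n] {M P : Matrix (m × n) (m × n) ℂ} {Q : Matrix n n ℂ}
    (hM : M.PosSemidef) (hP : IsAlgSupportProj M P) (hQ : IsAlgSupportProj (traceLeft M) Q) :
    Commute P ((1 : Matrix m m ℂ) ⊗ₖ Q) := by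
  refine hP.commute_of_trace_mul_eq hM ?_ ?_ ?_
  · rw [Matrix.IsHermitian, Matrix.conjTranspose_kronecker, hQ.isHermitian.eq,
      Matrix.conjTranspose_one]
  · rw [← Matrix.mul_kronecker_mul, hQ.mul_self, one_mul]
  · rw [trace_mul_one_kronecker, hQ.mul_proj, ← mul_one (traceLeft M), ← trace_mul_one_kronecker,
      Matrix.one_kronecker_one, mul_one]

theorem IsAlgSupportProj.commute_kronecker_one {m n : Type*} [Fintype m] [Fintype n]
    [DecidableEq m] [DecidableEq n] {M P : Matrix (m × n) (m × n) ℂ} {Q : Matrix m m ℂ}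
    (hM : M.PosSemidef) (hP : IsAlgSupportProj M P) (hQ : IsAlgSupportProj (traceRight M) Q) :
    Commute P (Q ⊗ₖ (1 : Matrix n n ℂ)) := by
  refine hP.commute_of_trace_mul_eq hM ?_ ?_ ?_
  · rw [Matrix.IsHermitian, Matrix.conjTranspose_kronecker, hQ.isHermitian.eq,
      Matrix.conjTranspose_one]
  · rw [← Matrix.mul_kronecker_mul, hQ.mul_self, one_mul]
  · rw [trace_mul_kronecker_one, hQ.mul_proj, ← mul_one (traceRight M), ← trace_mul_kronecker_one,
      Matrix.one_kronecker_one, mul_one]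

/-- Reassociation of indices `Σ j, (A × bLⱼ) × bRⱼ ≃ A × Σ j, bLⱼ × bRⱼ`. -/
def assocEquivLeft (A : Type*) {J : Type*} (bL bR : J → Type*) :
    (Σ j, (A × bL j) × bR j) ≃ A × (Σ j, bL j × bR j) where
  toFun x := (x.2.1.1, ⟨x.1, (x.2.1.2, x.2.2)⟩)
  invFun y := ⟨y.2.1, ((y.1, y.2.2.1), y.2.2.2)⟩
  left_inv _ := rfl
  right_inv _ := rfl

/-- Reassociation of indices `Σ j, bLⱼ × (bRⱼ × C) ≃ (Σ j, bLⱼ × bRⱼ) × C`. -/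
def assocEquivRight (C : Type*) {J : Type*} (bL bR : J → Type*) :
    (Σ j, bL j × (bR j × C)) ≃ (Σ j, bL j × bR j) × C where
  toFun x := (⟨x.1, (x.2.1, x.2.2.1)⟩, x.2.2.2)
  invFun y := ⟨y.1.1, (y.1.2.1, (y.1.2.2, y.2))⟩
  left_inv _ := rfl
  right_inv _ := rfl

section Marginals

variable {A B C D : Type*}

theorem margAB_conj [Fintype A] [DecidableEq A] [Fintype C] [DecidableEq C] [Fintype D]
    (U : Matrix B D ℂ) (X : Matrix (A × D × C) (A × D × C) ℂ) :
    margAB (((1 : Matrix A A ℂ) ⊗ₖ (U ⊗ₖ (1 : Matrix C C ℂ))) * X *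
      ((1 : Matrix A A ℂ) ⊗ₖ (U ⊗ₖ (1 : Matrix C C ℂ)))ᴴ) =
    ((1 : Matrix A A ℂ) ⊗ₖ U) * margAB X * ((1 : Matrix A A ℂ) ⊗ₖ U)ᴴ := by
  ext ⟨a, b⟩ ⟨a', b'⟩
  simp only [Matrix.conjTranspose_kronecker, Matrix.conjTranspose_one]
  simp [margAB, Matrix.mul_apply, Fintype.sum_prod_type, Matrix.one_apply, Finset.sum_mul,
    Finset.mul_sum, Finset.sum_ite_irrel]
  rw [Finset.sum_comm]
  exact Finset.sum_congr rfl fun _ _ => Finset.sum_comm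

theorem margBC_conj [Fintype A] [DecidableEq A] [Fintype C] [DecidableEq C] [Fintype D]
    (U : Matrix B D ℂ) (X : Matrix (A × D × C) (A × D × C) ℂ) :
    margBC (((1 : Matrix A A ℂ) ⊗ₖ (U ⊗ₖ (1 : Matrix C C ℂ))) * X *
      ((1 : Matrix A A ℂ) ⊗ₖ (U ⊗ₖ (1 : Matrix C C ℂ)))ᴴ) =
    (U ⊗ₖ (1 : Matrix C C ℂ)) * margBC X * (U ⊗ₖ (1 : Matrix C C ℂ))ᴴ := by
  ext ⟨a, b⟩ ⟨a', b'⟩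
  simp only [Matrix.conjTranspose_kronecker, Matrix.conjTranspose_one]
  simp [margBC, Matrix.mul_apply, Fintype.sum_prod_type, Matrix.one_apply, Finset.sum_mul,
    Finset.mul_sum, Finset.sum_ite_irrel]
  rw [Finset.sum_comm]
  exact Finset.sum_congr rfl fun _ _ => Finset.sum_comm

variable {J : Type*} [DecidableEq J] {bL bR : J → Type*}

theorem margAB_blockState [Fintype C] (q : J → ℝ) (ρL : ∀ j, Matrix (A × bL j) (A × bL j) ℂ)
    (ρR : ∀ j, Matrix (bR j × C) (bR j × C) ℂ) :
    margAB (blockState bL bR q ρL ρR) =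
      Matrix.reindex (assocEquivLeft A bL bR) (assocEquivLeft A bL bR)
        (Matrix.blockDiagonal' fun j => (q j : ℂ) • (ρL j ⊗ₖ traceRight (ρR j))) := by
  ext ⟨a, j, l, r⟩ ⟨a', j', l', r'⟩
  by_cases h : j = j'
  · subst h
    simp [margAB, blockState, assocEquivLeft, assocEquiv, traceRight, Finset.mul_sum]
  · simp [margAB, blockState, assocEquivLeft, assocEquiv, Matrix.blockDiagonal'_apply_ne, h]

theorem margBC_blockState [Fintype A] (q : J → ℝ) (ρL : ∀ j, Matrix (A × bL j) (A × bL j) ℂ)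
    (ρR : ∀ j, Matrix (bR j × C) (bR j × C) ℂ) :
    margBC (blockState bL bR q ρL ρR) =
      Matrix.reindex (assocEquivRight C bL bR) (assocEquivRight C bL bR)
        (Matrix.blockDiagonal' fun j => (q j : ℂ) • (traceLeft (ρL j) ⊗ₖ ρR j)) := by
  ext ⟨⟨j, l, r⟩, c⟩ ⟨⟨j', l', r'⟩, c'⟩
  by_cases h : j = j'
  · subst h
    simp [margBC, blockState, assocEquivRight, assocEquiv, traceLeft, Finset.mul_sum,
      Finset.sum_mul]
  · simp [margBC, blockState, assocEquivRight, assocEquiv, Matrix.blockDiagonal'_apply_ne, h]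

theorem reindex_conj_kronecker_one [Fintype A] [DecidableEq A] [Fintype C] [DecidableEq C]
    [Fintype D]
    (U : Matrix B D ℂ) (X : Matrix (A × D) (A × D) ℂ) :
    Matrix.reindex (Equiv.prodAssoc A B C) (Equiv.prodAssoc A B C)
      ((((1 : Matrix A A ℂ) ⊗ₖ U) * X * ((1 : Matrix A A ℂ) ⊗ₖ U)ᴴ) ⊗ₖ (1 : Matrix C C ℂ)) =
    ((1 : Matrix A A ℂ) ⊗ₖ (U ⊗ₖ (1 : Matrix C C ℂ))) *
      Matrix.reindex (Equiv.prodAssoc A D C) (Equiv.prodAssoc A D C) (X ⊗ₖ (1 : Matrix C C ℂ)) *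
      ((1 : Matrix A A ℂ) ⊗ₖ (U ⊗ₖ (1 : Matrix C C ℂ)))ᴴ := by
  have h1 : (((1 : Matrix A A ℂ) ⊗ₖ U) * X * ((1 : Matrix A A ℂ) ⊗ₖ U)ᴴ) ⊗ₖ (1 : Matrix C C ℂ) =
      (((1 : Matrix A A ℂ) ⊗ₖ U) ⊗ₖ (1 : Matrix C C ℂ)) * (X ⊗ₖ (1 : Matrix C C ℂ)) *
        (((1 : Matrix A A ℂ) ⊗ₖ U) ⊗ₖ (1 : Matrix C C ℂ))ᴴ := by
    rw [Matrix.conjTranspose_kronecker _ (1 : Matrix C C ℂ), Matrix.conjTranspose_one,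
      ← Matrix.mul_kronecker_mul, ← Matrix.mul_kronecker_mul, mul_one, mul_one]
  rw [h1, ← Matrix.kronecker_assoc]
  simp only [Matrix.reindex_apply, Matrix.conjTranspose_submatrix, Matrix.submatrix_mul_equiv]

theorem one_kronecker_conj [Fintype A] [DecidableEq A] [Fintype C] [DecidableEq C] [Fintype D]
    (U : Matrix B D ℂ) (X : Matrix (D × C) (D × C) ℂ) :
    (1 : Matrix A A ℂ) ⊗ₖ ((U ⊗ₖ (1 : Matrix C C ℂ)) * X * (U ⊗ₖ (1 : Matrix C C ℂ))ᴴ) =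
    ((1 : Matrix A A ℂ) ⊗ₖ (U ⊗ₖ (1 : Matrix C C ℂ))) * ((1 : Matrix A A ℂ) ⊗ₖ X) *
      ((1 : Matrix A A ℂ) ⊗ₖ (U ⊗ₖ (1 : Matrix C C ℂ)))ᴴ := by
  rw [Matrix.conjTranspose_kronecker (1 : Matrix A A ℂ), Matrix.conjTranspose_one,
    ← Matrix.mul_kronecker_mul, ← Matrix.mul_kronecker_mul, mul_one, mul_one]

theorem reindex_blockDiagonal'_kronecker_one [DecidableEq C] (s : J → ℂ)
    (P : ∀ j, Matrix (A × bL j) (A × bL j) ℂ) (R : ∀ j, Matrix (bR j) (bR j) ℂ) :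
    Matrix.reindex (Equiv.prodAssoc A (Σ j, bL j × bR j) C) (Equiv.prodAssoc A _ C)
      (Matrix.reindex (assocEquivLeft A bL bR) (assocEquivLeft A bL bR)
        (Matrix.blockDiagonal' fun j => s j • (P j ⊗ₖ R j)) ⊗ₖ (1 : Matrix C C ℂ)) =
    Matrix.reindex (assocEquiv A C bL bR) (assocEquiv A C bL bR)
      (Matrix.blockDiagonal' fun j => s j • (P j ⊗ₖ (R j ⊗ₖ (1 : Matrix C C ℂ)))) := by
  ext ⟨a, ⟨j, l, r⟩, c⟩ ⟨a', ⟨j', l', r'⟩, c'⟩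
  by_cases h : j = j'
  · subst h
    simp [assocEquivLeft, assocEquiv, mul_assoc]
  · simp [assocEquivLeft, assocEquiv, Matrix.blockDiagonal'_apply_ne, h]

theorem one_kronecker_reindex_blockDiagonal' [DecidableEq A] (s : J → ℂ)
    (P : ∀ j, Matrix (bR j × C) (bR j × C) ℂ) (L : ∀ j, Matrix (bL j) (bL j) ℂ) :
    (1 : Matrix A A ℂ) ⊗ₖ
      (Matrix.reindex (assocEquivRight C bL bR) (assocEquivRight C bL bR)
        (Matrix.blockDiagonal' fun j => s j • (L j ⊗ₖ P j))) =
    Matrix.reindex (assocEquiv A C bL bR) (assocEquiv A C bL bR)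
      (Matrix.blockDiagonal' fun j => s j • (((1 : Matrix A A ℂ) ⊗ₖ L j) ⊗ₖ P j)) := by
  ext ⟨a, ⟨j, l, r⟩, c⟩ ⟨a', ⟨j', l', r'⟩, c'⟩
  by_cases h : j = j'
  · subst h
    simp only [assocEquivRight, assocEquiv, Matrix.kroneckerMap_apply, Matrix.reindex_apply,
      Matrix.submatrix_apply, Equiv.coe_fn_symm_mk, Matrix.blockDiagonal'_apply_eq,
      Matrix.smul_apply, smul_eq_mul]
    ring
  · simp [assocEquivRight, assocEquiv, Matrix.blockDiagonal'_apply_ne, h]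

end Marginals

/-- For a block-diagonal quantum Markov chain
`ρ_ABC = ⊕ⱼ qⱼ ρ_{A bLⱼ} ⊗ ρ_{bRⱼ C}` (with `H_B` unitarily identified via `U` with
`⊕ⱼ H_{bLⱼ} ⊗ H_{bRⱼ}`), the ampliated support projections `P_AB ⊗ 1_C` and
`1_A ⊗ P_BC` commute. -/
theorem blockdiag_support_projections_commute
    {A C : Type*} [Fintype A] [DecidableEq A] [Fintype C] [DecidableEq C]
    {J : Type*} [Fintype J] [DecidableEq J]
    (bL bR : J → Type*) [∀ j, Fintype (bL j)] [∀ j, Fintype (bR j)]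
    [∀ j, DecidableEq (bL j)] [∀ j, DecidableEq (bR j)]
    {B : Type*} [Fintype B] [DecidableEq B]
    (U : Matrix B (Σ j, bL j × bR j) ℂ) (hU₁ : Uᴴ * U = 1) (hU₂ : U * Uᴴ = 1)
    (q : J → ℝ) (hq₀ : ∀ j, 0 ≤ q j) (hq₁ : ∑ j, q j = 1)
    (ρL : ∀ j, Matrix (A × bL j) (A × bL j) ℂ)
    (hρL : ∀ j, IsDensityMatrix (ρL j))
    (ρR : ∀ j, Matrix (bR j × C) (bR j × C) ℂ)
    (hρR : ∀ j, IsDensityMatrix (ρR j))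
    (ρ : Matrix (A × B × C) (A × B × C) ℂ)
    (hρ : ρ = ((1 : Matrix A A ℂ) ⊗ₖ (U ⊗ₖ (1 : Matrix C C ℂ))) *
        blockState bL bR q ρL ρR *
        ((1 : Matrix A A ℂ) ⊗ₖ (U ⊗ₖ (1 : Matrix C C ℂ)))ᴴ)
    (PAB : Matrix (A × B) (A × B) ℂ) (hPAB : IsSupportProj (margAB ρ) PAB)
    (PBC : Matrix (B × C) (B × C) ℂ) (hPBC : IsSupportProj (margBC ρ) PBC) :
    (Matrix.reindex (Equiv.prodAssoc A B C) (Equiv.prodAssoc A B C)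
        (PAB ⊗ₖ (1 : Matrix C C ℂ))) * ((1 : Matrix A A ℂ) ⊗ₖ PBC)
      = ((1 : Matrix A A ℂ) ⊗ₖ PBC) *
        (Matrix.reindex (Equiv.prodAssoc A B C) (Equiv.prodAssoc A B C)
          (PAB ⊗ₖ (1 : Matrix C C ℂ))) := by
  choose PL hPL using fun j => (hρL j).1.isHermitian.exists_isAlgSupportProj
  choose PR hPR using fun j => (hρR j).1.isHermitian.exists_isAlgSupportProj
  choose QL hQL using fun j => (hρL j).1.isHermitian.traceLeft.exists_isAlgSupportProj
  choose QR hQR using fun j => (hρR j).1.isHermitian.traceRight.exists_isAlgSupportProj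
  have hVL : ((1 : Matrix A A ℂ) ⊗ₖ U)ᴴ * ((1 : Matrix A A ℂ) ⊗ₖ U) = 1 := by
    rw [Matrix.conjTranspose_kronecker, ← Matrix.mul_kronecker_mul, hU₁,
      Matrix.conjTranspose_one, mul_one, Matrix.one_kronecker_one]
  have hVR : (U ⊗ₖ (1 : Matrix C C ℂ))ᴴ * (U ⊗ₖ (1 : Matrix C C ℂ)) = 1 := by
    rw [Matrix.conjTranspose_kronecker, ← Matrix.mul_kronecker_mul, hU₁,
      Matrix.conjTranspose_one, mul_one, Matrix.one_kronecker_one]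
  have hW : ((1 : Matrix A A ℂ) ⊗ₖ (U ⊗ₖ (1 : Matrix C C ℂ)))ᴴ *
      ((1 : Matrix A A ℂ) ⊗ₖ (U ⊗ₖ (1 : Matrix C C ℂ))) = 1 := by
    rw [Matrix.conjTranspose_kronecker, ← Matrix.mul_kronecker_mul, hVR,
      Matrix.conjTranspose_one, mul_one, Matrix.one_kronecker_one]
  have hL := ((IsAlgSupportProj.blockDiagonal' fun j =>
    ((hPL j).kronecker (hQR j)).smul (q j)).reindex (assocEquivLeft A bL bR)).conj_isometry hVL
  have hR := ((IsAlgSupportProj.blockDiagonal' fun j =>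
    ((hQL j).kronecker (hPR j)).smul (q j)).reindex (assocEquivRight C bL bR)).conj_isometry hVR
  rw [← margAB_blockState, ← margAB_conj, ← hρ] at hL
  rw [← margBC_blockState, ← margBC_conj, ← hρ] at hR
  rw [hPAB.unique hL.isSupportProj, hPBC.unique hR.isSupportProj, reindex_conj_kronecker_one,
    one_kronecker_conj, reindex_blockDiagonal'_kronecker_one,
    one_kronecker_reindex_blockDiagonal']
  refine conj_isometry_commute hW ?_
  simp only [Commute, SemiconjBy, Matrix.reindex_apply, Matrix.submatrix_mul_equiv,
    ← Matrix.blockDiagonal'_mul]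
  congr 2
  funext j
  simp only [Matrix.smul_mul, Matrix.mul_smul, ← Matrix.mul_kronecker_mul,
    ((hPL j).commute_one_kronecker (hρL j).1 (hQL j)).eq,
    ((hPR j).commute_kronecker_one (hρR j).1 (hQR j)).eq]
end

section
/- Let ρ_BC be a density matrix on H_B ⊗ H_C satisfying S(C)_ρ + S(BC)_ρ − S(B)_ρ = 0. Then every density matrix τ_BC on H_B ⊗ H_C whose support is contained in the support of ρ_BC satisfies τ_C = ρ_C, i.e. the partial traces over B agree. -/
open Matrix Kronecker BigOperators
open scoped ComplexOrder

/-- Reduced density matrix on `B` (partial trace over `C`) of a state on `B × C`. -/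
noncomputable def margFst {B C : Type*} [Fintype C]
    (ρ : Matrix (B × C) (B × C) ℂ) : Matrix B B ℂ :=
  Matrix.of fun b b' => ∑ c : C, ρ (b, c) (b', c)

/-- Reduced density matrix on `C` (partial trace over `B`) of a state on `B × C`. -/
noncomputable def margSnd {B C : Type*} [Fintype B]
    (ρ : Matrix (B × C) (B × C) ℂ) : Matrix C C ℂ :=
  Matrix.of fun c c' => ∑ b : B, ρ (b, c) (b, c')

/-- The scalar inequality behind Klein's inequality, with its equality case. -/
theorem mul_log_sub_mul_log_nonneg {p q : ℝ} (hp : 0 ≤ p) (hq : 0 < q) :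
    0 ≤ p * Real.log p - p * Real.log q - p + q ∧
      (p * Real.log p - p * Real.log q - p + q = 0 → p = q) := by
  rcases hp.eq_or_lt with rfl | hp
  · exact ⟨by simp [hq.le], fun h => by simpa using h.symm⟩
  have hlog : Real.log (q / p) = Real.log q - Real.log p := Real.log_div hq.ne' hp.ne'
  have hmul : p * (q / p) = q := by field_simp
  constructor
  · nlinarith [Real.log_le_sub_one_of_pos (div_pos hq hp)]
  · intro h
    by_contra hne
    have hlt := Real.log_lt_sub_one_of_pos (div_pos hq hp)
      (fun h' => hne (by rw [div_eq_one_iff_eq hp.ne'] at h'; exact h'.symm))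
    nlinarith

/-- The equality case of the classical inequality underlying Klein's inequality, for a doubly
stochastic matrix `P` connecting the spectra `p` and `q`. -/
theorem doublyStochastic_entropy_eq {n : Type*} [Fintype n] {P : n → n → ℝ} {p q : n → ℝ}
    (hP : ∀ i j, 0 ≤ P i j) (hrow : ∀ i, ∑ j, P i j = 1) (hcol : ∀ j, ∑ i, P i j = 1)
    (hp : ∀ i, 0 ≤ p i) (hq : ∀ j, 0 ≤ q j) (hsum : ∑ i, p i = ∑ j, q j)
    (hsupp : ∀ i j, q j = 0 → P i j * p i = 0)
    (hent : ∑ i, p i * Real.log (p i) = ∑ j, (∑ i, P i j * p i) * Real.log (q j)) (i j : n) :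
    P i j = 0 ∨ p i = q j := by
  have hterm : ∀ i j, 0 ≤ P i j * (p i * Real.log (p i) - p i * Real.log (q j) - p i + q j) ∧
      (P i j * (p i * Real.log (p i) - p i * Real.log (q j) - p i + q j) = 0 →
        P i j = 0 ∨ p i = q j) := by
    intro i j
    rcases (hq j).eq_or_lt with h | h
    · rcases mul_eq_zero.mp (hsupp i j h.symm) with h' | h' <;> simp [h', ← h]
    · obtain ⟨h1, h2⟩ := mul_log_sub_mul_log_nonneg (hp i) h
      exact ⟨mul_nonneg (hP i j) h1, fun h0 => (mul_eq_zero.mp h0).imp_right h2⟩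
  have hzero : ∑ i, ∑ j, P i j * (p i * Real.log (p i) - p i * Real.log (q j) - p i + q j) = 0 := by
    have h1 : ∑ i, ∑ j, P i j * (p i * Real.log (p i)) = ∑ i, p i * Real.log (p i) := by
      simp [← Finset.sum_mul, hrow]
    have h2 : ∑ i, ∑ j, P i j * (p i * Real.log (q j)) =
        ∑ j, (∑ i, P i j * p i) * Real.log (q j) := by
      rw [Finset.sum_comm]
      simp [Finset.sum_mul, mul_assoc]
    have h3 : ∑ i, ∑ j, P i j * p i = ∑ i, p i := by simp [← Finset.sum_mul, hrow]
    have h4 : ∑ i, ∑ j, P i j * q j = ∑ j, q j := by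
      rw [Finset.sum_comm]
      simp [← Finset.sum_mul, hcol]
    simp only [mul_add, mul_sub, Finset.sum_add_distrib, Finset.sum_sub_distrib, h1, h2, h3, h4]
    linarith
  rw [Finset.sum_eq_zero_iff_of_nonneg
    (fun i _ => Finset.sum_nonneg fun j _ => (hterm i j).1)] at hzero
  have hi := hzero i (Finset.mem_univ i)
  rw [Finset.sum_eq_zero_iff_of_nonneg (fun j _ => (hterm i j).1)] at hi
  exact (hterm i j).2 (hi j (Finset.mem_univ j))

theorem vNEntropy_eq_sum_roots {n : Type*} [Fintype n] [DecidableEq n] {ρ : Matrix n n ℂ}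
    (h : ρ.IsHermitian) :
    vNEntropy ρ = -(ρ.charpoly.roots.map fun z => z.re * Real.log z.re).sum := by
  rw [vNEntropy, dif_pos h, h.roots_charpoly_eq_eigenvalues]
  simp

/-- The two Gram matrices of a rectangular matrix have the same entropy. -/
theorem vNEntropy_mul_conjTranspose {m n : Type*} [Fintype m] [DecidableEq m] [Fintype n]
    [DecidableEq n] (M : Matrix m n ℂ) : vNEntropy (M * Mᴴ) = vNEntropy (Mᴴ * M) := by
  rw [vNEntropy_eq_sum_roots (isHermitian_mul_conjTranspose_self M),
    vNEntropy_eq_sum_roots (isHermitian_conjTranspose_mul_self M)]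
  have h := congrArg Polynomial.roots (charpoly_mul_comm' M Mᴴ)
  have hX : ∀ k : ℕ, (Polynomial.X ^ k : Polynomial ℂ) ≠ 0 := fun k =>
    pow_ne_zero _ Polynomial.X_ne_zero
  rw [Polynomial.roots_mul (mul_ne_zero (hX _) (charpoly_monic _).ne_zero),
    Polynomial.roots_mul (mul_ne_zero (hX _) (charpoly_monic _).ne_zero)] at h
  have h' := congrArg (fun s => (s.map fun z : ℂ => z.re * Real.log z.re).sum) h
  simpa [Polynomial.roots_X_pow, Multiset.map_nsmul, Multiset.sum_nsmul] using h'

theorem vNEntropy_transpose {n : Type*} [Fintype n] [DecidableEq n] {ρ : Matrix n n ℂ}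
    (h : ρ.IsHermitian) : vNEntropy ρᵀ = vNEntropy ρ := by
  rw [vNEntropy_eq_sum_roots h, vNEntropy_eq_sum_roots h.transpose, charpoly_transpose]

/-- Equality case of Klein's inequality: if the entropy of `σ` equals its cross entropy relative
to the state with eigenbasis `V` and spectrum `q`, then the two states coincide. -/
theorem conj_eq_diagonal_of_cross_entropy_eq {n : Type*} [Fintype n] [DecidableEq n]
    {σ V : Matrix n n ℂ} (hσ : σ.PosSemidef) (hV : Vᴴ * V = 1) {q : n → ℝ}
    (hq : ∀ j, 0 ≤ q j) (htr : σ.trace = ∑ j, (q j : ℂ))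
    (hsupp : ∀ j, q j = 0 → (Vᴴ * σ * V) j j = 0)
    (hent : vNEntropy σ = -∑ j, ((Vᴴ * σ * V) j j).re * Real.log (q j)) :
    Vᴴ * σ * V = diagonal fun j => (q j : ℂ) := by
  have hV' : V * Vᴴ = 1 := mul_eq_one_comm.mp hV
  set p := hσ.1.eigenvalues
  set U : Matrix n n ℂ := (hσ.1.eigenvectorUnitary : Matrix n n ℂ)
  have hU1 : Uᴴ * U = 1 := Unitary.coe_star_mul_self hσ.1.eigenvectorUnitary
  have hU2 : U * Uᴴ = 1 := mul_eq_one_comm.mp hU1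
  have hspec : σ = U * diagonal (fun i => (p i : ℂ)) * Uᴴ := by
    have := hσ.1.spectral_theorem
    rw [Unitary.conjStarAlgAut_apply] at this
    exact this
  set W : Matrix n n ℂ := Uᴴ * V with hW
  have hW1 : Wᴴ * W = 1 := by
    rw [hW, conjTranspose_mul, conjTranspose_conjTranspose, Matrix.mul_assoc,
      ← Matrix.mul_assoc U, hU2, Matrix.one_mul, hV]
  have hW2 : W * Wᴴ = 1 := mul_eq_one_comm.mp hW1
  have hconj : Vᴴ * σ * V = Wᴴ * (diagonal (fun i => (p i : ℂ)) * W) := by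
    rw [hspec, hW, conjTranspose_mul, conjTranspose_conjTranspose]
    simp only [Matrix.mul_assoc]
  have hdiag : ∀ j, (Vᴴ * σ * V) j j = ((∑ i, Complex.normSq (W i j) * p i : ℝ) : ℂ) := by
    intro j
    rw [hconj, mul_apply]
    push_cast
    refine Finset.sum_congr rfl fun i _ => ?_
    rw [diagonal_mul, conjTranspose_apply, Complex.normSq_eq_conj_mul_self, Complex.star_def]
    ring
  have hcol : ∀ j, ∑ i, Complex.normSq (W i j) = 1 := by
    intro j
    have := congrFun (congrFun hW1 j) j
    rw [mul_apply, one_apply_eq] at this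
    have h2 : ((∑ i, Complex.normSq (W i j) : ℝ) : ℂ) = 1 := by
      rw [← this]
      push_cast
      simp [Complex.normSq_eq_conj_mul_self]
    exact_mod_cast h2
  have hrow : ∀ i, ∑ j, Complex.normSq (W i j) = 1 := by
    intro i
    have := congrFun (congrFun hW2 i) i
    rw [mul_apply, one_apply_eq] at this
    have h2 : ((∑ j, Complex.normSq (W i j) : ℝ) : ℂ) = 1 := by
      rw [← this]
      push_cast
      simp [Complex.mul_conj]
    exact_mod_cast h2
  have hpq : ∑ i, p i = ∑ j, q j := by
    rw [hσ.1.trace_eq_sum_eigenvalues] at htr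
    have h : ((∑ i, p i : ℝ) : ℂ) = ((∑ j, q j : ℝ) : ℂ) := by
      push_cast
      exact htr
    exact_mod_cast h
  have key := doublyStochastic_entropy_eq (P := fun i j => Complex.normSq (W i j)) (p := p)
    (fun i j => Complex.normSq_nonneg _) hrow hcol hσ.eigenvalues_nonneg hq hpq
    (fun i j hj => by
      have h0 := hsupp j hj
      rw [hdiag j, Complex.ofReal_eq_zero, Finset.sum_eq_zero_iff_of_nonneg
        (fun i _ => mul_nonneg (Complex.normSq_nonneg _) (hσ.eigenvalues_nonneg i))] at h0
      exact h0 i (Finset.mem_univ i))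
    (by
      rw [vNEntropy, dif_pos hσ.1] at hent
      simpa only [hdiag, Complex.ofReal_re, neg_inj] using hent)
  have hcomm : diagonal (fun i => (p i : ℂ)) * W = W * diagonal (fun j => (q j : ℂ)) := by
    ext i j
    rw [diagonal_mul, mul_diagonal]
    rcases key i j with h | h
    · simp [Complex.normSq_eq_zero.mp h]
    · rw [h, mul_comm]
  rw [hconj, hcomm, ← Matrix.mul_assoc, hW1, Matrix.one_mul]

theorem Matrix.PosSemidef.exists_diagonalization {n : Type*} [Fintype n] [DecidableEq n]
    {ρ : Matrix n n ℂ} (hρ : ρ.PosSemidef) :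
    ∃ (V : Matrix n n ℂ) (q : n → ℝ), Vᴴ * V = 1 ∧ (∀ i, 0 ≤ q i) ∧
      Vᴴ * ρ * V = diagonal (fun i => (q i : ℂ)) ∧
      vNEntropy ρ = -∑ i, q i * Real.log (q i) := by
  have hV : (hρ.1.eigenvectorUnitary : Matrix n n ℂ)ᴴ * hρ.1.eigenvectorUnitary = 1 :=
    Unitary.coe_star_mul_self hρ.1.eigenvectorUnitary
  refine ⟨hρ.1.eigenvectorUnitary, hρ.1.eigenvalues, hV, hρ.eigenvalues_nonneg, ?_, ?_⟩
  · have := hρ.1.conjStarAlgAut_star_eigenvectorUnitary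
    rw [Unitary.conjStarAlgAut_star_apply] at this
    exact this
  · rw [vNEntropy, dif_pos hρ.1]

theorem margFst_apply {B C : Type*} [Fintype C] (ρ : Matrix (B × C) (B × C) ℂ) (b b' : B) :
    margFst ρ b b' = ∑ c, ρ (b, c) (b', c) := rfl

theorem margSnd_apply {B C : Type*} [Fintype B] (ρ : Matrix (B × C) (B × C) ℂ) (c c' : C) :
    margSnd ρ c c' = ∑ b, ρ (b, c) (b, c') := rfl

theorem trace_margFst {B C : Type*} [Fintype B] [Fintype C] (ρ : Matrix (B × C) (B × C) ℂ) :
    (margFst ρ).trace = ρ.trace := by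
  simp [Matrix.trace, margFst_apply, Fintype.sum_prod_type]

theorem trace_margSnd {B C : Type*} [Fintype B] [Fintype C] (ρ : Matrix (B × C) (B × C) ℂ) :
    (margSnd ρ).trace = ρ.trace := by
  simp [Matrix.trace, margSnd_apply, Fintype.sum_prod_type_right]

theorem margFst_eq_sum {B C : Type*} [Fintype C] (ρ : Matrix (B × C) (B × C) ℂ) :
    margFst ρ = ∑ c, ρ.submatrix (fun b => (b, c)) (fun b => (b, c)) := by
  ext b b'
  simp [margFst_apply, Matrix.sum_apply]

theorem margSnd_eq_sum {B C : Type*} [Fintype B] (ρ : Matrix (B × C) (B × C) ℂ) :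
    margSnd ρ = ∑ b, ρ.submatrix (fun c => (b, c)) (fun c => (b, c)) := by
  ext c c'
  simp [margSnd_apply, Matrix.sum_apply]

theorem Matrix.PosSemidef.margFst {B C : Type*} [Fintype B] [Fintype C]
    {ρ : Matrix (B × C) (B × C) ℂ} (h : ρ.PosSemidef) : (margFst ρ).PosSemidef := by
  rw [margFst_eq_sum]
  exact posSemidef_sum _ fun c _ => h.submatrix _

theorem Matrix.PosSemidef.margSnd {B C : Type*} [Fintype B] [Fintype C]
    {ρ : Matrix (B × C) (B × C) ℂ} (h : ρ.PosSemidef) : (margSnd ρ).PosSemidef := by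
  rw [margSnd_eq_sum]
  exact posSemidef_sum _ fun c _ => h.submatrix _

/-- Local unitaries commute with the partial trace over the second factor. -/
theorem margFst_kronecker_conj {A C : Type*} [Fintype A] [DecidableEq A] [Fintype C]
    [DecidableEq C] (σ : Matrix (A × C) (A × C) ℂ) (V : Matrix A A ℂ) {W : Matrix C C ℂ}
    (hW : W * Wᴴ = 1) :
    margFst ((V ⊗ₖ W)ᴴ * σ * (V ⊗ₖ W)) = Vᴴ * margFst σ * V := by
  have hW' : ∀ d d', ∑ c, W d c * star (W d' c) = if d = d' then 1 else 0 := fun d d' => by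
    simpa [mul_apply, one_apply] using congrFun (congrFun hW d) d'
  ext a a'
  simp only [margFst_apply, mul_apply, Fintype.sum_prod_type, conjTranspose_apply,
    kroneckerMap_apply, Finset.sum_mul, Finset.mul_sum, star_mul']
  calc _ = ∑ x, ∑ d, ∑ y, ∑ d', (star (V y a) * σ (y, d') (x, d) * V x a') *
        ∑ c, W d c * star (W d' c) := by
        rw [Finset.sum_comm]
        refine Finset.sum_congr rfl fun x _ => ?_
        rw [Finset.sum_comm]
        refine Finset.sum_congr rfl fun d _ => ?_
        rw [Finset.sum_comm]
        refine Finset.sum_congr rfl fun y _ => ?_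
        rw [Finset.sum_comm]
        refine Finset.sum_congr rfl fun d' _ => ?_
        rw [Finset.mul_sum]
        refine Finset.sum_congr rfl fun c _ => ?_
        ring
    _ = _ := by
        simp only [hW', mul_ite, mul_one, mul_zero, Finset.sum_ite_eq, Finset.mem_univ, if_true]
        refine Finset.sum_congr rfl fun x _ => ?_
        rw [Finset.sum_comm]

/-- Local unitaries commute with the partial trace over the first factor. -/
theorem margSnd_kronecker_conj {A C : Type*} [Fintype A] [DecidableEq A] [Fintype C]
    [DecidableEq C] (σ : Matrix (A × C) (A × C) ℂ) {V : Matrix A A ℂ} (W : Matrix C C ℂ)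
    (hV : V * Vᴴ = 1) :
    margSnd ((V ⊗ₖ W)ᴴ * σ * (V ⊗ₖ W)) = Wᴴ * margSnd σ * W := by
  have hV' : ∀ d d', ∑ c, V d c * star (V d' c) = if d = d' then 1 else 0 := fun d d' => by
    simpa [mul_apply, one_apply] using congrFun (congrFun hV d) d'
  ext a a'
  simp only [margSnd_apply, mul_apply, Fintype.sum_prod_type_right, conjTranspose_apply,
    kroneckerMap_apply, Finset.sum_mul, Finset.mul_sum, star_mul']
  calc _ = ∑ x, ∑ d, ∑ y, ∑ d', (star (W y a) * σ (d', y) (d, x) * W x a') *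
        ∑ c, V d c * star (V d' c) := by
        rw [Finset.sum_comm]
        refine Finset.sum_congr rfl fun x _ => ?_
        rw [Finset.sum_comm]
        refine Finset.sum_congr rfl fun d _ => ?_
        rw [Finset.sum_comm]
        refine Finset.sum_congr rfl fun y _ => ?_
        rw [Finset.sum_comm]
        refine Finset.sum_congr rfl fun d' _ => ?_
        rw [Finset.mul_sum]
        refine Finset.sum_congr rfl fun c _ => ?_
        ring
    _ = _ := by
        simp only [hV', mul_ite, mul_one, mul_zero, Finset.sum_ite_eq, Finset.mem_univ, if_true]
        refine Finset.sum_congr rfl fun x _ => ?_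
        rw [Finset.sum_comm]

/-- Equality case of subadditivity: a state of zero mutual information is a product state. -/
theorem eq_kronecker_of_vNEntropy_add {A C : Type*} [Fintype A] [DecidableEq A] [Fintype C]
    [DecidableEq C] {σ : Matrix (A × C) (A × C) ℂ} (hσ : IsDensityMatrix σ)
    (hent : vNEntropy σ = vNEntropy (margFst σ) + vNEntropy (margSnd σ)) :
    σ = margFst σ ⊗ₖ margSnd σ := by
  obtain ⟨V, α, hV, hα, hVσ, hSα⟩ := hσ.1.margFst.exists_diagonalization
  obtain ⟨W, γ, hW, hγ, hWσ, hSγ⟩ := hσ.1.margSnd.exists_diagonalization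
  have hV' : V * Vᴴ = 1 := mul_eq_one_comm.mp hV
  have hW' : W * Wᴴ = 1 := mul_eq_one_comm.mp hW
  have hVW : (V ⊗ₖ W)ᴴ * (V ⊗ₖ W) = 1 := by
    rw [conjTranspose_kronecker, ← mul_kronecker_mul, hV, hW, one_kronecker_one]
  have hVW' : (V ⊗ₖ W) * (V ⊗ₖ W)ᴴ = 1 := mul_eq_one_comm.mp hVW
  set ω := (V ⊗ₖ W)ᴴ * σ * (V ⊗ₖ W) with hω
  have hωpos : ω.PosSemidef := hσ.1.conjTranspose_mul_mul_same _
  set r : A × C → ℝ := fun x => (ω x x).re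
  have hr0 : ∀ x, 0 ≤ r x := fun x => (Complex.nonneg_iff.mp hωpos.diag_nonneg).1
  have hωr : ∀ x, ω x x = (r x : ℂ) := fun x => Complex.ext rfl
    (by simpa using (Complex.nonneg_iff.mp (hωpos.diag_nonneg (i := x))).2.symm)
  have hsumC : ∀ a, ∑ c, r (a, c) = α a := fun a => by
    have h := congrFun (congrFun ((margFst_kronecker_conj σ V hW').trans hVσ) a) a
    rw [margFst_apply, diagonal_apply_eq] at h
    simp only [← hω, hωr] at h
    exact_mod_cast h
  have hsumA : ∀ c, ∑ a, r (a, c) = γ c := fun c => by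
    have h := congrFun (congrFun ((margSnd_kronecker_conj σ W hV').trans hWσ) c) c
    rw [margSnd_apply, diagonal_apply_eq] at h
    simp only [← hω, hωr] at h
    exact_mod_cast h
  have hrα : ∀ a c, α a = 0 → r (a, c) = 0 := fun a c h => by
    rw [← hsumC a, Finset.sum_eq_zero_iff_of_nonneg fun c _ => hr0 _] at h
    exact h c (Finset.mem_univ c)
  have hrγ : ∀ a c, γ c = 0 → r (a, c) = 0 := fun a c h => by
    rw [← hsumA c, Finset.sum_eq_zero_iff_of_nonneg fun a _ => hr0 _] at h
    exact h a (Finset.mem_univ a)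
  have htrω : ω.trace = 1 := by
    rw [hω, trace_mul_comm, ← Matrix.mul_assoc, hVW', Matrix.one_mul, hσ.2]
  have hαtr : ∑ a, α a = 1 := by
    have h : ((∑ a, α a : ℝ) : ℂ) = 1 := by
      rw [← htrω, Matrix.trace, Fintype.sum_prod_type]
      simp [hωr, ← hsumC]
    exact_mod_cast h
  have hγtr : ∑ c, γ c = 1 := by
    have h : ((∑ c, γ c : ℝ) : ℂ) = 1 := by
      rw [← htrω, Matrix.trace, Fintype.sum_prod_type_right]
      simp [hωr, ← hsumA]
    exact_mod_cast h
  have hcross : vNEntropy σ = -∑ x : A × C, r x * Real.log (α x.1 * γ x.2) := by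
    have hlog : ∀ x : A × C, r x * Real.log (α x.1 * γ x.2) =
        r x * Real.log (α x.1) + r x * Real.log (γ x.2) := by
      rintro ⟨a, c⟩
      by_cases ha : α a = 0
      · simp [hrα a c ha]
      by_cases hc : γ c = 0
      · simp [hrγ a c hc]
      rw [Real.log_mul ha hc, mul_add]
    simp only [hlog, Finset.sum_add_distrib]
    rw [Fintype.sum_prod_type, Fintype.sum_prod_type_right]
    simp only [← Finset.sum_mul, hsumA, hsumC]
    rw [hent, hSα, hSγ]
    ring
  have hdiag : ω = diagonal fun x : A × C => ((α x.1 * γ x.2 : ℝ) : ℂ) := by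
    refine conj_eq_diagonal_of_cross_entropy_eq hσ.1 hVW
      (fun x => mul_nonneg (hα _) (hγ _)) ?_ ?_ hcross
    · rw [hσ.2, ← Complex.ofReal_sum, Fintype.sum_prod_type]
      simp [← Finset.mul_sum, hαtr, hγtr]
    · rintro ⟨a, c⟩ h
      rw [← hω, hωr]
      rcases mul_eq_zero.mp h with h | h
      · simp [hrα a c h]
      · simp [hrγ a c h]
  have hprod : ω = (V ⊗ₖ W)ᴴ * (margFst σ ⊗ₖ margSnd σ) * (V ⊗ₖ W) := by
    rw [conjTranspose_kronecker, ← mul_kronecker_mul, ← mul_kronecker_mul, hVσ, hWσ,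
      diagonal_kronecker_diagonal, hdiag]
    simp
  have hundo : ∀ X : Matrix (A × C) (A × C) ℂ,
      (V ⊗ₖ W) * ((V ⊗ₖ W)ᴴ * X * (V ⊗ₖ W)) * (V ⊗ₖ W)ᴴ = X := fun X => by
    calc _ = ((V ⊗ₖ W) * (V ⊗ₖ W)ᴴ) * X * ((V ⊗ₖ W) * (V ⊗ₖ W)ᴴ) := by
          simp only [Matrix.mul_assoc]
      _ = X := by rw [hVW', Matrix.one_mul, Matrix.mul_one]
  rw [← hundo (margFst σ ⊗ₖ margSnd σ), ← hprod, hω, hundo]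

theorem Matrix.PosSemidef.exists_eq_mul_conjTranspose {n : Type*} [Fintype n]
    {ρ : Matrix n n ℂ} (hρ : ρ.PosSemidef) : ∃ K : Matrix n n ℂ, ρ = K * Kᴴ := by
  classical
  open scoped MatrixOrder in
  obtain ⟨L, hL⟩ := CStarAlgebra.nonneg_iff_eq_star_mul_self.mp hρ.nonneg
  rw [star_eq_conjTranspose] at hL
  exact ⟨Lᴴ, by rw [hL, conjTranspose_conjTranspose]⟩

/-- A matrix whose kernel contains that of `M` factors through `M`. -/
theorem Matrix.exists_eq_mul_of_mulVec_eq_zero {l m n : Type*} [Fintype m] [DecidableEq m]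
    [Fintype n] [DecidableEq n] {T : Matrix l n ℂ} {M : Matrix m n ℂ}
    (h : ∀ v, M *ᵥ v = 0 → T *ᵥ v = 0) : ∃ W : Matrix l m ℂ, T = W * M := by
  have hker : LinearMap.ker (toLin' M) ≤ LinearMap.ker (toLin' T) := fun v hv => by
    simpa using h v (by simpa using hv)
  obtain ⟨g, hg⟩ := LinearMap.exists_extend
    ((LinearMap.ker (toLin' M)).liftQ (toLin' T) hker ∘ₗ
      (toLin' M).quotKerEquivRange.symm.toLinearMap)
  refine ⟨LinearMap.toMatrix' g, toLin'.injective (LinearMap.ext fun v => ?_)⟩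
  have hv := LinearMap.congr_fun hg ⟨toLin' M v, LinearMap.mem_range_self _ v⟩
  rw [toLin'_mul, toLin'_toMatrix']
  have hq : (toLin' M).quotKerEquivRange.symm ⟨toLin' M v, LinearMap.mem_range_self _ v⟩ =
      Submodule.Quotient.mk v := by
    rw [LinearEquiv.symm_apply_eq]
    rfl
  simp only [LinearMap.comp_apply, LinearEquiv.coe_coe, hq] at hv
  simpa using hv.symm

/-- The matrix of amplitudes, between `A × C` and `B`, of the vector whose amplitudes between
`B × C` and `A` are `K`. -/
def regroup {A B C : Type*} (K : Matrix (B × C) A ℂ) : Matrix (A × C) B ℂ :=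
  Matrix.of fun x b => K (b, x.2) x.1

theorem regroup_apply {A B C : Type*} (K : Matrix (B × C) A ℂ) (x : A × C) (b : B) :
    regroup K x b = K (b, x.2) x.1 := rfl

theorem margFst_regroup {A B C : Type*} [Fintype B] [Fintype C] (K : Matrix (B × C) A ℂ) :
    margFst (regroup K * (regroup K)ᴴ) = (Kᴴ * K)ᵀ := by
  ext a a'
  simp only [margFst_apply, regroup_apply, transpose_apply, mul_apply,
    conjTranspose_apply, Fintype.sum_prod_type_right]
  simp only [mul_comm]

theorem margSnd_regroup {A B C : Type*} [Fintype A] [Fintype B] (K : Matrix (B × C) A ℂ) :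
    margSnd (regroup K * (regroup K)ᴴ) = margSnd (K * Kᴴ) := by
  ext c c'
  simp only [margSnd_apply, regroup_apply, mul_apply, conjTranspose_apply]
  exact Finset.sum_comm

theorem conjTranspose_regroup_mul_regroup {A B C : Type*} [Fintype A] [Fintype C]
    (K : Matrix (B × C) A ℂ) :
    (regroup K)ᴴ * regroup K = (margFst (K * Kᴴ))ᵀ := by
  ext b b'
  simp only [regroup_apply, margFst_apply, transpose_apply, mul_apply, conjTranspose_apply,
    Fintype.sum_prod_type_right]
  simp only [mul_comm]

/-- A state supported in the range of `K` is obtained from the purification `K` by an operation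
on the purifying system. -/
theorem margSnd_mul_mul_conjTranspose {A B C : Type*} [Fintype A] [Fintype B]
    (K : Matrix (B × C) A ℂ) (X : Matrix A A ℂ) (c c' : C) :
    margSnd (K * X * Kᴴ) c c' =
      ∑ a', ∑ a, X a a' * (regroup K * (regroup K)ᴴ) (a, c) (a', c') := by
  simp only [margSnd_apply, regroup_apply, mul_apply, conjTranspose_apply,
    Finset.sum_mul, Finset.mul_sum]
  rw [Finset.sum_comm]
  refine Finset.sum_congr rfl fun a' _ => ?_
  rw [Finset.sum_comm]
  refine Finset.sum_congr rfl fun a _ => Finset.sum_congr rfl fun b _ => ?_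
  ring

/-- If `ρ_BC` is a density matrix with `S(C) + S(BC) - S(B) = 0`, then
every density matrix `τ_BC` whose support is contained in the support of `ρ_BC`
(equivalently, `ker ρ ⊆ ker τ`) has the same reduced state on `C`: `τ_C = ρ_C`. -/
theorem marginal_determined_on_support
    {B C : Type*} [Fintype B] [DecidableEq B] [Fintype C] [DecidableEq C]
    (ρ : Matrix (B × C) (B × C) ℂ) (hρ : IsDensityMatrix ρ)
    (hA0 : vNEntropy (margSnd ρ) + vNEntropy ρ - vNEntropy (margFst ρ) = 0)
    (τ : Matrix (B × C) (B × C) ℂ) (hτ : IsDensityMatrix τ)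
    (hsupp : ∀ v : B × C → ℂ, ρ.mulVec v = 0 → τ.mulVec v = 0) :
    margSnd τ = margSnd ρ := by
  obtain ⟨K, hK⟩ := hρ.1.exists_eq_mul_conjTranspose
  obtain ⟨T, hT⟩ := hτ.1.exists_eq_mul_conjTranspose
  obtain ⟨W, hW⟩ : ∃ W, Tᴴ = W * Kᴴ := Matrix.exists_eq_mul_of_mulVec_eq_zero fun v hv => by
    rw [← self_mul_conjTranspose_mulVec_eq_zero, ← hT]
    exact hsupp v (by rw [hK, self_mul_conjTranspose_mulVec_eq_zero, hv])
  have hτK : τ = K * (Wᴴ * W) * Kᴴ := by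
    have hT' : T = K * Wᴴ := by
      rw [← conjTranspose_conjTranspose T, hW, conjTranspose_mul, conjTranspose_conjTranspose]
    rw [hT, hW, hT']
    simp only [Matrix.mul_assoc]
  set σ := regroup K * (regroup K)ᴴ with hσ
  have hσC : margSnd σ = margSnd ρ := by rw [hσ, margSnd_regroup, hK]
  have hσd : IsDensityMatrix σ :=
    ⟨posSemidef_self_mul_conjTranspose _, by rw [← trace_margSnd, hσC, trace_margSnd, hρ.2]⟩
  have hSA : vNEntropy (margFst σ) = vNEntropy ρ := by
    rw [hσ, margFst_regroup, vNEntropy_transpose (isHermitian_conjTranspose_mul_self K),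
      ← vNEntropy_mul_conjTranspose, hK]
  have hSB : vNEntropy σ = vNEntropy (margFst ρ) := by
    rw [hσ, vNEntropy_mul_conjTranspose, conjTranspose_regroup_mul_regroup, ← hK,
      vNEntropy_transpose hρ.1.margFst.1]
  have hprod := eq_kronecker_of_vNEntropy_add hσd (by rw [hSA, hSB, hσC]; linarith)
  have hscal : margSnd τ =
      (∑ a', ∑ a, (Wᴴ * W) a a' * margFst σ a a') • margSnd ρ := by
    ext c c'
    have hentry : ∀ a a', σ (a, c) (a', c') = margFst σ a a' * margSnd ρ c c' := fun a a' => by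
      rw [← hσC]
      exact congrFun (congrFun hprod (a, c)) (a', c')
    rw [hτK, margSnd_mul_mul_conjTranspose, ← hσ, Matrix.smul_apply, smul_eq_mul]
    simp only [hentry, Finset.sum_mul, mul_assoc]
  have hone := congrArg Matrix.trace hscal
  rw [trace_smul, trace_margSnd, trace_margSnd, hτ.2, hρ.2, smul_eq_mul, mul_one] at hone
  rw [hscal, ← hone, one_smul]
end

section
/- Let ψ be a unit vector in H_A ⊗ H_B ⊗ H_C whose induced density matrix ρ = |ψ⟩⟨ψ| has factorizing marginal on AC: ρ_AC = ρ_A ⊗ ρ_C. Then there exist finite-dimensional complex Hilbert spaces H_{B_L} and H_{B_R}, a linear isometry V : H_{B_L} ⊗ H_{B_R} → H_B, and unit vectors ψ₁ ∈ H_A ⊗ H_{B_L} and ψ₂ ∈ H_{B_R} ⊗ H_C, such that ψ = (1_A ⊗ V ⊗ 1_C)(ψ₁ ⊗ ψ₂), where the tensor factors are reordered in the canonical way. -/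
open Matrix Kronecker BigOperators
open scoped ComplexOrder

/-- A positive semidefinite matrix factors as `L * Lᴴ` with `L` left invertible. -/
theorem Matrix.PosSemidef.exists_eq_mul_conjTranspose_leftInvertible
    {n : Type*} [Fintype n] [DecidableEq n] {P : Matrix n n ℂ} (hP : P.PosSemidef) :
    ∃ (k : ℕ) (L : Matrix n (Fin k) ℂ) (K : Matrix (Fin k) n ℂ), P = L * Lᴴ ∧ K * L = 1 := by
  set ev := hP.isHermitian.eigenvalues
  set U : Matrix n n ℂ := (hP.isHermitian.eigenvectorUnitary : Matrix n n ℂ)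
  have hUU : Uᴴ * U = 1 := Unitary.coe_star_mul_self hP.isHermitian.eigenvectorUnitary
  have hspec : P = U * diagonal (fun i => (ev i : ℂ)) * Uᴴ := by
    conv_lhs => rw [hP.isHermitian.spectral_theorem]
    rfl
  have hnonneg : ∀ i, 0 ≤ ev i := hP.eigenvalues_nonneg
  let e := Fintype.equivFin {i // ev i ≠ 0}
  refine ⟨_, of fun a j => U a (e.symm j) * (Real.sqrt (ev (e.symm j)) : ℂ),
    of fun j a => (Real.sqrt (ev (e.symm j)) : ℂ)⁻¹ * star (U a (e.symm j)), ?_, ?_⟩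
  · ext a a'
    have hterm : ∀ i, (Real.sqrt (ev i) : ℂ) * (Real.sqrt (ev i) : ℂ) = ev i := fun i => by
      rw [← Complex.ofReal_mul, Real.mul_self_sqrt (hnonneg i)]
    calc P a a' = ∑ i, U a i * ev i * star (U a' i) := by
          conv_lhs => rw [hspec]
          simp only [mul_apply (N := Uᴴ), mul_diagonal, conjTranspose_apply]
      _ = ∑ i : {i // ev i ≠ 0}, U a i * ev i * star (U a' i) := by
          rw [← Finset.sum_subtype (Finset.univ.filter fun i => ev i ≠ 0) (by simp)
            (fun i => U a i * ev i * star (U a' i)), Finset.sum_filter_of_ne]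
          rintro i - hi h0
          simp [h0] at hi
      _ = _ := by
          rw [← e.symm.sum_comp]
          simp only [mul_apply, of_apply, conjTranspose_apply]
          refine Finset.sum_congr rfl fun j _ => ?_
          rw [← hterm]
          simp
          ring
  · ext j j'
    have hne : (Real.sqrt (ev (e.symm j)) : ℂ) ≠ 0 := by
      rw [Ne, Complex.ofReal_eq_zero, Real.sqrt_eq_zero (hnonneg _)]
      exact (e.symm j).2
    have horth := congrFun₂ hUU (e.symm j : n) (e.symm j' : n)
    rw [mul_apply] at horth
    simp only [conjTranspose_apply, one_apply, Subtype.coe_inj, e.symm.injective.eq_iff] at horth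
    calc _ = (Real.sqrt (ev (e.symm j)) : ℂ)⁻¹ * (∑ a, star (U a (e.symm j)) * U a (e.symm j')) *
            (Real.sqrt (ev (e.symm j')) : ℂ) := by
          simp only [mul_apply, of_apply, Finset.mul_sum, Finset.sum_mul, mul_assoc]
      _ = _ := by
          rw [horth, one_apply]
          split_ifs with h
          · subst h
            simp [hne]
          · simp

/-- If `Ψ * Ψᴴ = W * Wᴴ` and `K` is a left inverse of `W`, then `Ψ = W * (K * Ψ)`. -/
theorem Matrix.eq_mul_mul_of_mul_conjTranspose_eq
    {m n k : Type*} [Fintype m] [DecidableEq m] [Fintype n] [Fintype k] [DecidableEq k]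
    {Ψ : Matrix m n ℂ} {W : Matrix m k ℂ} {K : Matrix k m ℂ}
    (h : Ψ * Ψᴴ = W * Wᴴ) (hK : K * W = 1) : Ψ = W * (K * Ψ) := by
  have hzero : (W * K - 1) * W = 0 := by
    rw [Matrix.sub_mul, Matrix.mul_assoc, hK, Matrix.mul_one, Matrix.one_mul, sub_self]
  have hsq : ((W * K - 1) * Ψ) * ((W * K - 1) * Ψ)ᴴ = 0 := by
    rw [conjTranspose_mul, Matrix.mul_assoc, ← Matrix.mul_assoc Ψ, h, Matrix.mul_assoc W,
      ← Matrix.mul_assoc, hzero, Matrix.zero_mul]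
  rw [self_mul_conjTranspose_eq_zero, Matrix.sub_mul, Matrix.one_mul, sub_eq_zero] at hsq
  rw [← Matrix.mul_assoc, hsq]

/-- Let `ψ` be a unit vector in `H_A ⊗ H_B ⊗ H_C` whose induced density
matrix `|ψ⟩⟨ψ|` has factorizing marginal on `AC`: `ρ_AC = ρ_A ⊗ ρ_C`. Then there exist
finite-dimensional Hilbert spaces `H_BL`, `H_BR`, a linear isometry
`V : H_BL ⊗ H_BR → H_B`, and unit vectors `ψ₁ ∈ H_A ⊗ H_BL`, `ψ₂ ∈ H_BR ⊗ H_C`, with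
`ψ = (1_A ⊗ V ⊗ 1_C)(ψ₁ ⊗ ψ₂)` (tensor factors reordered in the canonical way). -/
theorem pure_state_with_factorizing_AC_marginal_factorizes
    {A B C : Type*} [Fintype A] [DecidableEq A] [Fintype B] [DecidableEq B]
    [Fintype C] [DecidableEq C]
    (ψ : A × B × C → ℂ) (hψ : star ψ ⬝ᵥ ψ = 1)
    (ρA : Matrix A A ℂ)
    (hρA : ρA = Matrix.of fun a a' => ∑ b : B, ∑ c : C, ψ (a, b, c) * star (ψ (a', b, c)))
    (ρC : Matrix C C ℂ)
    (hρC : ρC = Matrix.of fun c c' => ∑ a : A, ∑ b : B, ψ (a, b, c) * star (ψ (a, b, c')))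
    (hfact : (Matrix.of fun p q : A × C =>
        ∑ b : B, ψ (p.1, b, p.2) * star (ψ (q.1, b, q.2))) = ρA ⊗ₖ ρC) :
    ∃ (nL nR : ℕ) (V : Matrix B (Fin nL × Fin nR) ℂ)
      (ψ₁ : A × Fin nL → ℂ) (ψ₂ : Fin nR × C → ℂ),
      Vᴴ * V = 1 ∧
      star ψ₁ ⬝ᵥ ψ₁ = 1 ∧
      star ψ₂ ⬝ᵥ ψ₂ = 1 ∧
      ψ = ((1 : Matrix A A ℂ) ⊗ₖ (V ⊗ₖ (1 : Matrix C C ℂ))).mulVec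
            (fun x => ψ₁ (x.1, x.2.1.1) * ψ₂ (x.2.1.2, x.2.2)) := by
  have hA : ρA = (of fun a (x : B × C) => ψ (a, x.1, x.2)) *
      (of fun a (x : B × C) => ψ (a, x.1, x.2))ᴴ := by
    ext a a'
    simp [hρA, mul_apply, Fintype.sum_prod_type]
  have hC : ρC = (of fun c (x : A × B) => ψ (x.1, x.2, c)) *
      (of fun c (x : A × B) => ψ (x.1, x.2, c))ᴴ := by
    ext c c'
    simp [hρC, mul_apply, Fintype.sum_prod_type]
  have htrA : ρA.trace = 1 := by
    rw [← hψ, hρA]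
    simp [Matrix.trace, dotProduct, Fintype.sum_prod_type, mul_comm]
  have htrC : ρC.trace = 1 := by
    rw [← hψ, hρC]
    simp only [Matrix.trace, diag_apply, of_apply, dotProduct, Fintype.sum_prod_type,
      Pi.star_apply, mul_comm]
    rw [Finset.sum_comm]
    exact Finset.sum_congr rfl fun a _ => Finset.sum_comm
  obtain ⟨nL, L, KL, hL, hKL⟩ :=
    (hA ▸ posSemidef_self_mul_conjTranspose _ : ρA.PosSemidef)
      |>.exists_eq_mul_conjTranspose_leftInvertible
  obtain ⟨nR, R, KR, hR, hKR⟩ :=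
    (hC ▸ posSemidef_self_mul_conjTranspose _ : ρC.PosSemidef)
      |>.exists_eq_mul_conjTranspose_leftInvertible
  let Ψ : Matrix (A × C) B ℂ := of fun p b => ψ (p.1, b, p.2)
  have hΨ : Ψ * Ψᴴ = (L ⊗ₖ R) * (L ⊗ₖ R)ᴴ := by
    rw [conjTranspose_kronecker, ← mul_kronecker_mul, ← hL, ← hR, ← hfact]
    rfl
  have hK : (KL ⊗ₖ KR) * (L ⊗ₖ R) = 1 := by
    rw [← mul_kronecker_mul, hKL, hKR, one_kronecker_one]
  have hfactor := eq_mul_mul_of_mul_conjTranspose_eq hΨ hK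
  set T := (KL ⊗ₖ KR) * Ψ with hT
  have hTT : T * Tᴴ = 1 := by
    rw [hT, conjTranspose_mul, Matrix.mul_assoc, ← Matrix.mul_assoc Ψ, hΨ, Matrix.mul_assoc _ _ᴴ,
      ← conjTranspose_mul, hK, conjTranspose_one, Matrix.mul_one, hK]
  refine ⟨nL, nR, Tᵀ, fun x => L x.1 x.2, fun x => R x.2 x.1, ?_, ?_, ?_, ?_⟩
  · rw [← transpose_one, ← hTT, transpose_mul T]
    rfl
  · rw [← htrA, hL]
    simp [Matrix.trace, dotProduct, Fintype.sum_prod_type, mul_apply, mul_comm]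
  · rw [← htrC, hR]
    simp only [Matrix.trace, diag_apply, mul_apply, conjTranspose_apply, dotProduct,
      Fintype.sum_prod_type, Pi.star_apply, mul_comm]
    exact Finset.sum_comm
  · ext ⟨a, b, c⟩
    have h := congrFun₂ hfactor (a, c) b
    simp only [Ψ, of_apply, mul_apply, Fintype.sum_prod_type, kronecker_apply] at h
    rw [h]
    simp only [mulVec, dotProduct, Fintype.sum_prod_type, kronecker_apply, transpose_apply]
    rw [Finset.sum_eq_single a (fun a' _ ha => by simp [one_apply_ne ha.symm]) (by simp)]
    refine Finset.sum_congr rfl fun l _ => Finset.sum_congr rfl fun r _ => ?_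
    rw [Finset.sum_eq_single c (fun c' _ hc => by simp [one_apply_ne hc.symm]) (by simp)]
    simp only [one_apply_eq]
    ring
end

section
/- Let ρ_ABC and σ_ABC be density matrices on H_A ⊗ H_B ⊗ H_C with I(A:C|B)_ρ = 0 and I(A:C|B)_σ = 0. If ρ_AB = σ_AB and ρ_BC = σ_BC, then ρ_ABC = σ_ABC. -/
open Matrix Kronecker BigOperators
open scoped ComplexOrder

/-- `ρ = U diag(p) Uᴴ` with `U` unitary. -/
def IsEigendecomp {n : Type*} [Fintype n] [DecidableEq n]
    (ρ U : Matrix n n ℂ) (p : n → ℝ) : Prop :=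
  U * Uᴴ = 1 ∧ Uᴴ * U = 1 ∧ ρ = U * diagonal (fun i => (p i : ℂ)) * Uᴴ

lemma Matrix.IsHermitian.isEigendecomp {n : Type*} [Fintype n] [DecidableEq n]
    {ρ : Matrix n n ℂ} (h : ρ.IsHermitian) :
    IsEigendecomp ρ (h.eigenvectorUnitary : Matrix n n ℂ) h.eigenvalues := by
  refine ⟨?_, ?_, ?_⟩
  · exact Unitary.mul_star_self_of_mem h.eigenvectorUnitary.2
  · exact Unitary.star_mul_self_of_mem h.eigenvectorUnitary.2
  · conv_lhs => rw [h.spectral_theorem]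
    rfl

lemma sum_norm_sq_row_of_mul_conjTranspose {n : Type*} [Fintype n] [DecidableEq n]
    {M : Matrix n n ℂ} (hM : M * Mᴴ = 1) (i : n) : ∑ j, ‖M i j‖ ^ 2 = 1 := by
  have h := congrFun (congrFun hM i) i
  simp only [mul_apply, conjTranspose_apply, one_apply_eq, RCLike.star_def, Complex.mul_conj,
    Complex.normSq_eq_norm_sq] at h
  exact_mod_cast h

lemma sum_norm_sq_col_of_conjTranspose_mul {n : Type*} [Fintype n] [DecidableEq n]
    {M : Matrix n n ℂ} (hM : Mᴴ * M = 1) (j : n) : ∑ i, ‖M i j‖ ^ 2 = 1 := by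
  have h := congrFun (congrFun hM j) j
  simp only [mul_apply, conjTranspose_apply, one_apply_eq, RCLike.star_def, Complex.conj_mul'] at h
  exact_mod_cast h

/-- The transition probabilities between two bases. -/
noncomputable def overlap {n : Type*} [Fintype n] (U V : Matrix n n ℂ) (i j : n) : ℝ :=
  ‖(Uᴴ * V) i j‖ ^ 2

lemma overlap_nonneg {n : Type*} [Fintype n] (U V : Matrix n n ℂ) (i j : n) :
    0 ≤ overlap U V i j := by
  unfold overlap; positivity

section Overlap

variable {n : Type*} [Fintype n] [DecidableEq n] {ρ σ U V : Matrix n n ℂ} {p q : n → ℝ}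

lemma overlap_sum_row (hU : Uᴴ * U = 1) (hV : V * Vᴴ = 1) (i : n) :
    ∑ j, overlap U V i j = 1 := by
  refine sum_norm_sq_row_of_mul_conjTranspose ?_ i
  rw [conjTranspose_mul, conjTranspose_conjTranspose, Matrix.mul_assoc, ← Matrix.mul_assoc V, hV,
    Matrix.one_mul, hU]

lemma overlap_sum_col (hU : U * Uᴴ = 1) (hV : Vᴴ * V = 1) (j : n) :
    ∑ i, overlap U V i j = 1 := by
  refine sum_norm_sq_col_of_conjTranspose_mul ?_ j
  rw [conjTranspose_mul, conjTranspose_conjTranspose, Matrix.mul_assoc, ← Matrix.mul_assoc U, hU,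
    Matrix.one_mul, hV]

/-- Diagonal entries of `ρ` in the basis `U`. -/
lemma IsEigendecomp.diag_entry (hρ : IsEigendecomp ρ V p) (U : Matrix n n ℂ) (i : n) :
    (Uᴴ * ρ * U) i i = ((∑ j, overlap U V i j * p j : ℝ) : ℂ) := by
  have h : Uᴴ * ρ * U = (Uᴴ * V) * diagonal (fun i => (p i : ℂ)) * (Uᴴ * V)ᴴ := by
    rw [hρ.2.2, conjTranspose_mul, conjTranspose_conjTranspose]
    simp only [Matrix.mul_assoc]
  rw [h, mul_apply]
  push_cast
  refine Finset.sum_congr rfl fun j _ => ?_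
  rw [mul_diagonal, conjTranspose_apply, overlap]
  push_cast
  rw [← Complex.mul_conj', RCLike.star_def]
  ring

/-- A quadratic functional whose supremum over `X` is
`∑ i j, overlap U V i j * p j ^ 2 / (q i + t * p j)`. -/
noncomputable def quadFunctional (ρ σ : Matrix n n ℂ) (t : ℝ) (X : Matrix n n ℂ) : ℝ :=
  2 * (trace (Xᴴ * ρ)).re - (trace (X * Xᴴ * σ)).re - t * (trace (Xᴴ * X * ρ)).re

lemma quadFunctional_eq (hρ : IsEigendecomp ρ V p) (hσ : IsEigendecomp σ U q) (t : ℝ)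
    (Y : Matrix n n ℂ) :
    quadFunctional ρ σ t (U * Y * Vᴴ) =
      ∑ i, ∑ j, (2 * (star (Y i j) * (Uᴴ * V) i j).re * p j - (q i + t * p j) * ‖Y i j‖ ^ 2) := by
  obtain ⟨hV1, hV2, rfl⟩ := hρ
  obtain ⟨hU1, hU2, rfl⟩ := hσ
  set P := diagonal (fun i => (p i : ℂ))
  set Q := diagonal (fun i => (q i : ℂ))
  have h1 : trace ((U * Y * Vᴴ)ᴴ * (V * P * Vᴴ)) = trace (Yᴴ * ((Uᴴ * V) * P)) := by
    have : (U * Y * Vᴴ)ᴴ * (V * P * Vᴴ) = V * (Yᴴ * ((Uᴴ * V) * P) * Vᴴ) := by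
      simp only [conjTranspose_mul, conjTranspose_conjTranspose, Matrix.mul_assoc]
    rw [this, trace_mul_comm, Matrix.mul_assoc, hV2, Matrix.mul_one]
  have h2 : trace ((U * Y * Vᴴ) * (U * Y * Vᴴ)ᴴ * (U * Q * Uᴴ)) = trace (Y * (Yᴴ * Q)) := by
    have : (U * Y * Vᴴ) * (U * Y * Vᴴ)ᴴ * (U * Q * Uᴴ)
        = U * (Y * (Vᴴ * V) * Yᴴ * (Uᴴ * U) * Q * Uᴴ) := by
      simp only [conjTranspose_mul, conjTranspose_conjTranspose, Matrix.mul_assoc]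
    rw [this, trace_mul_comm, hV2, hU2, Matrix.mul_one, Matrix.mul_one, Matrix.mul_assoc, hU2,
      Matrix.mul_one, Matrix.mul_assoc]
  have h3 : trace ((U * Y * Vᴴ)ᴴ * (U * Y * Vᴴ) * (V * P * Vᴴ)) = trace (Yᴴ * (Y * P)) := by
    have : (U * Y * Vᴴ)ᴴ * (U * Y * Vᴴ) * (V * P * Vᴴ)
        = V * (Yᴴ * (Uᴴ * U) * Y * (Vᴴ * V) * P * Vᴴ) := by
      simp only [conjTranspose_mul, conjTranspose_conjTranspose, Matrix.mul_assoc]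
    rw [this, trace_mul_comm, hV2, hU2, Matrix.mul_one, Matrix.mul_one, Matrix.mul_assoc, hV2,
      Matrix.mul_one, Matrix.mul_assoc]
  have e1 : (trace (Yᴴ * ((Uᴴ * V) * P))).re
      = ∑ i, ∑ j, (star (Y i j) * (Uᴴ * V) i j).re * p j := by
    rw [Finset.sum_comm]
    simp only [trace, diag_apply, mul_apply (M := Yᴴ), Complex.re_sum, P, mul_diagonal,
      conjTranspose_apply]
    refine Finset.sum_congr rfl fun i _ => Finset.sum_congr rfl fun j _ => ?_
    rw [← mul_assoc, Complex.re_mul_ofReal]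
  have e2 : (trace (Y * (Yᴴ * Q))).re = ∑ i, ∑ j, q i * ‖Y i j‖ ^ 2 := by
    simp only [trace, diag_apply, mul_apply (M := Y), Complex.re_sum, Q, mul_diagonal,
      conjTranspose_apply]
    refine Finset.sum_congr rfl fun i _ => Finset.sum_congr rfl fun j _ => ?_
    rw [← mul_assoc, Complex.re_mul_ofReal, RCLike.star_def, Complex.mul_conj',
      mul_comm]
    norm_cast
  have e3 : (trace (Yᴴ * (Y * P))).re = ∑ i, ∑ j, p j * ‖Y i j‖ ^ 2 := by
    rw [Finset.sum_comm]
    simp only [trace, diag_apply, mul_apply (M := Yᴴ), Complex.re_sum, P, mul_diagonal,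
      conjTranspose_apply]
    refine Finset.sum_congr rfl fun i _ => Finset.sum_congr rfl fun j _ => ?_
    rw [← mul_assoc, Complex.re_mul_ofReal, RCLike.star_def, Complex.conj_mul',
      mul_comm]
    norm_cast
  rw [quadFunctional, h1, h2, h3, e1, e2, e3]
  simp only [Finset.mul_sum, ← Finset.sum_sub_distrib]
  refine Finset.sum_congr rfl fun i _ => Finset.sum_congr rfl fun j _ => ?_
  ring

lemma quadFunctional_le (hρ : IsEigendecomp ρ V p) (hσ : IsEigendecomp σ U q)
    (hp : ∀ j, 0 ≤ p j) (hq : ∀ i, 0 < q i) {t : ℝ} (ht : 0 ≤ t) (X : Matrix n n ℂ) :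
    quadFunctional ρ σ t X ≤ ∑ i, ∑ j, overlap U V i j * (p j ^ 2 / (q i + t * p j)) := by
  have hX : X = U * (Uᴴ * X * V) * Vᴴ := by
    rw [← Matrix.mul_assoc, ← Matrix.mul_assoc, hσ.1, Matrix.one_mul, Matrix.mul_assoc, hρ.1,
      Matrix.mul_one]
  rw [hX, quadFunctional_eq hρ hσ]
  refine Finset.sum_le_sum fun i _ => Finset.sum_le_sum fun j _ => ?_
  set y := (Uᴴ * X * V) i j
  have hd : 0 < q i + t * p j := by have := mul_nonneg ht (hp j); linarith [hq i]
  have hre : (star y * (Uᴴ * V) i j).re ≤ ‖y‖ * ‖(Uᴴ * V) i j‖ := by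
    refine (Complex.re_le_norm _).trans ?_
    rw [norm_mul, norm_star]
  have h1 := mul_le_mul_of_nonneg_right hre (hp j)
  rw [overlap, ← mul_div_assoc, le_div_iff₀ hd]
  have h2 := mul_le_mul_of_nonneg_right h1 hd.le
  nlinarith [sq_nonneg (‖(Uᴴ * V) i j‖ * p j - (q i + t * p j) * ‖y‖)]

lemma exists_quadFunctional_eq (hρ : IsEigendecomp ρ V p) (hσ : IsEigendecomp σ U q)
    (hp : ∀ j, 0 ≤ p j) (hq : ∀ i, 0 < q i) {t : ℝ} (ht : 0 ≤ t) :
    ∃ X, quadFunctional ρ σ t X = ∑ i, ∑ j, overlap U V i j * (p j ^ 2 / (q i + t * p j)) := by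
  refine ⟨U * (of fun i j => ((p j / (q i + t * p j) : ℝ) : ℂ) * (Uᴴ * V) i j) * Vᴴ, ?_⟩
  rw [quadFunctional_eq hρ hσ]
  refine Finset.sum_congr rfl fun i _ => Finset.sum_congr rfl fun j _ => ?_
  have hd : 0 < q i + t * p j := by have := mul_nonneg ht (hp j); linarith [hq i]
  rw [of_apply, overlap]
  generalize (Uᴴ * V) i j = z
  rw [star_mul, RCLike.star_def, Complex.conj_ofReal,
    mul_right_comm (starRingEnd ℂ z), Complex.conj_mul', norm_mul, mul_pow, Complex.norm_real,
    Real.norm_eq_abs, sq_abs]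
  norm_cast
  field_simp
  ring

end Overlap

lemma hasDerivAt_sum_mul_log {K : Type*} [Fintype K] (w : K → ℝ) {p q : K → ℝ}
    (hp : ∀ k, 0 ≤ p k) (hq : ∀ k, 0 < q k) {t : ℝ} (ht : 0 ≤ t) :
    HasDerivAt (fun T => ∑ k, w k * (p k * (Real.log (q k + T * p k) - Real.log (q k))))
      (∑ k, w k * (p k ^ 2 / (q k + t * p k))) t := by
  refine HasDerivAt.fun_sum fun k _ => ?_
  have hd : 0 < q k + t * p k := by have := mul_nonneg ht (hp k); linarith [hq k]
  have h1 : HasDerivAt (fun T : ℝ => q k + T * p k) (p k) t := by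
    simpa using ((hasDerivAt_id t).mul_const (p k)).const_add (q k)
  have h2 := (((h1.log hd.ne').sub_const (Real.log (q k))).const_mul (p k)).const_mul (w k)
  rwa [← mul_div_assoc, ← sq] at h2

lemma tendsto_sum_mul_log_sub {K : Type*} [Fintype K] (w : K → ℝ) {p q : K → ℝ}
    (hp : ∀ k, 0 ≤ p k) (hq : ∀ k, 0 < q k) :
    Filter.Tendsto
      (fun T => ∑ k, w k * (p k * (Real.log (q k + T * p k) - Real.log (q k)))
        - Real.log T * ∑ k, w k * p k)
      Filter.atTop (nhds (∑ k, w k * (p k * (Real.log (p k) - Real.log (q k))))) := by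
  simp only [Finset.mul_sum, ← Finset.sum_sub_distrib]
  refine tendsto_finsetSum _ fun k _ => ?_
  rcases (hp k).eq_or_lt with h0 | h0
  · simp [← h0]
  have h1 : Filter.Tendsto (fun T : ℝ => Real.log (q k / T + p k)) Filter.atTop
      (nhds (Real.log (p k))) := by
    have h2 : Filter.Tendsto (fun T : ℝ => q k / T + p k) Filter.atTop (nhds (0 + p k)) :=
      (tendsto_const_nhds.div_atTop Filter.tendsto_id).add_const _
    rw [zero_add] at h2
    exact h2.log h0.ne'
  refine (((h1.sub_const (Real.log (q k))).const_mul (p k)).const_mul (w k)).congr' ?_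
  filter_upwards [Filter.eventually_gt_atTop 0] with T hT
  have h3 : q k + T * p k = T * (q k / T + p k) := by field_simp
  have h4 : 0 < q k / T + p k := by have := div_pos (hq k) hT; linarith
  rw [h3, Real.log_mul hT.ne' h4.ne']
  ring

lemma sum_mul_log_sub_log_le {K L : Type*} [Fintype K] [Fintype L]
    {w p q : K → ℝ} {w' p' q' : L → ℝ} (hp : ∀ k, 0 ≤ p k) (hq : ∀ k, 0 < q k)
    (hp' : ∀ k, 0 ≤ p' k) (hq' : ∀ k, 0 < q' k)
    (hsum : ∑ k, w' k * p' k = ∑ k, w k * p k)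
    (hle : ∀ t : ℝ, 0 ≤ t →
      ∑ k, w' k * (p' k ^ 2 / (q' k + t * p' k)) ≤ ∑ k, w k * (p k ^ 2 / (q k + t * p k))) :
    ∑ k, w' k * (p' k * (Real.log (p' k) - Real.log (q' k))) ≤
      ∑ k, w k * (p k * (Real.log (p k) - Real.log (q k))) := by
  refine le_of_tendsto_of_tendsto (tendsto_sum_mul_log_sub w' hp' hq')
    (tendsto_sum_mul_log_sub w hp hq) ?_
  filter_upwards [Filter.eventually_ge_atTop 0] with T hT
  rw [hsum]
  refine sub_le_sub_right ?_ _
  have hder := fun (t : ℝ) (ht : 0 ≤ t) =>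
    (hasDerivAt_sum_mul_log w hp hq ht).fun_sub (hasDerivAt_sum_mul_log w' hp' hq' ht)
  have hmono := monotoneOn_of_deriv_nonneg (convex_Ici (0 : ℝ))
    (fun t ht => (hder t ht).continuousAt.continuousWithinAt)
    (fun t ht => (hder t (interior_subset ht)).differentiableAt.differentiableWithinAt)
    (fun t ht => by
      rw [(hder t (interior_subset ht)).deriv]
      exact sub_nonneg.2 (hle t (interior_subset ht)))
  have h := hmono (Set.mem_Ici.2 le_rfl) (Set.mem_Ici.2 hT) hT
  simp only [zero_mul, add_zero, sub_self, mul_zero, Finset.sum_const_zero] at h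
  linarith

/-- Monotonicity of relative entropy under the dual of a star-homomorphism `E`. -/
theorem relEntropy_mono {m n : Type*} [Fintype m] [DecidableEq m] [Fintype n] [DecidableEq n]
    (E : Matrix m m ℂ → Matrix n n ℂ) (hone : E 1 = 1)
    (hmul : ∀ X Y, E (X * Y) = E X * E Y) (hstar : ∀ X, E Xᴴ = (E X)ᴴ)
    {ρ σ U V : Matrix n n ℂ} {p q : n → ℝ} {ρ' σ' U' V' : Matrix m m ℂ} {p' q' : m → ℝ}
    (hρE : ∀ X, trace (E X * ρ) = trace (X * ρ')) (hσE : ∀ X, trace (E X * σ) = trace (X * σ'))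
    (hρ : IsEigendecomp ρ V p) (hσ : IsEigendecomp σ U q)
    (hρ' : IsEigendecomp ρ' V' p') (hσ' : IsEigendecomp σ' U' q')
    (hp : ∀ j, 0 ≤ p j) (hq : ∀ i, 0 < q i) (hp' : ∀ j, 0 ≤ p' j) (hq' : ∀ i, 0 < q' i) :
    ∑ i, ∑ j, overlap U' V' i j * (p' j * (Real.log (p' j) - Real.log (q' i))) ≤
      ∑ i, ∑ j, overlap U V i j * (p j * (Real.log (p j) - Real.log (q i))) := by
  have htr := hρE 1
  rw [hone, Matrix.one_mul, Matrix.one_mul, hρ.2.2, hρ'.2.2, trace_mul_comm, ← Matrix.mul_assoc,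
    hρ.2.1, Matrix.one_mul, trace_mul_comm, ← Matrix.mul_assoc, hρ'.2.1, Matrix.one_mul,
    trace_diagonal, trace_diagonal] at htr
  have htr' : ∑ j, p' j = ∑ j, p j := by exact_mod_cast htr.symm
  simp only [← Fintype.sum_prod_type']
  refine sum_mul_log_sub_log_le (p := fun k : n × n => p k.2) (q := fun k : n × n => q k.1)
    (p' := fun k : m × m => p' k.2) (q' := fun k : m × m => q' k.1)
    (w := fun k : n × n => overlap U V k.1 k.2) (w' := fun k : m × m => overlap U' V' k.1 k.2)
    (fun _ => hp _) (fun _ => hq _) (fun _ => hp' _) (fun _ => hq' _) ?_ ?_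
  · simp only [Fintype.sum_prod_type_right, ← Finset.sum_mul]
    simp only [overlap_sum_col hσ.1 hρ.2.1, overlap_sum_col hσ'.1 hρ'.2.1, one_mul, htr']
  · intro t ht
    simp only [Fintype.sum_prod_type]
    obtain ⟨Y, hY⟩ := exists_quadFunctional_eq hρ' hσ' hp' hq' ht
    rw [← hY]
    refine le_trans (le_of_eq ?_) (quadFunctional_le hρ hσ hp hq ht (E Y))
    rw [quadFunctional, quadFunctional, ← hstar, ← hmul, ← hmul, hρE, hρE, hσE]

lemma sum_overlap_mul_log_sub_log {n : Type*} [Fintype n] [DecidableEq n]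
    {ρ U V : Matrix n n ℂ} {p q : n → ℝ} (hρ : IsEigendecomp ρ V p) (hU : U * Uᴴ = 1) :
    ∑ i, ∑ j, overlap U V i j * (p j * (Real.log (p j) - Real.log (q i))) =
      ∑ j, p j * Real.log (p j) - ∑ i, ((Uᴴ * ρ * U) i i).re * Real.log (q i) := by
  simp only [hρ.diag_entry, Complex.ofReal_re, mul_sub, Finset.sum_sub_distrib, Finset.sum_mul]
  congr 1
  · rw [Finset.sum_comm]
    simp only [← Finset.sum_mul, overlap_sum_col hU hρ.2.1, one_mul]
  · simp only [mul_assoc]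

/-- Partial trace over the first factor. -/
noncomputable def traceFst {A D : Type*} [Fintype A]
    (ρ : Matrix (A × D) (A × D) ℂ) : Matrix D D ℂ :=
  of fun d d' => ∑ a : A, ρ (a, d) (a, d')

lemma traceFst_conj_one_kronecker {A D : Type*} [Fintype A] [DecidableEq A] [Fintype D]
    (ρ : Matrix (A × D) (A × D) ℂ) (R : Matrix D D ℂ) :
    traceFst (((1 : Matrix A A ℂ) ⊗ₖ R)ᴴ * ρ * ((1 : Matrix A A ℂ) ⊗ₖ R)) =
      Rᴴ * traceFst ρ * R := by
  ext d d'
  simp only [traceFst, of_apply, mul_apply, conjTranspose_kronecker, conjTranspose_one,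
    Fintype.sum_prod_type, kroneckerMap_apply, one_apply, ite_mul, one_mul, zero_mul,
    mul_ite, mul_zero, Finset.sum_ite_eq, Finset.sum_ite_eq', Finset.mem_univ, if_true,
    Finset.sum_ite_irrel, Finset.sum_const_zero, Finset.sum_mul, Finset.mul_sum]
  rw [Finset.sum_comm]
  refine Finset.sum_congr rfl fun x _ => ?_
  rw [Finset.sum_comm]

section TraceFst

variable {A D : Type*} [Fintype A] [DecidableEq A] [Fintype D] [DecidableEq D]

lemma IsEigendecomp.one_kronecker_add {ω R : Matrix D D ℂ} {r : D → ℝ}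
    (h : IsEigendecomp ω R r) (ε : ℝ) :
    IsEigendecomp ((1 : Matrix A A ℂ) ⊗ₖ (ω + (ε : ℂ) • (1 : Matrix D D ℂ)))
      ((1 : Matrix A A ℂ) ⊗ₖ R) (fun k => r k.2 + ε) := by
  have hd : diagonal (fun k : A × D => ((r k.2 + ε : ℝ) : ℂ)) =
      (1 : Matrix A A ℂ) ⊗ₖ (diagonal (fun i => (r i : ℂ)) + (ε : ℂ) • (1 : Matrix D D ℂ)) := by
    rw [← diagonal_one, ← diagonal_one, ← diagonal_smul, diagonal_add, diagonal_kronecker_diagonal]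
    congr 1
    ext k
    simp
  refine ⟨?_, ?_, ?_⟩
  · rw [conjTranspose_kronecker, ← mul_kronecker_mul, h.1, conjTranspose_one, Matrix.one_mul,
      one_kronecker_one]
  · rw [conjTranspose_kronecker, ← mul_kronecker_mul, h.2.1, conjTranspose_one, Matrix.one_mul,
      one_kronecker_one]
  · rw [hd, conjTranspose_kronecker, ← mul_kronecker_mul, ← mul_kronecker_mul, conjTranspose_one,
      Matrix.one_mul, Matrix.one_mul, Matrix.mul_add, Matrix.add_mul, ← h.2.2, Matrix.mul_smul,
      Matrix.smul_mul, Matrix.mul_one, h.1]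

lemma sum_diag_re_mul_log {ρ : Matrix (A × D) (A × D) ℂ} {R : Matrix D D ℂ} {r : D → ℝ}
    (h : IsEigendecomp (traceFst ρ) R r) (ε : ℝ) :
    ∑ k : A × D, ((((1 : Matrix A A ℂ) ⊗ₖ R)ᴴ * ρ * ((1 : Matrix A A ℂ) ⊗ₖ R)) k k).re *
      Real.log (r k.2 + ε) = ∑ d, r d * Real.log (r d + ε) := by
  rw [Fintype.sum_prod_type_right]
  refine Finset.sum_congr rfl fun d _ => ?_
  dsimp only
  rw [← Finset.sum_mul, ← Complex.re_sum]
  congr 1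
  have h1 := congrFun (congrFun (traceFst_conj_one_kronecker ρ R) d) d
  rw [h.2.2] at h1
  have h2 : Rᴴ * (R * diagonal (fun i => (r i : ℂ)) * Rᴴ) * R =
      (Rᴴ * R) * diagonal (fun i => (r i : ℂ)) * (Rᴴ * R) := by simp only [Matrix.mul_assoc]
  rw [h2, h.2.1, Matrix.one_mul, Matrix.mul_one, diagonal_apply_eq] at h1
  change ∑ a : A, _ = _ at h1
  rw [h1, Complex.ofReal_re]

end TraceFst

section PartialTraces

variable {A B C : Type*}

/-- The embedding `X ↦ X ⊗ 1_C` of operators on `A × B` into operators on `A × B × C`. -/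
noncomputable def ampliate [DecidableEq C] (X : Matrix (A × B) (A × B) ℂ) :
    Matrix (A × B × C) (A × B × C) ℂ :=
  of fun x y => if x.2.2 = y.2.2 then X (x.1, x.2.1) (y.1, y.2.1) else 0

lemma ampliate_one [DecidableEq A] [DecidableEq B] [DecidableEq C] :
    ampliate (C := C) (1 : Matrix (A × B) (A × B) ℂ) = 1 := by
  ext ⟨a, b, c⟩ ⟨a', b', c'⟩
  simp only [ampliate, of_apply, one_apply, Prod.mk.injEq]
  split_ifs <;> simp_all

lemma ampliate_conjTranspose [DecidableEq C] (X : Matrix (A × B) (A × B) ℂ) :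
    ampliate (C := C) Xᴴ = (ampliate X)ᴴ := by
  ext ⟨a, b, c⟩ ⟨a', b', c'⟩
  simp only [ampliate, of_apply, conjTranspose_apply, eq_comm (a := c)]
  split_ifs <;> simp

lemma ampliate_mul [Fintype A] [Fintype B] [Fintype C] [DecidableEq C]
    (X Y : Matrix (A × B) (A × B) ℂ) :
    ampliate (C := C) (X * Y) = ampliate X * ampliate Y := by
  ext ⟨a, b, c⟩ ⟨a', b', c'⟩
  simp only [ampliate, of_apply, mul_apply, Fintype.sum_prod_type, ite_mul, zero_mul,
    mul_ite, mul_zero]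
  by_cases h : c = c' <;> simp [h]

lemma trace_ampliate_mul [Fintype A] [Fintype B] [Fintype C] [DecidableEq C]
    (X : Matrix (A × B) (A × B) ℂ)
    (ρ : Matrix (A × B × C) (A × B × C) ℂ) :
    trace (ampliate X * ρ) = trace (X * margAB ρ) := by
  simp only [ampliate, margAB, trace, diag_apply, of_apply, mul_apply, Fintype.sum_prod_type,
    ite_mul, zero_mul, Finset.sum_ite_eq, Finset.mem_univ, if_true, Finset.mul_sum]
  refine Finset.sum_congr rfl fun a _ => Finset.sum_congr rfl fun b _ => ?_
  rw [Finset.sum_comm]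
  refine Finset.sum_congr rfl fun a' _ => ?_
  rw [Finset.sum_comm]

lemma traceFst_margAB [Fintype A] [Fintype C] (ρ : Matrix (A × B × C) (A × B × C) ℂ) :
    traceFst (margAB ρ) = margB ρ := rfl

lemma margAB_one_kronecker [Fintype A] [DecidableEq A] [DecidableEq B] [Fintype C]
    [DecidableEq C]
    (ρ : Matrix (A × B × C) (A × B × C) ℂ) (ε : ℝ) :
    margAB ((1 : Matrix A A ℂ) ⊗ₖ (margBC ρ + (ε : ℂ) • (1 : Matrix (B × C) (B × C) ℂ))) =
      (1 : Matrix A A ℂ) ⊗ₖ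
        (margB ρ + ((Fintype.card C * ε : ℝ) : ℂ) • (1 : Matrix B B ℂ)) := by
  ext ⟨a, b⟩ ⟨a', b'⟩
  simp only [margAB, margBC, margB, of_apply, kroneckerMap_apply, Matrix.add_apply,
    Matrix.smul_apply,
    smul_eq_mul, one_apply, Prod.mk.injEq, and_true]
  rw [Finset.sum_comm (γ := A)]
  by_cases h : b = b' <;> simp [h, Finset.sum_add_distrib]

lemma margAB_posSemidef [Fintype C] {ρ : Matrix (A × B × C) (A × B × C) ℂ} (h : ρ.PosSemidef) :
    (margAB ρ).PosSemidef := by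
  have : margAB ρ = ∑ c : C, ρ.submatrix (fun p : A × B => (p.1, p.2, c))
      (fun p : A × B => (p.1, p.2, c)) := by
    ext p q
    simp [margAB, Matrix.sum_apply]
  rw [this]
  exact posSemidef_sum _ fun c _ => h.submatrix _

lemma traceFst_posSemidef [Fintype A] {D : Type*} {ρ : Matrix (A × D) (A × D) ℂ}
    (h : ρ.PosSemidef) : (traceFst ρ).PosSemidef := by
  have : traceFst ρ = ∑ a : A, ρ.submatrix (fun d => (a, d)) (fun d => (a, d)) := by
    ext p q
    simp [traceFst, Matrix.sum_apply]
  rw [this]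
  exact posSemidef_sum _ fun c _ => h.submatrix _

end PartialTraces

lemma tendsto_sum_mul_log_add {D : Type*} [Fintype D] (r : D → ℝ) (c : ℝ) :
    Filter.Tendsto (fun ε : ℝ => ∑ d, r d * Real.log (r d + c * ε)) (nhdsWithin 0 (Set.Ioi 0))
      (nhds (∑ d, r d * Real.log (r d))) := by
  refine tendsto_finsetSum _ fun d _ => ?_
  by_cases h : r d = 0
  · simp [h]
  have h1 : Filter.Tendsto (fun ε : ℝ => r d + c * ε) (nhds 0) (nhds (r d)) := by
    have : Continuous fun ε : ℝ => r d + c * ε := by fun_prop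
    simpa using this.tendsto 0
  exact ((h1.mono_left nhdsWithin_le_nhds).log h).const_mul (r d)

lemma vNEntropy_eq {n : Type*} [Fintype n] [DecidableEq n] {ρ : Matrix n n ℂ}
    (h : ρ.IsHermitian) :
    vNEntropy ρ = -∑ i, h.eigenvalues i * Real.log (h.eigenvalues i) := dif_pos h

/-- Strong subadditivity of the von Neumann entropy. -/
theorem CMI_nonneg {A B C : Type*} [Fintype A] [DecidableEq A] [Fintype B] [DecidableEq B]
    [Fintype C] [DecidableEq C] [Nonempty C] {ρ : Matrix (A × B × C) (A × B × C) ℂ}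
    (hρ : ρ.PosSemidef) : 0 ≤ CMI ρ := by
  have hAB := margAB_posSemidef hρ
  have hBC : (margBC ρ).PosSemidef := traceFst_posSemidef hρ
  have hB : (margB ρ).PosSemidef := traceFst_posSemidef hAB
  have key : ∀ ε : ℝ, 0 < ε →
      ∑ j, hAB.1.eigenvalues j * Real.log (hAB.1.eigenvalues j) -
        ∑ d, hB.1.eigenvalues d * Real.log (hB.1.eigenvalues d + Fintype.card C * ε) ≤
      ∑ j, hρ.1.eigenvalues j * Real.log (hρ.1.eigenvalues j) -
        ∑ d, hBC.1.eigenvalues d * Real.log (hBC.1.eigenvalues d + 1 * ε) := by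
    intro ε hε
    have hC : (0 : ℝ) < Fintype.card C := by exact_mod_cast Fintype.card_pos
    have dBC := hBC.1.isEigendecomp.one_kronecker_add (A := A) ε
    have dB := hB.1.isEigendecomp.one_kronecker_add (A := A) (Fintype.card C * ε)
    have h := relEntropy_mono (ampliate (C := C)) ampliate_one ampliate_mul ampliate_conjTranspose
      (fun X => trace_ampliate_mul X ρ)
      (fun X => by rw [trace_ampliate_mul, margAB_one_kronecker])
      hρ.1.isEigendecomp dBC hAB.1.isEigendecomp dB
      hρ.eigenvalues_nonneg (fun k => by have := hBC.eigenvalues_nonneg k.2; positivity)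
      hAB.eigenvalues_nonneg (fun k => by have := hB.eigenvalues_nonneg k.2; positivity)
    rw [sum_overlap_mul_log_sub_log hρ.1.isEigendecomp dBC.1,
      sum_overlap_mul_log_sub_log hAB.1.isEigendecomp dB.1,
      sum_diag_re_mul_log (ρ := ρ) hBC.1.isEigendecomp,
      sum_diag_re_mul_log (ρ := margAB ρ) hB.1.isEigendecomp] at h
    simpa only [one_mul] using h
  have hlim := le_of_tendsto_of_tendsto
    (tendsto_const_nhds.sub (tendsto_sum_mul_log_add hB.1.eigenvalues (Fintype.card C)))
    (tendsto_const_nhds.sub (tendsto_sum_mul_log_add hBC.1.eigenvalues 1))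
    (Filter.eventually_of_mem self_mem_nhdsWithin key)
  rw [CMI, vNEntropy_eq hAB.1, vNEntropy_eq hBC.1, vNEntropy_eq hB.1, vNEntropy_eq hρ.1]
  linarith

lemma eq_of_overlap_ne_zero {n : Type*} [Fintype n] [DecidableEq n] {ρ τ U V : Matrix n n ℂ}
    {p t : n → ℝ} (hρ : IsEigendecomp ρ V p) (hτ : IsEigendecomp τ U t)
    (h : ∀ i j, overlap U V i j ≠ 0 → p j = t i) : ρ = τ := by
  have hM : (Uᴴ * V) * diagonal (fun j => (p j : ℂ)) =
      diagonal (fun i => (t i : ℂ)) * (Uᴴ * V) := by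
    ext i j
    rw [mul_diagonal, diagonal_mul, mul_comm]
    by_cases h0 : overlap U V i j = 0
    · have : (Uᴴ * V) i j = 0 := by simpa [overlap] using h0
      rw [this, mul_zero, mul_zero]
    · rw [h i j h0]
  calc ρ = (U * Uᴴ) * (V * diagonal (fun j => (p j : ℂ)) * Vᴴ) := by
        rw [hτ.1, Matrix.one_mul, ← hρ.2.2]
    _ = U * ((Uᴴ * V) * diagonal (fun j => (p j : ℂ))) * Vᴴ := by simp only [Matrix.mul_assoc]
    _ = U * diagonal (fun i => (t i : ℂ)) * Uᴴ * (V * Vᴴ) := by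
        rw [hM]; simp only [Matrix.mul_assoc]
    _ = τ := by rw [hρ.1, Matrix.mul_one, ← hτ.2.2]

lemma vNEntropy_eq_sum_negMulLog {n : Type*} [Fintype n] [DecidableEq n] {ρ : Matrix n n ℂ}
    (h : ρ.IsHermitian) : vNEntropy ρ = ∑ i, Real.negMulLog (h.eigenvalues i) := by
  simp [vNEntropy_eq h, Real.negMulLog]

/-- Strict concavity of the von Neumann entropy, at midpoints. -/
theorem eq_of_vNEntropy_midpoint_le {n : Type*} [Fintype n] [DecidableEq n]
    {ρ σ : Matrix n n ℂ} (hρ : ρ.PosSemidef) (hσ : σ.PosSemidef)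
    (h : vNEntropy ((1 / 2 : ℂ) • (ρ + σ)) ≤ (vNEntropy ρ + vNEntropy σ) / 2) : ρ = σ := by
  have hτ : ((1 / 2 : ℂ) • (ρ + σ)).IsHermitian := by
    rw [IsHermitian, conjTranspose_smul, (hρ.1.add hσ.1).eq]
    simp
  rw [vNEntropy_eq_sum_negMulLog hτ, vNEntropy_eq_sum_negMulLog hρ.1,
    vNEntropy_eq_sum_negMulLog hσ.1] at h
  have dρ := hρ.1.isEigendecomp
  have dσ := hσ.1.isEigendecomp
  have dτ := hτ.isEigendecomp
  set V := (hρ.1.eigenvectorUnitary : Matrix n n ℂ)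
  set V' := (hσ.1.eigenvectorUnitary : Matrix n n ℂ)
  set U := (hτ.eigenvectorUnitary : Matrix n n ℂ)
  have hp := hρ.eigenvalues_nonneg
  have hs := hσ.eigenvalues_nonneg
  set p := hρ.1.eigenvalues
  set s := hσ.1.eigenvalues
  set t := hτ.eigenvalues
  let w : n → n ⊕ n → ℝ := fun i => Sum.elim (fun j => overlap U V i j / 2)
    (fun j => overlap U V' i j / 2)
  let x : n ⊕ n → ℝ := Sum.elim p s
  have hw0 : ∀ i, ∀ k ∈ Finset.univ, 0 ≤ w i k := by
    rintro i (j | j) -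
    · exact div_nonneg (overlap_nonneg U V i j) zero_le_two
    · exact div_nonneg (overlap_nonneg U V' i j) zero_le_two
  have hw1 : ∀ i, ∑ k, w i k = 1 := by
    intro i
    simp only [w, Fintype.sum_sum_type, Sum.elim_inl, Sum.elim_inr, ← Finset.sum_div,
      overlap_sum_row dτ.2.1 dρ.1, overlap_sum_row dτ.2.1 dσ.1]
    norm_num
  have hx : ∀ k ∈ Finset.univ, x k ∈ Set.Ici (0 : ℝ) := by
    rintro (j | j) -
    · exact hp j
    · exact hs j
  have ht : ∀ i, ∑ k, w i k • x k = t i := by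
    intro i
    have h1 : (Uᴴ * ((1 / 2 : ℂ) • (ρ + σ)) * U) i i = (t i : ℂ) := by
      conv_lhs => rw [dτ.2.2]
      have : Uᴴ * (U * diagonal (fun i => (t i : ℂ)) * Uᴴ) * U =
          (Uᴴ * U) * diagonal (fun i => (t i : ℂ)) * (Uᴴ * U) := by simp only [Matrix.mul_assoc]
      rw [this, dτ.2.1, Matrix.one_mul, Matrix.mul_one, diagonal_apply_eq]
    rw [Matrix.mul_smul, Matrix.smul_mul, Matrix.mul_add, Matrix.add_mul, Matrix.smul_apply,
      Matrix.add_apply, dρ.diag_entry, dσ.diag_entry] at h1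
    have h2 : (1 / 2 : ℝ) * (∑ j, overlap U V i j * p j + ∑ j, overlap U V' i j * s j) = t i := by
      apply Complex.ofReal_injective
      rw [← h1, smul_eq_mul]
      push_cast
      rfl
    rw [← h2]
    simp only [w, x, Fintype.sum_sum_type, Sum.elim_inl, Sum.elim_inr, smul_eq_mul, mul_add,
      Finset.mul_sum]
    congr 1 <;> exact Finset.sum_congr rfl fun j _ => by ring
  have hle : ∀ i ∈ Finset.univ, ∑ k, w i k • Real.negMulLog (x k) ≤ Real.negMulLog (t i) :=
    fun i _ => by
      rw [← ht i]
      exact Real.concaveOn_negMulLog.le_map_sum (hw0 i) (hw1 i) hx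
  have hsum : ∑ i, ∑ k, w i k • Real.negMulLog (x k) =
      (∑ j, Real.negMulLog (p j) + ∑ j, Real.negMulLog (s j)) / 2 := by
    rw [Finset.sum_comm]
    simp only [← Finset.sum_smul]
    simp only [w, x, Fintype.sum_sum_type, Sum.elim_inl, Sum.elim_inr, ← Finset.sum_div,
      overlap_sum_col dτ.1 dρ.2.1, overlap_sum_col dτ.1 dσ.2.1, smul_eq_mul, ← Finset.mul_sum]
    ring
  have heq := (Finset.sum_eq_sum_iff_of_le hle).1
    (le_antisymm (Finset.sum_le_sum hle) (h.trans hsum.ge))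
  have hk : ∀ i k, w i k ≠ 0 → x k = t i := by
    intro i k hik
    have h1 := heq i (Finset.mem_univ i)
    rw [← ht i] at h1 ⊢
    exact (Real.strictConcaveOn_negMulLog.map_sum_eq_iff' (hw0 i) (hw1 i) hx).1 h1.symm k
      (Finset.mem_univ k) hik
  have e1 := eq_of_overlap_ne_zero dρ dτ fun i j hij =>
    hk i (Sum.inl j) (div_ne_zero hij two_ne_zero)
  have e2 := eq_of_overlap_ne_zero dσ dτ fun i j hij =>
    hk i (Sum.inr j) (div_ne_zero hij two_ne_zero)
  exact e1.trans e2.symm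

/-- Two quantum Markov chains (`I(A:C|B) = 0`) with the same marginals
on `AB` and on `BC` are equal. -/
theorem markov_chains_agree_of_equal_marginals
    {A B C : Type*} [Fintype A] [DecidableEq A] [Fintype B] [DecidableEq B]
    [Fintype C] [DecidableEq C]
    (ρ σ : Matrix (A × B × C) (A × B × C) ℂ)
    (hρ : IsDensityMatrix ρ) (hσ : IsDensityMatrix σ)
    (hρM : CMI ρ = 0) (hσM : CMI σ = 0)
    (hAB : margAB ρ = margAB σ) (hBC : margBC ρ = margBC σ) :
    ρ = σ := by
  have hC : Nonempty C := by
    by_contra hC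
    rw [not_nonempty_iff] at hC
    simpa [trace] using hρ.2
  have hτ : ((1 / 2 : ℂ) • (ρ + σ)).PosSemidef :=
    (hρ.1.add hσ.1).smul (by norm_num [Complex.le_def])
  have mAB : margAB ((1 / 2 : ℂ) • (ρ + σ)) = margAB ρ := by
    have : margAB ((1 / 2 : ℂ) • (ρ + σ)) = (1 / 2 : ℂ) • (margAB ρ + margAB σ) := by
      ext
      simp [margAB, Finset.sum_add_distrib, Finset.mul_sum, mul_add]
    rw [this, ← hAB, ← two_smul ℂ, smul_smul]
    norm_num
  have mBC : margBC ((1 / 2 : ℂ) • (ρ + σ)) = margBC ρ := by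
    have : margBC ((1 / 2 : ℂ) • (ρ + σ)) = (1 / 2 : ℂ) • (margBC ρ + margBC σ) := by
      ext
      simp [margBC, Finset.sum_add_distrib, Finset.mul_sum, mul_add]
    rw [this, ← hBC, ← two_smul ℂ, smul_smul]
    norm_num
  have mB : margB ((1 / 2 : ℂ) • (ρ + σ)) = margB ρ := by
    rw [← traceFst_margAB, mAB, traceFst_margAB]
  have mB' : margB σ = margB ρ := by
    rw [← traceFst_margAB, ← hAB, traceFst_margAB]
  have hSSA := CMI_nonneg hτ
  rw [CMI, mAB, mBC, mB] at hSSA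
  rw [CMI] at hρM hσM
  rw [← hAB, ← hBC, mB'] at hσM
  exact eq_of_vNEntropy_midpoint_le hρ.1 hσ.1 (by linarith)
end
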